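/- arXiv:2510.18397 — 5 statements merged into one kernel-verified Lean document; each statement's English description precedes it below -/
import Mathlib

section
/- Let ℓ be a prime, a ≥ 1 an integer, and K = ℚ(ζ) the ℓ^a-th cyclotomic field. Let z ∈ K be a sum of n (not necessarily distinct) roots of unity, each of order dividing ℓ^a, where n is a positive integer not divisible by ℓ. Then the field norm N_{K/ℚ}(z) is a rational integer not divisible by ℓ; in particular, z ≠ 0. -/
/-- A root of unity of `p`-power order is trivial in a domain of characteristic `p`. -/
lemma eq_one_of_pow_prime_pow_eq_one {R : Type*} [CommRing R] [IsDomain R] (p : ℕ)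
    [Fact p.Prime] [CharP R p] {a : ℕ} {x : R} (hx : x ^ p ^ a = 1) : x = 1 := by
  apply iterateFrobenius_inj R p a
  rw [iterateFrobenius_def, iterateFrobenius_def, hx, one_pow]

open NumberField in
/-- In a Galois number field, a sum of `n` roots of unity of `p`-power order, with `p ∤ n`,
has norm a rational integer prime to `p`. -/
theorem exists_norm_sum_eq_intCast_and_not_dvd {K : Type*} [Field K] [NumberField K]
    [IsGalois ℚ K] {p : ℕ} (hp : p.Prime) (a : ℕ) {n : ℕ} (hpn : ¬ p ∣ n) (f : Fin n → K)
    (hf : ∀ i, f i ^ p ^ a = 1) :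
    ∃ m : ℤ, Algebra.norm ℚ (∑ i, f i) = (m : ℚ) ∧ ¬ (p : ℤ) ∣ m := by
  have : Fact p.Prime := ⟨hp⟩
  have hint (x : K) (hx : x ^ p ^ a = 1) : IsIntegral ℤ x :=
    .of_pow (pow_pos hp.pos a) (hx ▸ isIntegral_one)
  have hval (x : K) (hx : IsIntegral ℤ x) : algebraMap (𝓞 K) K ⟨x, hx⟩ = x := rfl
  let r (i : Fin n) : 𝓞 K := ⟨f i, hint _ (hf i)⟩
  let y : 𝓞 K := ∑ i, r i
  have hy : ∑ i, f i = algebraMap (𝓞 K) K y :=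
    (map_sum (algebraMap (𝓞 K) K) r Finset.univ).symm
  have hconj (σ : K ≃ₐ[ℚ] K) (i : Fin n) : σ (f i) ^ p ^ a = 1 := by
    rw [← map_pow, hf, map_one]
  let g (σ : K ≃ₐ[ℚ] K) (i : Fin n) : 𝓞 K := ⟨σ (f i), hint _ (hconj σ i)⟩
  have hg (σ : K ≃ₐ[ℚ] K) (i : Fin n) : g σ i ^ p ^ a = 1 :=
    RingOfIntegers.ext (hconj σ i)
  have hprod : ((Algebra.norm ℤ y : ℤ) : 𝓞 K) = ∏ σ, ∑ i, g σ i := by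
    apply RingOfIntegers.coe_injective
    have h := Algebra.norm_eq_prod_automorphisms ℚ (y : K)
    rw [← Algebra.coe_norm_int] at h
    rw [map_prod]
    simp only [map_sum]
    simpa [← hy, g, hval] using h
  refine ⟨Algebra.norm ℤ y, by rw [hy, Algebra.coe_norm_int], fun hdvd ↦ ?_⟩
  have hnu : ¬ IsUnit (p : 𝓞 K) := by
    intro hu
    obtain ⟨w, hw⟩ := hu.exists_right_inv
    have h := congrArg (Algebra.norm ℤ) hw
    rw [map_mul, map_one, ← map_natCast (algebraMap ℤ (𝓞 K)), Algebra.norm_algebraMap] at h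
    have h1 := (isUnit_pow_iff (Module.finrank_pos (R := ℤ) (M := 𝓞 K)).ne').1
      (IsUnit.of_mul_eq_one _ h)
    exact (Nat.prime_iff_prime_int.1 hp).not_isUnit h1
  obtain ⟨P, hP, hpP⟩ := exists_max_ideal_of_mem_nonunits (mem_nonunits_iff.2 hnu)
  have hp0 : (p : 𝓞 K ⧸ P) = 0 := by
    rw [← map_natCast (Ideal.Quotient.mk P)]
    exact Ideal.Quotient.eq_zero_iff_mem.2 hpP
  have : CharP (𝓞 K ⧸ P) p := (CharP.charP_iff_prime_eq_zero hp).2 hp0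
  have hmod := congrArg (Ideal.Quotient.mk P) hprod
  have hone (σ : K ≃ₐ[ℚ] K) (i : Fin n) : Ideal.Quotient.mk P (g σ i) = 1 :=
    eq_one_of_pow_prime_pow_eq_one p (a := a) (by rw [← map_pow, hg, map_one])
  simp only [map_intCast, map_prod, map_sum, hone, (CharP.intCast_eq_zero_iff _ p _).2 hdvd,
    Finset.sum_const, Finset.prod_const, Finset.card_univ, Fintype.card_fin, nsmul_one] at hmod
  exact hpn ((CharP.cast_eq_zero_iff (𝓞 K ⧸ P) p n).1 (eq_zero_of_pow_eq_zero hmod.symm))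

/-- In the `ℓ^a`-th cyclotomic field, the norm of a sum of `n` roots of unity of
`ℓ`-power order, with `ℓ ∤ n`, is a rational integer prime to `ℓ`; in particular the
sum is non-zero. -/
theorem norm_of_sum_of_prime_power_roots_of_unity
    (ℓ : ℕ) (hℓ : ℓ.Prime) (a : ℕ) (ha : 1 ≤ a) (n : ℕ) (hn : 0 < n) (hℓn : ¬ ℓ ∣ n)
    (z : CyclotomicField ((⟨ℓ, hℓ.pos⟩ : ℕ+) ^ a) ℚ)
    (f : Fin n → CyclotomicField ((⟨ℓ, hℓ.pos⟩ : ℕ+) ^ a) ℚ)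
    (hf : ∀ i, (f i) ^ (ℓ ^ a) = 1)
    (hz : z = ∑ i, f i) :
    (∃ m : ℤ, Algebra.norm ℚ z = (m : ℚ) ∧ ¬ (ℓ : ℤ) ∣ m) ∧ z ≠ 0 := by
  have : NeZero ℓ := ⟨hℓ.ne_zero⟩
  have : IsCyclotomicExtension {ℓ ^ a} ℚ (CyclotomicField ((⟨ℓ, hℓ.pos⟩ : ℕ+) ^ a) ℚ) :=
    CyclotomicField.isCyclotomicExtension (ℓ ^ a) ℚ
  have : IsGalois ℚ (CyclotomicField ((⟨ℓ, hℓ.pos⟩ : ℕ+) ^ a) ℚ) :=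
    IsCyclotomicExtension.isGalois {ℓ ^ a} ℚ _
  obtain ⟨m, hm, hdvd⟩ := exists_norm_sum_eq_intCast_and_not_dvd hℓ a hℓn f hf
  rw [← hz] at hm
  refine ⟨⟨m, hm, hdvd⟩, ?_⟩
  rintro rfl
  rw [Algebra.norm_zero] at hm
  exact hdvd (by simp [Int.cast_eq_zero.1 hm.symm])
end

section
/- Let G be a finite group, ℓ a prime, x ∈ G an ℓ-element, and χ an irreducible complex character of G with χ(1) not divisible by ℓ. Then χ(x) ≠ 0; moreover, the field norm of χ(x) from ℚ(χ(x)) to ℚ is a nonzero rational integer not divisible by ℓ. -/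
open IntermediateField

/-- `χ` is the character of some irreducible complex representation of `G`. -/
def IsIrrChar (G : Type) [Group G] (χ : G → ℂ) : Prop :=
  ∃ V : FDRep ℂ G, CategoryTheory.Simple V ∧ χ = V.character

theorem Multiset.exists_isIntegral_sum_pow_prime_pow_eq {A : Type*} [CommRing A] {p : ℕ}
    (hp : p.Prime) (k : ℕ) (s : Multiset A) (hs : ∀ a ∈ s, IsIntegral ℤ a) :
    ∃ r : A, IsIntegral ℤ r ∧ s.sum ^ p ^ k = (s.map (· ^ p ^ k)).sum + p * r := by
  induction s using Multiset.induction with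
  | empty =>
    exact ⟨0, isIntegral_zero, by simp [hp.ne_zero]⟩
  | cons a s ih =>
    obtain ⟨r, hr, h⟩ := ih fun b hb => hs b (Multiset.mem_cons_of_mem hb)
    have ha := hs a (Multiset.mem_cons_self a s)
    have hsum : IsIntegral ℤ s.sum :=
      IsIntegral.multiset_sum fun b hb => hs b (Multiset.mem_cons_of_mem hb)
    obtain ⟨t, ht⟩ := exists_add_pow_prime_pow_eq hp
      (⟨a, ha⟩ : integralClosure ℤ A) ⟨s.sum, hsum⟩ k
    have ht' := congrArg (Subtype.val) ht
    push_cast at ht'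
    refine ⟨a * s.sum * t + r, ((ha.mul hsum).mul t.2).add hr, ?_⟩
    rw [Multiset.sum_cons, Multiset.map_cons, Multiset.sum_cons, ht', h]
    ring

theorem LinearMap.pow_eq_one_of_mem_roots_charpoly {K V : Type*} [Field K] [AddCommGroup V]
    [Module K V] [FiniteDimensional K V] {f : V →ₗ[K] V} {n : ℕ} (hf : f ^ n = 1) {μ : K}
    (hμ : μ ∈ f.charpoly.roots) : μ ^ n = 1 := by
  have hev : Module.End.HasEigenvalue f μ :=
    (Module.End.hasEigenvalue_iff_isRoot_charpoly f μ).mpr (Polynomial.isRoot_of_mem_roots hμ)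
  obtain ⟨v, hv⟩ := hev.exists_hasEigenvector
  have h := hv.pow_apply n
  rw [hf, Module.End.one_apply] at h
  refine smul_left_injective K hv.2 ?_
  simpa using h.symm

/-- The trace of an endomorphism of `p`-power order is an algebraic integer whose `p ^ k`-th power
is congruent to the dimension modulo `p`. -/
theorem LinearMap.exists_isIntegral_trace_pow_prime_pow_eq {K V : Type*} [Field K] [IsAlgClosed K]
    [AddCommGroup V] [Module K V] [FiniteDimensional K V] {p : ℕ} (hp : p.Prime) {k : ℕ}
    {f : V →ₗ[K] V} (hf : f ^ p ^ k = 1) :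
    IsIntegral ℤ (LinearMap.trace K V f) ∧ ∃ r : K, IsIntegral ℤ r ∧
      LinearMap.trace K V f ^ p ^ k = Module.finrank K V + p * r := by
  have hsplits : f.charpoly.Splits := IsAlgClosed.splits _
  have htr : LinearMap.trace K V f = f.charpoly.roots.sum :=
    Module.End.trace_eq_sum_roots_charpoly_of_splits hsplits
  have hpow : ∀ μ ∈ f.charpoly.roots, μ ^ p ^ k = 1 := fun μ hμ =>
    pow_eq_one_of_mem_roots_charpoly hf hμ
  have hint : ∀ μ ∈ f.charpoly.roots, IsIntegral ℤ μ := fun μ hμ =>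
    IsIntegral.of_pow (pow_pos hp.pos k) (by rw [hpow μ hμ]; exact isIntegral_one)
  obtain ⟨r, hr, h⟩ := Multiset.exists_isIntegral_sum_pow_prime_pow_eq hp k _ hint
  refine ⟨htr ▸ IsIntegral.multiset_sum hint, r, hr, ?_⟩
  rw [htr, h, Multiset.map_congr rfl hpow, Multiset.map_const', Multiset.sum_replicate,
    nsmul_one, ← hsplits.natDegree_eq_card_roots, LinearMap.charpoly_natDegree]

theorem Algebra.norm_add_natCast_mul_modEq {S : Type*} [CommRing S]
    [Module.Free ℤ S] [Module.Finite ℤ S] (p d : ℕ) (s : S) :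
    Algebra.norm ℤ ((d : S) + p * s) ≡ (d : ℤ) ^ Module.finrank ℤ S [ZMOD p] := by
  classical
  let b := Module.Free.chooseBasis ℤ S
  rw [← ZMod.intCast_eq_intCast_iff, Algebra.norm_eq_matrix_det b,
    Module.finrank_eq_card_basis b]
  change Int.castRingHom (ZMod p) _ = _
  rw [RingHom.map_det, map_add, map_mul, map_natCast, map_natCast, map_add, map_mul,
    map_natCast, map_natCast]
  have hp : ((p : ℕ) : Matrix (Module.Free.ChooseBasisIndex ℤ S)
      (Module.Free.ChooseBasisIndex ℤ S) (ZMod p)) = 0 := by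
    rw [← Matrix.diagonal_natCast]; simp
  rw [hp, zero_mul, add_zero, ← Matrix.diagonal_natCast, Matrix.det_diagonal]
  simp

theorem NumberField.not_dvd_norm_of_pow_eq_natCast_add {K : Type*} [Field K] [NumberField K]
    {p : ℕ} (hp : p.Prime) {d n : ℕ} (hd : ¬ p ∣ d) {a s : NumberField.RingOfIntegers K}
    (h : a ^ n = d + p * s) (hn : n ≠ 0) : ¬ (p : ℤ) ∣ Algebra.norm ℤ a := by
  intro hdvd
  have hmod := Algebra.norm_add_natCast_mul_modEq p d s
  rw [← h, map_pow] at hmod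
  have hdvd' := hmod.dvd_iff.mp (dvd_pow hdvd hn)
  exact hd (Int.natCast_dvd_natCast.mp ((Nat.prime_iff_prime_int.mp hp).dvd_of_dvd_pow hdvd'))

/-- If `x` is an `ℓ`-element of a finite group `G` and `χ` is an irreducible complex
character of `G` of degree prime to `ℓ`, then `χ(x) ≠ 0` and the field norm of `χ(x)`
from `ℚ(χ(x))` to `ℚ` is a non-zero rational integer prime to `ℓ`. -/
theorem char_value_nonzero_of_degree_coprime
    (G : Type) [Group G] [Fintype G] (ℓ : ℕ) (hℓ : ℓ.Prime)
    (x : G) (hx : ∃ k : ℕ, orderOf x = ℓ ^ k)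
    (χ : G → ℂ) (V : FDRep ℂ G) (hV : CategoryTheory.Simple V) (hχ : χ = V.character)
    (hdeg : ¬ ℓ ∣ Module.finrank ℂ V) :
    χ x ≠ 0 ∧
      ∃ m : ℤ, Algebra.norm ℚ (IntermediateField.AdjoinSimple.gen ℚ (χ x)) = (m : ℚ) ∧
        m ≠ 0 ∧ ¬ (ℓ : ℤ) ∣ m := by
  obtain ⟨k, hk⟩ := hx
  have hρ : V.ρ x ^ ℓ ^ k = 1 := by rw [← map_pow, ← hk, pow_orderOf_eq_one, map_one]
  obtain ⟨hint, r, hr, hpow⟩ := LinearMap.exists_isIntegral_trace_pow_prime_pow_eq hℓ hρ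
  have htr : LinearMap.trace ℂ V (V.ρ x) = χ x := by rw [hχ]; rfl
  rw [htr] at hint hpow
  have hℓ0 : (ℓ : ℂ) ≠ 0 := Nat.cast_ne_zero.mpr hℓ.ne_zero
  let K := ℚ⟮χ x⟯
  have : FiniteDimensional ℚ K := IntermediateField.adjoin.finiteDimensional hint.tower_top
  have : NumberField K := ⟨⟩
  have hrK : r ∈ K := by
    have hr' : r = (χ x ^ ℓ ^ k - (Module.finrank ℂ V : ℕ)) / (ℓ : ℕ) := by
      rw [hpow]; field_simp; ring
    rw [hr']
    exact div_mem (sub_mem (pow_mem (IntermediateField.mem_adjoin_simple_self ℚ _) _)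
      (_root_.natCast_mem _ _)) (_root_.natCast_mem _ _)
  have hinj : Function.Injective (algebraMap K ℂ) := (algebraMap K ℂ).injective
  let a : NumberField.RingOfIntegers K := ⟨IntermediateField.AdjoinSimple.gen ℚ (χ x),
    (isIntegral_algebraMap_iff hinj).mp hint⟩
  let s : NumberField.RingOfIntegers K := ⟨⟨r, hrK⟩, (isIntegral_algebraMap_iff hinj).mp hr⟩
  have ha : algebraMap K ℂ (algebraMap _ K a) = χ x := rfl
  have hs : algebraMap K ℂ (algebraMap _ K s) = r := rfl
  have has : a ^ ℓ ^ k = (Module.finrank ℂ V : ℕ) + ℓ * s := by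
    apply NumberField.RingOfIntegers.coe_injective
    apply hinj
    simp only [map_pow, map_add, map_mul, map_natCast, ha, hs, hpow]
  have hnd := NumberField.not_dvd_norm_of_pow_eq_natCast_add hℓ hdeg has
    (pow_ne_zero k hℓ.ne_zero)
  have hm0 : Algebra.norm ℤ a ≠ 0 := fun h => hnd (h ▸ dvd_zero _)
  refine ⟨fun h0 => hm0 ?_, Algebra.norm ℤ a, (Algebra.coe_norm_int a).symm, hm0, hnd⟩
  have ha0 : a = 0 := by
    apply NumberField.RingOfIntegers.coe_injective
    apply hinj
    simp only [ha, h0, map_zero]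
  rw [ha0, Algebra.norm_zero]
end

section
/- Let G be a finite group, ℓ a prime, K ≤ G a subgroup containing some Sylow ℓ-subgroup of G, and H a normal subgroup of K. Suppose that the Sylow ℓ-subgroups of the quotient K/H are not normal in K/H. Then every ℓ-element of H lies in at least two distinct Sylow ℓ-subgroups of G; in particular, no ℓ-element of H is picky in G. -/
/-- If an element of a normal subgroup `N` of `K` lies in a unique Sylow `p`-subgroup of `K`,
then `K ⧸ N` has a normal Sylow `p`-subgroup. -/
theorem Sylow.exists_normal_quotient_of_existsUnique_mem {K : Type*} [Group K] [Finite K] {p : ℕ}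
    [Fact p.Prime] (N : Subgroup K) [N.Normal] {x : K} (hxN : x ∈ N)
    (hx : ∃! P : Sylow p K, x ∈ P) :
    ∃ T : Sylow p (K ⧸ N), (T : Subgroup (K ⧸ N)).Normal := by
  obtain ⟨P₀, hxP₀, hP₀⟩ := hx
  have hpow : IsPGroup p (Subgroup.zpowers (⟨x, hxN⟩ : N)) := by
    have h : IsPGroup p ((P₀ : Subgroup K).subgroupOf N) := P₀.isPGroup'.comap_subtype
    exact h.to_le (Subgroup.zpowers_le.2 (Subgroup.mem_subgroupOf.2 hxP₀))
  obtain ⟨R, hR⟩ := hpow.exists_le_sylow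
  have hxR : x ∈ (R : Subgroup N).map N.subtype :=
    ⟨⟨x, hxN⟩, hR (Subgroup.mem_zpowers _), rfl⟩
  have hRP₀ : (R : Subgroup N).map N.subtype ≤ P₀ := by
    obtain ⟨P, hP⟩ := (R.isPGroup'.map N.subtype).exists_le_sylow
    exact hP₀ P (hP hxR) ▸ hP
  have hnormalizer : Subgroup.normalizer ((R : Subgroup N).map N.subtype : Set K) ≤
      Subgroup.normalizer (P₀ : Set K) := by
    intro g hg
    refine Sylow.smul_eq_iff_mem_normalizer.1 (hP₀ (g • P₀) ?_)
    have hconj : g⁻¹ * x * g ∈ (R : Subgroup N).map N.subtype :=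
      (Subgroup.mem_normalizer_iff''.1 hg x).1 hxR
    refine ⟨g⁻¹ * x * g, hRP₀ hconj, ?_⟩
    simp [mul_assoc]
  have hsurj := QuotientGroup.mk'_surjective N
  refine ⟨P₀.mapSurjective hsurj, ?_⟩
  rw [Sylow.coe_mapSurjective, ← Subgroup.normalizer_eq_top_iff, eq_top_iff]
  have hmap := congrArg (Subgroup.map (QuotientGroup.mk' N)) R.normalizer_sup_eq_top
  rw [Subgroup.map_sup, QuotientGroup.map_mk'_self, sup_bot_eq,
    Subgroup.map_top_of_surjective _ hsurj] at hmap
  rw [← hmap]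
  exact (Subgroup.map_mono hnormalizer).trans (Subgroup.le_normalizer_map _)

/-- Let `K ≤ G` contain a Sylow `ℓ`-subgroup of `G` and let `H` be normal in `K`.
If the Sylow `ℓ`-subgroups of `K/H` are not normal, then every `ℓ`-element of `H`
lies in at least two distinct Sylow `ℓ`-subgroups of `G`; in particular no `ℓ`-element
of `H` is picky in `G`. -/
theorem not_picky_of_nonnormal_sylow_in_quotient
    (G : Type*) [Group G] [Fintype G] (ℓ : ℕ) (hℓ : ℓ.Prime)
    (K H : Subgroup G) (hHK : H ≤ K) (hnorm : (H.subgroupOf K).Normal)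
    (S : Sylow ℓ G) (hSK : (S : Subgroup G) ≤ K)
    (hq : ∀ T : Sylow ℓ (K ⧸ H.subgroupOf K), ¬ (T : Subgroup (K ⧸ H.subgroupOf K)).Normal)
    (x : G) (hxH : x ∈ H) (hx : ∃ k : ℕ, orderOf x = ℓ ^ k) :
    (∃ P Q : Sylow ℓ G, P ≠ Q ∧ x ∈ P ∧ x ∈ Q) ∧ ¬ ∃! P : Sylow ℓ G, x ∈ P := by
  have : Fact ℓ.Prime := ⟨hℓ⟩
  suffices h : ∃ P Q : Sylow ℓ G, P ≠ Q ∧ x ∈ P ∧ x ∈ Q by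
    refine ⟨h, fun hu => ?_⟩
    obtain ⟨P, Q, hne, hP, hQ⟩ := h
    exact hne (hu.unique hP hQ)
  let y : K := ⟨x, hHK hxH⟩
  have hpow : IsPGroup ℓ (Subgroup.zpowers y) := by
    obtain ⟨k, hk⟩ := hx
    refine IsPGroup.of_card (n := k) ?_
    rw [Nat.card_zpowers, ← hk, Subgroup.orderOf_mk]
  obtain ⟨P, hP⟩ := hpow.exists_le_sylow
  have hyP : y ∈ P := hP (Subgroup.mem_zpowers y)
  obtain ⟨Q, hyQ, hQP⟩ : ∃ Q : Sylow ℓ K, y ∈ Q ∧ Q ≠ P := by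
    by_contra! h
    obtain ⟨T, hT⟩ := Sylow.exists_normal_quotient_of_existsUnique_mem (H.subgroupOf K)
      (Subgroup.mem_subgroupOf.2 hxH : y ∈ H.subgroupOf K) ⟨P, hyP, h⟩
    exact hq T hT
  obtain ⟨P', hP'⟩ := P.exists_comap_subtype_eq
  obtain ⟨Q', hQ'⟩ := Q.exists_comap_subtype_eq
  refine ⟨P', Q', ?_, ?_, ?_⟩
  · rintro rfl
    exact hQP (Sylow.ext (hQ'.symm.trans hP'))
  · exact (hP'.ge hyP : y ∈ (P' : Subgroup G).comap K.subtype)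
  · exact (hQ'.ge hyQ : y ∈ (Q' : Subgroup G).comap K.subtype)
end

section
/- Let q be an odd prime power and n ≥ 6 an integer. Then the group SL_n(𝔽_q) possesses no picky 2-element; that is, no element of 2-power order of SL_n(𝔽_q) lies in a unique Sylow 2-subgroup. -/
/-- The elements `x` and `y` of a monoid are units and generate a `2`-group. -/
def TwoPair {M : Type*} [Monoid M] (x y : M) : Prop :=
  ∃ X Y : Mˣ, (X : M) = x ∧ (Y : M) = y ∧ IsPGroup 2 (Subgroup.closure {X, Y})

namespace TwoPair

variable {M N : Type*} [Monoid M] [Monoid N]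

theorem symm {x y : M} (h : TwoPair x y) : TwoPair y x := by
  obtain ⟨X, Y, hX, hY, h⟩ := h
  exact ⟨Y, X, hY, hX, by rwa [Set.pair_comm]⟩

theorem map {x y : M} (h : TwoPair x y) (φ : M →* N) : TwoPair (φ x) (φ y) := by
  obtain ⟨X, Y, rfl, rfl, h⟩ := h
  refine ⟨Units.map φ X, Units.map φ Y, rfl, rfl, ?_⟩
  have := h.map (Units.map φ)
  rwa [MonoidHom.map_closure, Set.image_pair] at this

theorem isPGroup_zpowers {G : Type*} [Group G] {x : G} {k : ℕ} (hx : x ^ 2 ^ k = 1) :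
    IsPGroup 2 (Subgroup.zpowers x) := by
  rintro ⟨_, m, rfl⟩
  refine ⟨k, Subtype.ext ?_⟩
  simp [← zpow_natCast, ← zpow_mul, mul_comm m]
  rw [zpow_mul, ← Nat.cast_ofNat, ← Nat.cast_pow, zpow_natCast, hx, one_zpow]

/-- If `x` commutes with its conjugate `x'` by `y`, and with `y ^ 2`, then two `2`-elements
`x`, `y` generate a `2`-group. -/
theorem of_conj_commute {x x' y : M} {k l : ℕ} (hx : x ^ 2 ^ k = 1) (hy : y ^ 2 ^ l = 1)
    (h : y * x = x' * y) (hc : x * x' = x' * x) (h2 : y * y * x = x * (y * y)) :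
    TwoPair x y := by
  let X := Units.ofPowEqOne x _ hx (by positivity)
  let Y := Units.ofPowEqOne y _ hy (by positivity)
  have hX : X ^ 2 ^ k = 1 := Units.pow_ofPowEqOne hx _
  have hY : Y ^ 2 ^ l = 1 := Units.pow_ofPowEqOne hy _
  obtain ⟨X', hX'⟩ : ∃ X', X' = Y * X * Y⁻¹ := ⟨_, rfl⟩
  have hxx : (X' : M) = x' := by
    rw [hX', Units.val_mul, Units.mul_inv_eq_iff_eq_mul]
    exact h
  have hcom : X * X' = X' * X := Units.ext (by
    rw [Units.val_mul, Units.val_mul, hxx]; exact hc)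
  have hYX : Y * X' * Y⁻¹ = X := by
    have : Y * Y * X = X * (Y * Y) := Units.ext h2
    rw [hX']
    calc Y * (Y * X * Y⁻¹) * Y⁻¹ = (Y * Y * X) * (Y⁻¹ * Y⁻¹) := by group
      _ = X := by rw [this]; group
  have hX'2 : X' ^ 2 ^ k = 1 := by rw [hX', conj_pow, hX]; simp
  have hA : IsPGroup 2 (Subgroup.zpowers X ⊔ Subgroup.zpowers X' : Subgroup Mˣ) := by
    refine (isPGroup_zpowers hX).to_sup_of_normal_right' (isPGroup_zpowers hX'2) ?_
    rw [Subgroup.zpowers_le, Subgroup.mem_normalizer_iff_map_conj_eq, MonoidHom.map_zpowers]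
    simp [MulAut.conj_apply, hcom]
  have hB := (isPGroup_zpowers hY).to_sup_of_normal_right' hA (by
    rw [Subgroup.zpowers_le, Subgroup.mem_normalizer_iff_map_conj_eq, Subgroup.map_sup,
      MonoidHom.map_zpowers, MonoidHom.map_zpowers]
    simp [MulAut.conj_apply, hYX, ← hX', sup_comm])
  refine ⟨X, Y, rfl, rfl, hB.to_le ?_⟩
  rw [Subgroup.closure_le]
  rintro z (rfl | rfl)
  · exact Subgroup.mem_sup_right (Subgroup.mem_sup_left (Subgroup.mem_zpowers _))
  · exact Subgroup.mem_sup_left (Subgroup.mem_zpowers _)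

theorem of_commute {x y : M} {k l : ℕ} (hx : x ^ 2 ^ k = 1) (hy : y ^ 2 ^ l = 1)
    (h : y * x = x * y) : TwoPair x y :=
  of_conj_commute hx hy h rfl (by rw [mul_assoc, h, ← mul_assoc, h, mul_assoc])

theorem exists_pow_eq_one {x y : M} (h : TwoPair x y) : ∃ k, y ^ 2 ^ k = 1 := by
  obtain ⟨X, Y, rfl, rfl, h⟩ := h
  obtain ⟨k, hk⟩ := h ⟨Y, Subgroup.subset_closure (by simp)⟩
  exact ⟨k, by simpa [Subtype.ext_iff, Units.ext_iff] using hk⟩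

theorem prod {x y : M} {x' y' : N} (h : TwoPair x y) (h' : TwoPair x' y') :
    TwoPair (x, x') (y, y') := by
  obtain ⟨X, Y, rfl, rfl, h⟩ := h
  obtain ⟨X', Y', rfl, rfl, h'⟩ := h'
  refine ⟨MulEquiv.prodUnits.symm (X, X'), MulEquiv.prodUnits.symm (Y, Y'), rfl, rfl, ?_⟩
  have key : ∀ g ∈ Subgroup.closure
      {MulEquiv.prodUnits.symm (X, X'), MulEquiv.prodUnits.symm (Y, Y')},
      (MulEquiv.prodUnits g).1 ∈ Subgroup.closure {X, Y} ∧
      (MulEquiv.prodUnits g).2 ∈ Subgroup.closure {X', Y'} := by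
    intro g hg
    have : Subgroup.closure {MulEquiv.prodUnits.symm (X, X'), MulEquiv.prodUnits.symm (Y, Y')} ≤
        ((Subgroup.closure {X, Y}).prod (Subgroup.closure {X', Y'})).comap
          MulEquiv.prodUnits.toMonoidHom := by
      rw [Subgroup.closure_le]
      rintro _ (rfl | rfl) <;>
      · simp only [SetLike.mem_coe, Subgroup.mem_comap]
        constructor <;> exact Subgroup.subset_closure (by simp)
    exact this hg
  rintro ⟨g, hg⟩
  obtain ⟨h1, h2⟩ := key g hg
  obtain ⟨k, hk⟩ := h ⟨_, h1⟩
  obtain ⟨l, hl⟩ := h' ⟨_, h2⟩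
  refine ⟨k + l, Subtype.ext (MulEquiv.prodUnits.injective (Prod.ext ?_ ?_))⟩
  · have hk : (MulEquiv.prodUnits g).1 ^ 2 ^ k = 1 := congrArg Subtype.val hk
    simp [pow_add, pow_mul, hk]
  · have hl : (MulEquiv.prodUnits g).2 ^ 2 ^ l = 1 := congrArg Subtype.val hl
    simp [pow_add, mul_comm (2 ^ k), pow_mul, hl]

/-- Conjugating `y⁻¹` by a unit `c` commuting with `x` preserves `TwoPair x`. -/
theorem exists_commutator {x y : M} (h : TwoPair x y) (c : Mˣ) (hc : (c : M) * x = x * c) {g : M}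
    (hg : y * c = g * c * y) :
    ∃ z, TwoPair x z ∧ y * z = g ∧ z * c * y = c := by
  obtain ⟨X, Y, rfl, rfl, h⟩ := h
  have hcX : c * X * c⁻¹ = X := mul_inv_eq_of_eq_mul (Units.ext hc)
  refine ⟨(c * Y⁻¹ * c⁻¹ : Mˣ), ⟨X, _, rfl, rfl, ?_⟩, ?_, ?_⟩
  · have := h.map (MulAut.conj c).toMonoidHom
    refine this.to_le ?_
    rw [Subgroup.closure_le]
    rintro z (rfl | rfl)
    · exact ⟨z, Subgroup.subset_closure (by simp), by simpa using hcX⟩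
    · exact ⟨Y⁻¹, inv_mem (Subgroup.subset_closure (by simp)), by simp⟩
  · rw [← Units.val_mul, ← mul_assoc, ← mul_assoc, Units.val_mul, Units.mul_inv_eq_iff_eq_mul,
      Units.val_mul, Units.mul_inv_eq_iff_eq_mul, Units.val_mul, hg]
  · rw [← Units.val_mul, ← Units.val_mul]
    simp

end TwoPair

/-- The endomorphism `f` generates a `2`-group together with each of two endomorphisms `y`, `z`
of determinant one whose product has a non-trivial orbit of odd length. -/
def HasOddProduct (F : Type*) {V : Type*} [Field F] [AddCommGroup V] [Module F V]
    (f : Module.End F V) : Prop :=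
  ∃ y z : Module.End F V, LinearMap.det y = 1 ∧ LinearMap.det z = 1 ∧ TwoPair f y ∧ TwoPair f z ∧
    ∃ v m, Odd m ∧ ((y * z) ^ m) v = v ∧ (y * z) v ≠ v

theorem apply_eq_self_of_odd_period {F V : Type*} [Field F] [AddCommGroup V] [Module F V]
    {g : Module.End F V} {k m : ℕ} {v : V} (hg : g ^ 2 ^ k = 1) (hm : Odd m)
    (hv : (g ^ m) v = v) : g v = v := by
  have h1 : Function.IsPeriodicPt g m v := by
    rw [Function.IsPeriodicPt, Function.IsFixedPt, ← Module.End.pow_apply, hv]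
  have h2 : Function.IsPeriodicPt g (2 ^ k) v := by
    rw [Function.IsPeriodicPt, Function.IsFixedPt, ← Module.End.pow_apply, hg]; rfl
  have h := h1.gcd h2
  rw [(Nat.Coprime.pow_right k hm.coprime_two_right).gcd_eq_one] at h
  simpa [Function.IsPeriodicPt, Function.IsFixedPt] using h

/-- The endomorphisms `f` and `g` are conjugate by a linear equivalence. -/
def SimilarEnd {F V W : Type*} [Field F] [AddCommGroup V] [Module F V] [AddCommGroup W]
    [Module F W] (f : Module.End F V) (g : Module.End F W) : Prop :=
  ∃ e : V ≃ₗ[F] W, ∀ v, e (f v) = g (e v)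

namespace SimilarEnd

variable {F V W U X : Type*} [Field F] [AddCommGroup V] [Module F V] [AddCommGroup W] [Module F W]
  [AddCommGroup U] [Module F U] [AddCommGroup X] [Module F X]

theorem refl (f : Module.End F V) : SimilarEnd f f := ⟨.refl F V, fun _ => rfl⟩

theorem symm {f : Module.End F V} {g : Module.End F W} (h : SimilarEnd f g) : SimilarEnd g f := by
  obtain ⟨e, he⟩ := h
  exact ⟨e.symm, fun w => e.injective (by simp [he])⟩

theorem trans {f : Module.End F V} {g : Module.End F W} {h : Module.End F U}
    (h1 : SimilarEnd f g) (h2 : SimilarEnd g h) : SimilarEnd f h := by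
  obtain ⟨e, he⟩ := h1
  obtain ⟨e', he'⟩ := h2
  exact ⟨e.trans e', fun v => by simp [he, he']⟩

theorem prodMap {f : Module.End F V} {g : Module.End F W} {f' : Module.End F U}
    {g' : Module.End F X} (h1 : SimilarEnd f g) (h2 : SimilarEnd f' g') :
    SimilarEnd (f.prodMap f') (g.prodMap g') := by
  obtain ⟨e, he⟩ := h1
  obtain ⟨e', he'⟩ := h2
  exact ⟨e.prodCongr e', fun v => by simp [he, he']⟩

theorem conj_eq {f : Module.End F V} {g : Module.End F W} {e : V ≃ₗ[F] W}
    (he : ∀ v, e (f v) = g (e v)) : e.conj f = g := by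
  ext w
  simp [LinearEquiv.conj_apply, he]

theorem pow_eq_one {f : Module.End F V} {g : Module.End F W} (h : SimilarEnd f g) {m : ℕ}
    (hf : f ^ m = 1) : g ^ m = 1 := by
  obtain ⟨e, he⟩ := h
  rw [← conj_eq he]
  exact (map_pow e.conjRingEquiv f m).symm.trans (by rw [hf, map_one])

theorem det_eq {f : Module.End F V} {g : Module.End F W} (h : SimilarEnd f g) :
    LinearMap.det f = LinearMap.det g := by
  obtain ⟨e, he⟩ := h
  rw [← conj_eq he, LinearEquiv.conj_apply, LinearMap.comp_assoc, LinearMap.det_conj]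

theorem hasOddProduct {f : Module.End F V} {g : Module.End F W} (h : SimilarEnd f g)
    (hg : HasOddProduct F g) : HasOddProduct F f := by
  obtain ⟨e, he⟩ := h.symm
  obtain ⟨y, z, hy, hz, hfy, hfz, v, m, hm, h1, h2⟩ := hg
  refine ⟨e.conj y, e.conj z, ?_, ?_, ?_, ?_, e v, m, hm, ?_, ?_⟩
  · rw [LinearEquiv.conj_apply, LinearMap.comp_assoc, LinearMap.det_conj, hy]
  · rw [LinearEquiv.conj_apply, LinearMap.comp_assoc, LinearMap.det_conj, hz]
  · rw [← conj_eq he]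
    exact hfy.map e.conjRingEquiv.toMonoidHom
  · rw [← conj_eq he]
    exact hfz.map e.conjRingEquiv.toMonoidHom
  · have : (e.conj y * e.conj z) ^ m = e.conj ((y * z) ^ m) :=
      ((map_pow e.conjRingEquiv _ m).trans
        (congrArg (· ^ m) (map_mul e.conjRingEquiv y z))).symm
    rw [this]
    simp [LinearEquiv.conj_apply, h1]
  · have : e.conj y * e.conj z = e.conj (y * z) :=
      (map_mul e.conjRingEquiv y z).symm
    rw [this]
    simpa [LinearEquiv.conj_apply] using h2

end SimilarEnd

/-- An element of `SL_n` whose associated endomorphism satisfies `HasOddProduct` lies in several Sylow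
`2`-subgroups. -/
theorem not_existsUnique_sylow_of_hasOddProduct {F ι : Type*} [Field F] [Fintype ι] [DecidableEq ι]
    {x : Matrix.SpecialLinearGroup ι F}
    (hx : HasOddProduct F (Matrix.toLin' (x : Matrix ι ι F))) :
    ¬ ∃! P : Sylow 2 (Matrix.SpecialLinearGroup ι F), x ∈ P := by
  rintro ⟨P, -, hP⟩
  let φ : Matrix.SpecialLinearGroup ι F →* Module.End F (ι → F) :=
    (Matrix.toLinAlgEquiv' (R := F) (n := ι)).toMonoidHom.comp Matrix.SpecialLinearGroup.coeMonoidHom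
  have hφ : ∀ A, φ A = Matrix.toLin' (A : Matrix ι ι F) := fun A => rfl
  have hφinj : Function.Injective φ := fun A B h => Subtype.ext (Matrix.toLin'.injective h)
  have key : ∀ y : Module.End F (ι → F), LinearMap.det y = 1 → TwoPair (φ x) y →
      ∃ Y ∈ P, φ Y = y := by
    rintro y hy ⟨X, Y, hX, rfl, h⟩
    have hdet : (LinearMap.toMatrix' (Y : Module.End F (ι → F))).det = 1 := by
      rw [LinearMap.det_toMatrix', hy]
    let Y' : Matrix.SpecialLinearGroup ι F := ⟨_, hdet⟩
    have hY' : φ Y' = Y := Matrix.toLin'_toMatrix' _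
    refine ⟨Y', ?_, hY'⟩
    have hc : IsPGroup 2 (Subgroup.closure {x, Y'}) := by
      refine (h.comap_of_injective φ.toHomUnits
        (fun A B hAB => hφinj (congrArg Units.val hAB))).to_le ?_
      rw [Subgroup.closure_le]
      rintro z (rfl | rfl)
      · exact Subgroup.subset_closure (Or.inl (Units.ext hX.symm))
      · exact Subgroup.subset_closure (Or.inr (Units.ext hY'))
    obtain ⟨Q, hQ⟩ := hc.exists_le_sylow
    rw [← hP Q (hQ (Subgroup.subset_closure (by simp)))]
    exact hQ (Subgroup.subset_closure (by simp))
  obtain ⟨y, z, hy, hz, hxy, hxz, v, m, hm, h1, h2⟩ := hx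
  obtain ⟨Y, hYP, rfl⟩ := key y hy hxy
  obtain ⟨Z, hZP, rfl⟩ := key z hz hxz
  obtain ⟨k, hk⟩ := P.isPGroup' ⟨Y * Z, mul_mem hYP hZP⟩
  refine h2 (apply_eq_self_of_odd_period (k := k) ?_ hm h1)
  rw [← map_mul, ← map_pow, show (Y * Z) ^ 2 ^ k = 1 from congrArg Subtype.val hk, map_one]

section Constructions

variable {F A V W : Type*} [Field F] [CommRing A] [Algebra F A] [AddCommGroup V] [Module F V]
  [AddCommGroup W] [Module F W]

theorem TwoPair.prodMap {f y : Module.End F V} {g z : Module.End F W} (h : TwoPair f y)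
    (h' : TwoPair g z) :
    TwoPair (f.prodMap g : Module.End F (V × W)) (y.prodMap z : Module.End F (V × W)) :=
  (h.prod h').map (LinearMap.prodMapRingHom F V W).toMonoidHom

theorem LinearMap.mulLeft_pow_eq_one {a : A} {m : ℕ} (h : a ^ m = 1) :
    (LinearMap.mulLeft F a : Module.End F A) ^ m = 1 := by
  rw [LinearMap.pow_mulLeft, h, LinearMap.mulLeft_one]; rfl

/-- The endomorphism `v ↦ s * τ v` of an algebra. -/
def twistedMul (s : A) (τ : A →ₐ[F] A) : Module.End F A :=
  LinearMap.mulLeft F s * τ.toLinearMap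

@[simp]
theorem twistedMul_apply (s : A) (τ : A →ₐ[F] A) (v : A) : twistedMul s τ v = s * τ v := rfl

theorem twoPair_twistedMul {ζ s : A} {τ : A →ₐ[F] A} (hτ : ∀ v, τ (τ v) = v) {k l : ℕ}
    (hζ : ζ ^ 2 ^ k = 1) (hs : (s * τ s) ^ 2 ^ l = 1) :
    TwoPair (LinearMap.mulLeft F ζ : Module.End F A) (twistedMul s τ) := by
  have hsq : (twistedMul s τ) ^ 2 = LinearMap.mulLeft F (s * τ s) := by
    ext v
    simp [pow_two, hτ]
  refine TwoPair.of_conj_commute (x' := LinearMap.mulLeft F (τ ζ)) (k := k) (l := l + 1)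
    (LinearMap.mulLeft_pow_eq_one hζ) ?_ ?_ ?_ ?_
  · rw [pow_succ', pow_mul, hsq]
    exact LinearMap.mulLeft_pow_eq_one hs
  · ext v
    simp; ring
  · ext v
    simp; ring
  · rw [← pow_two, hsq]
    ext v
    simp; ring

theorem hasOddProduct_of_twistedMul [Module.Finite F A] [Module.Finite F W] {ζ s : A}
    {τ : A →ₐ[F] A}
    (hτ : ∀ v, τ (τ v) = v) {k l m r : ℕ} (hζ : ζ ^ 2 ^ k = 1) (hs : (s * τ s) ^ 2 ^ l = 1)
    (hdet : LinearMap.det (twistedMul s τ) = 1) {h : Module.End F W} (hh : h ^ 2 ^ m = 1) (c d : A)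
    (hcd : c * d = 1) (hr : Odd r) (hc : (τ c * d) ^ r = 1) (hc' : τ c * d ≠ 1) :
    HasOddProduct F ((LinearMap.mulLeft F ζ).prodMap h) := by
  have hpair : TwoPair ((LinearMap.mulLeft F ζ).prodMap h : Module.End F (A × W))
      ((twistedMul s τ).prodMap 1 : Module.End F (A × W)) :=
    (twoPair_twistedMul hτ hζ hs).prodMap
      (TwoPair.of_commute (k := m) (l := 0) hh (by simp) (by simp))
  have hinv : ∀ c d : A, c * d = 1 → ((LinearMap.mulLeft F c).prodMap 1 : Module.End F (A × W)) *
      (LinearMap.mulLeft F d).prodMap 1 = 1 := by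
    intro c d h
    ext v <;> simp [← mul_assoc, h]
  let C : (Module.End F (A × W))ˣ :=
    ⟨(LinearMap.mulLeft F c).prodMap 1, (LinearMap.mulLeft F d).prodMap 1,
      hinv c d hcd, hinv d c (by rw [mul_comm, hcd])⟩
  have hC : (C : Module.End F (A × W)) = (LinearMap.mulLeft F c).prodMap 1 := rfl
  obtain ⟨z, hz, hyz, hzy⟩ := hpair.exists_commutator C
    (g := (LinearMap.mulLeft F (τ c * d)).prodMap 1)
    (by rw [hC]; ext v <;> simp; ring)
    (by
      rw [hC]
      ext v
      · simp only [LinearMap.comp_apply, Module.End.mul_apply, LinearMap.prodMap_apply,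
          LinearMap.inl_apply, LinearMap.mulLeft_apply, twistedMul_apply, map_mul]
        linear_combination (- τ c * s * τ v) * hcd
      all_goals simp)
  have hdety : LinearMap.det ((twistedMul s τ).prodMap 1 : Module.End F (A × W)) = 1 := by
    rw [LinearMap.det_prodMap, hdet, map_one, one_mul]
  have hpow : ∀ n : ℕ, (((LinearMap.mulLeft F (τ c * d)).prodMap 1 : Module.End F (A × W)) ^ n)
      (1, 0) = ((τ c * d) ^ n, 0) := by
    intro n
    induction n with
    | zero => simp
    | succ n ih => rw [pow_succ', Module.End.mul_apply, ih]; simp [pow_succ', mul_assoc]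
  refine ⟨_, z, hdety, ?_, hpair, hz, (1, 0), r, hr, ?_, ?_⟩
  · have hCdet : LinearMap.det (C : Module.End F (A × W)) ≠ 0 :=
      (C.isUnit.map (LinearMap.det (M := A × W))).ne_zero
    have := congrArg LinearMap.det hzy
    rw [map_mul, map_mul, hdety, mul_one] at this
    exact mul_eq_right₀ hCdet |>.mp this
  · rw [hyz, hpow, hc]
  · rw [hyz]
    simpa using hc'

/-- A `2`-element of a finite field is the norm of a `2`-element of any finite extension. -/
theorem exists_norm_eq_of_two_power {K : Type*} [Field K] [Algebra F K] [Finite K] {δ : F} {n : ℕ}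
    (hδ : δ ^ 2 ^ n = 1) : ∃ (a : K) (t : ℕ), Algebra.norm F a = δ ∧ a ^ 2 ^ t = 1 := by
  have : Finite F := Finite.of_injective _ (algebraMap F K).injective
  obtain ⟨t, r, hr, htr⟩ := Nat.exists_eq_two_pow_mul_odd (n := Nat.card Kˣ) Nat.card_pos.ne'
  obtain ⟨r', hr'⟩ := exists_pow_eq_self_of_coprime (x := δ) (n := r)
    (Nat.Coprime.of_dvd_right (orderOf_dvd_of_pow_eq_one hδ)
      (Nat.Coprime.pow_right n hr.coprime_two_right))
  obtain ⟨a, ha⟩ := FiniteField.norm_surjective F K δ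
  have ha0 : a ≠ 0 := by
    rintro rfl
    rw [Algebra.norm_zero] at ha
    simp [← ha] at hδ
  refine ⟨(a ^ r) ^ r', t, by rw [map_pow, map_pow, ha, hr'], ?_⟩
  have h1 : (Units.mk0 a ha0) ^ Nat.card Kˣ = 1 := pow_card_eq_one'
  have h2 : a ^ Nat.card Kˣ = 1 := congrArg Units.val h1
  rw [← pow_mul, ← pow_mul, show r * (r' * 2 ^ t) = (2 ^ t * r) * r' by ring, ← htr, pow_mul, h2,
    one_pow]

/-- Endomorphisms of a direct factor can be corrected to have determinant one by means of a
second factor which is a finite field extension of `F`. -/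
theorem hasOddProduct_of_factor [Finite F] {K : Type*} [Field K] [Algebra F K] [Finite K]
    [Module.Finite F V] [Module.Finite F W] {f y z : Module.End F V} (hy : TwoPair f y)
    (hz : TwoPair f z) {v : V} {m : ℕ} (hm : Odd m) (hv : ((y * z) ^ m) v = v)
    (hv' : (y * z) v ≠ v) {β : K} {k l : ℕ} (hβ : β ^ 2 ^ k = 1) {h : Module.End F W}
    (hh : h ^ 2 ^ l = 1) :
    HasOddProduct F (f.prodMap ((LinearMap.mulLeft F β).prodMap h)) := by
  have key : ∀ y : Module.End F V, TwoPair f y → ∃ b : K,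
      LinearMap.det (y.prodMap ((LinearMap.mulLeft F b).prodMap (1 : Module.End F W))) = 1 ∧
      TwoPair (f.prodMap ((LinearMap.mulLeft F β).prodMap h) : Module.End F (V × (K × W)))
        (y.prodMap ((LinearMap.mulLeft F b).prodMap (1 : Module.End F W))) := by
    intro y hy
    obtain ⟨n, hn⟩ := hy.exists_pow_eq_one
    have hdn : (LinearMap.det y)⁻¹ ^ 2 ^ n = 1 := by rw [inv_pow, ← map_pow, hn, map_one, inv_one]
    have hdet0 : LinearMap.det y ≠ 0 := fun h0 => by simp [h0] at hdn
    obtain ⟨a, t, ha, hat⟩ := exists_norm_eq_of_two_power (K := K) hdn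
    refine ⟨a, ?_, hy.prodMap (TwoPair.prodMap (TwoPair.of_commute
      (LinearMap.mulLeft_pow_eq_one hβ) (LinearMap.mulLeft_pow_eq_one hat) ?_)
      (TwoPair.of_commute (l := 0) hh (by simp) (by simp)))⟩
    · rw [LinearMap.det_prodMap, LinearMap.det_prodMap, map_one, mul_one]
      change _ * Algebra.norm F a = 1
      rw [ha, mul_inv_cancel₀ hdet0]
    · ext v; simp; ring
  obtain ⟨b, hb, hyb⟩ := key y hy
  obtain ⟨c, hc, hzc⟩ := key z hz
  have hmul : (y.prodMap ((LinearMap.mulLeft F b).prodMap (1 : Module.End F W)) *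
      z.prodMap ((LinearMap.mulLeft F c).prodMap (1 : Module.End F W)) :
        Module.End F (V × (K × W))) =
      (y * z).prodMap ((LinearMap.mulLeft F (b * c)).prodMap (1 : Module.End F W)) := by
    ext <;> simp
  have hpow : ∀ n : ℕ, (((y * z).prodMap ((LinearMap.mulLeft F (b * c)).prodMap
      (1 : Module.End F W)) : Module.End F (V × (K × W))) ^ n) (v, 0) = (((y * z) ^ n) v, 0) := by
    intro n
    induction n with
    | zero => simp
    | succ n ih => rw [pow_succ', Module.End.mul_apply, ih]; simp [pow_succ']
  refine ⟨_, _, hb, hc, hyb, hzc, (v, 0), m, hm, ?_, ?_⟩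
  · rw [hmul, hpow, hv]
  · rw [hmul]
    simpa using hv'

end Constructions

section Blocks

variable {F W : Type*} [Field F] [Finite F] [AddCommGroup W] [Module F W] [Module.Finite F W]

theorem hasOddProduct_of_four_dvd_finrank (hF : Odd (Nat.card F)) {K : Type*} [Field K]
    [Algebra F K] [Module.Finite F K] (hK : 4 ∣ Module.finrank F K) {ζ : K} {k l : ℕ}
    (hζ : ζ ^ 2 ^ k = 1) {h : Module.End F W} (hh : h ^ 2 ^ l = 1) :
    HasOddProduct F ((LinearMap.mulLeft F ζ).prodMap h) := by
  have := Fintype.ofFinite F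
  have : Finite K := Module.finite_of_finite F
  obtain ⟨e, he⟩ := hK
  have he0 : 0 < e := by
    have : 0 < Module.finrank F K := Module.finrank_pos
    omega
  obtain ⟨q, hq⟩ : ∃ q, q = Nat.card F ^ e := ⟨_, rfl⟩
  have hqodd : Odd q := hq ▸ hF.pow
  have hq1 : 1 < q := hq ▸ Nat.one_lt_pow he0.ne' Finite.one_lt_card
  have hcard : Nat.card K = (q ^ 2) ^ 2 := by
    rw [Module.natCard_eq_pow_finrank (K := F), he, hq]
    ring
  let τ : K →ₐ[F] K := (FiniteField.frobeniusAlgHom F K) ^ (2 * e)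
  have hτ : ∀ v, τ v = v ^ q ^ 2 := by
    intro v
    simp only [τ, AlgHom.coe_pow, FiniteField.coe_frobeniusAlgHom, pow_iterate]
    rw [hq, ← pow_mul, Fintype.card_eq_nat_card, mul_comm e]
  have hfix : ∀ v : K, v ^ (q ^ 2) ^ 2 = v := by
    intro v
    have := Fintype.ofFinite K
    rw [← hcard, ← Fintype.card_eq_nat_card, FiniteField.pow_card]
  have hττ : ∀ v, τ (τ v) = v := by
    intro v
    rw [hτ, hτ, ← pow_mul, ← pow_two, hfix]
  have hδ : (LinearMap.det τ.toLinearMap)⁻¹ ^ 2 ^ 1 = 1 := by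
    rw [pow_one, inv_pow, ← map_pow, inv_eq_one]
    convert LinearMap.det_id (M := K) (A := F)
    ext v
    simp [pow_two, hττ]
  obtain ⟨a, t, ha, hat⟩ := exists_norm_eq_of_two_power (K := K) hδ
  have hδ0 : LinearMap.det τ.toLinearMap ≠ 0 := fun h0 => by simp [h0] at hδ
  obtain ⟨b, hb⟩ := IsCyclic.exists_generator (α := Kˣ)
  have hord : orderOf b = (q ^ 2) ^ 2 - 1 := by
    rw [orderOf_eq_card_of_forall_mem_zpowers hb, Nat.card_units, hcard]
  obtain ⟨s, hs⟩ := hqodd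
  have hs0 : 0 < s := by omega
  have hq2 : q ^ 2 = 4 * (s * (s + 1)) + 1 := by rw [hs]; ring
  obtain ⟨u, hu⟩ : ∃ u, u = s * (s + 1) := ⟨_, rfl⟩
  rw [← hu] at hq2
  have hu0 : 0 < u := by rw [hu]; positivity
  have hord' : orderOf b = 8 * u * (2 * u + 1) := by
    rw [hord, hq2]
    apply Nat.sub_eq_of_eq_add
    ring
  have hg : τ (b ^ 2 : Kˣ) * ((b ^ 2)⁻¹ : Kˣ) = ((b ^ (8 * u) : Kˣ) : K) := by
    rw [hτ, ← Units.val_pow_eq_pow_val, ← Units.val_mul, hq2]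
    congr 1
    rw [mul_inv_eq_iff_eq_mul, ← pow_mul, ← pow_add]
    congr 1
    ring
  refine hasOddProduct_of_twistedMul (τ := τ) (s := a) (r := 2 * u + 1) hττ (l := t) hζ ?_ ?_ hh
    ((b ^ 2 : Kˣ) : K) ((b ^ 2)⁻¹ : Kˣ) (Units.mul_inv _) ⟨u, rfl⟩ ?_ ?_
  · rw [mul_pow, ← map_pow, hat, map_one, mul_one]
  · rw [twistedMul, map_mul]
    change Algebra.norm F a * _ = 1
    rw [ha, inv_mul_cancel₀ hδ0]
  · rw [hg, ← Units.val_pow_eq_pow_val, ← pow_mul, ← hord', pow_orderOf_eq_one, Units.val_one]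
  · rw [hg]
    intro h1
    have := orderOf_dvd_of_pow_eq_one (Units.ext h1 : b ^ (8 * u) = 1)
    have := Nat.le_of_dvd (by positivity) this
    rw [hord'] at this
    nlinarith

variable {K ι : Type*} [Field K] [Algebra F K] [Module.Finite F K] [Fintype ι] [DecidableEq ι]

/-- Reindexing of functions by a permutation, as an algebra homomorphism. -/
def permAlgHom (F K : Type*) [Field F] [Field K] [Algebra F K] {ι : Type*} (σ : Equiv.Perm ι) :
    (ι → K) →ₐ[F] (ι → K) :=
  AlgHom.pi fun l => Pi.evalAlgHom F _ (σ l)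

omit [Finite F] [Module.Finite F K] [Fintype ι] [DecidableEq ι] in
@[simp]
theorem permAlgHom_apply (σ : Equiv.Perm ι) (v : ι → K) (l : ι) :
    permAlgHom F K σ v l = v (σ l) := rfl

omit [Finite F] in
theorem det_mulLeft_pi (u : ι → K) :
    LinearMap.det (LinearMap.mulLeft F u) = Algebra.norm F (∏ l, u l) := by
  have : LinearMap.mulLeft F u = (Matrix.toLin' (Matrix.diagonal u)).restrictScalars F := by
    ext v l
    simp [Matrix.mulVec_diagonal]
  rw [this, LinearMap.det_restrictScalars, LinearMap.det_toLin', Matrix.det_diagonal]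

omit [Finite F] in
theorem det_twistedMul_perm (u : ι → K) (σ : Equiv.Perm ι) :
    LinearMap.det (twistedMul u (permAlgHom F K σ)) =
      Algebra.norm F ((∏ l, u l) * (Equiv.Perm.sign σ : ℤ)) := by
  have : twistedMul u (permAlgHom F K σ) =
      (Matrix.toLin' (Matrix.diagonal u * σ.permMatrix K)).restrictScalars F := by
    refine LinearMap.ext fun v => funext fun l => ?_
    simp [Matrix.mulVec_diagonal, Matrix.permMatrix_mulVec]
  rw [this, LinearMap.det_restrictScalars, LinearMap.det_toLin', Matrix.det_mul,
    Matrix.det_diagonal, Matrix.det_permutation]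

/-- The signed transposition exchanging two coordinates. -/
def signedSwap (F K : Type*) [Field F] [Field K] [Algebra F K] {ι : Type*} [DecidableEq ι]
    (i j : ι) : Module.End F (ι → K) :=
  twistedMul (Function.update 1 i (-1)) (permAlgHom F K (Equiv.swap i j))

omit [Finite F] in
theorem det_signedSwap {i j : ι} (hij : i ≠ j) : LinearMap.det (signedSwap F K i j) = 1 := by
  rw [signedSwap, det_twistedMul_perm, Finset.prod_update_of_mem (Finset.mem_univ i),
    Equiv.Perm.sign_swap hij]
  simp

omit [Fintype ι] in
theorem update_neg_one_sq (i : ι) : (Function.update (1 : ι → K) i (-1)) ^ 2 = 1 := by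
  ext l
  by_cases h : l = i <;> simp [h]

omit [Finite F] [Module.Finite F K] [Fintype ι] in
theorem signedSwap_sign_pow (i j : ι) : ((Function.update (1 : ι → K) i (-1)) *
    permAlgHom F K (Equiv.swap i j) (Function.update (1 : ι → K) i (-1))) ^ 2 ^ 1 = 1 := by
  rw [pow_one, mul_pow, ← map_pow, update_neg_one_sq, map_one, mul_one]

theorem hasOddProduct_of_three {α : ι → K} {i j k : ι} (hij : i ≠ j) (hjk : j ≠ k) (hik : i ≠ k)
    {m n : ℕ} (hα : α ^ 2 ^ m = 1) {h : Module.End F W} (hh : h ^ 2 ^ n = 1) :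
    HasOddProduct F ((LinearMap.mulLeft F α).prodMap h) := by
  have hpair : ∀ i j, TwoPair ((LinearMap.mulLeft F α).prodMap h : Module.End F ((ι → K) × W))
      ((signedSwap F K i j).prodMap 1 : Module.End F ((ι → K) × W)) := fun i j =>
    (twoPair_twistedMul (fun v => by ext; simp) hα (signedSwap_sign_pow i j)).prodMap
      (TwoPair.of_commute (l := 0) hh (by simp) (by simp))
  have hdet : ∀ i j : ι, i ≠ j →
      LinearMap.det ((signedSwap F K i j).prodMap 1 : Module.End F ((ι → K) × W)) = 1 := by
    intro i j hij
    rw [LinearMap.det_prodMap, det_signedSwap hij, map_one, mul_one]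
  have hs1 : ∀ a b : ι, a ≠ b → signedSwap F K a b (Pi.single a 1) = Pi.single b 1 := by
    intro a b hab
    ext l
    rcases eq_or_ne l a with rfl | hla
    · simp [signedSwap, hab.symm, hab]
    rcases eq_or_ne l b with rfl | hlb
    · simp [signedSwap, hla]
    · simp [signedSwap, Equiv.swap_apply_of_ne_of_ne, hla, hlb]
  have hs2 : ∀ a b : ι, a ≠ b → signedSwap F K a b (Pi.single b 1) = - Pi.single a 1 := by
    intro a b hab
    ext l
    rcases eq_or_ne l a with rfl | hla
    · simp [signedSwap]
    rcases eq_or_ne l b with rfl | hlb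
    · simp [signedSwap, hab, hla]
    · simp [signedSwap, Equiv.swap_apply_of_ne_of_ne, hla, hlb]
  have hs3 : ∀ a b c : ι, c ≠ a → c ≠ b → signedSwap F K a b (Pi.single c 1) = Pi.single c 1 := by
    intro a b c hca hcb
    ext l
    rcases eq_or_ne l a with rfl | hla
    · simp [signedSwap, hca.symm, hcb.symm]
    rcases eq_or_ne l b with rfl | hlb
    · simp [signedSwap, hcb.symm, hca.symm]
    · simp [signedSwap, Equiv.swap_apply_of_ne_of_ne, hla, hlb]
  refine ⟨_, _, hdet i j hij, hdet j k hjk, hpair i j, hpair j k, (Pi.single i 1, 0), 3,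
    by decide, ?_, ?_⟩
  · simp [pow_succ, hs1, hs2, hs3, hij, hjk, hjk.symm, hik, hik.symm]
  · intro h
    have := congrFun (congrArg Prod.fst h) i
    simp [hs1, hs3, hij, hik] at this

omit [Finite F] in
theorem hasOddProduct_of_two {α : ι → K} {i j : ι} (hij : i ≠ j) {m n r : ℕ} (hr : Odd r)
    (c : Kˣ) (hc : c ^ r = 1) (hc1 : c ≠ 1) (hα : α ^ 2 ^ m = 1) {h : Module.End F W}
    (hh : h ^ 2 ^ n = 1) :
    HasOddProduct F ((LinearMap.mulLeft F α).prodMap h) := by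
  have hcr : (c : K) ^ r = 1 := congrArg Units.val hc
  have hcr' : (↑(c⁻¹ : Kˣ) : K) ^ r = 1 := by
    rw [← Units.val_pow_eq_pow_val, inv_pow, hc, inv_one, Units.val_one]
  refine hasOddProduct_of_twistedMul (τ := permAlgHom F K (Equiv.swap i j))
    (fun v => by ext; simp) hα (signedSwap_sign_pow i j) (det_signedSwap hij) hh
    (Function.update 1 i (c : K)) (Function.update 1 i ((c⁻¹ : Kˣ) : K)) ?_ hr ?_ ?_
  · ext l
    by_cases hl : l = i <;> simp [hl]
  · have h1 : ∀ d : K, d ^ r = 1 → (Function.update (1 : ι → K) i d) ^ r = 1 := by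
      intro d hd
      ext l
      by_cases hl : l = i <;> simp [hl, hd]
    rw [mul_pow, ← map_pow, h1 _ hcr, h1 _ hcr', map_one, mul_one]
  · intro h1
    have := congrFun h1 j
    simp [hij.symm] at this
    exact hc1 this

end Blocks

section CardThree

variable {F K L W : Type*} [Field F] [Finite F] [AddCommGroup W] [Module F W] [Module.Finite F W]
  [Field K] [Finite K] [Algebra F K] [Field L] [Algebra F L] [Module.Finite F L]

theorem three_eq_zero_of_card (hF : Nat.card F = 3) : (3 : F) = 0 := by
  have := Fintype.ofFinite F
  have h := FiniteField.cast_card_eq_zero F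
  rw [Fintype.card_eq_nat_card, hF] at h
  exact_mod_cast h

theorem hasOddProduct_of_sq_eq_neg_one (hF : Nat.card F = 3) (hL : Module.finrank F L = 2) {α : L}
    (hα : α ^ 2 = -1) {β : K} {k l : ℕ} (hβ : β ^ 2 ^ k = 1) {h : Module.End F W}
    (hh : h ^ 2 ^ l = 1) :
    HasOddProduct F ((LinearMap.mulLeft F α).prodMap ((LinearMap.mulLeft F β).prodMap h)) := by
  have := Fintype.ofFinite F
  have : Finite L := Module.finite_of_finite F
  have := Fintype.ofFinite L
  have h3 : (3 : L) = 0 := by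
    rw [← map_ofNat (algebraMap F L) 3, three_eq_zero_of_card hF, map_zero]
  obtain ⟨σ, hσ⟩ : ∃ σ : L →ₐ[F] L, ∀ v, σ v = v ^ 3 :=
    ⟨FiniteField.frobeniusAlgHom F L, fun v => by
      rw [FiniteField.coe_frobeniusAlgHom, Fintype.card_eq_nat_card, hF]⟩
  have hσσ : ∀ v, σ (σ v) = v := by
    intro v
    rw [hσ, hσ, ← pow_mul]
    have h9 : Fintype.card L = 3 * 3 := by
      rw [Fintype.card_eq_nat_card, Module.natCard_eq_pow_finrank (K := F), hF, hL]
      rfl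
    rw [← h9, FiniteField.pow_card]
  have hσα : σ α = -α := by
    rw [hσ]
    linear_combination α * hα
  have hα4 : α ^ 2 ^ 2 = 1 := by
    linear_combination (α ^ 2 - 1) * hα
  let a : Module.End F L := LinearMap.mulLeft F α
  let j : Module.End F L := LinearMap.mulLeft F (1 + α) * σ.toLinearMap
  have ha : ∀ v, a v = α * v := fun v => rfl
  have hj : ∀ v, j v = (1 + α) * σ v := fun v => rfl
  have haa : a * a = -1 := by
    ext v
    simp only [Module.End.mul_apply, ha, LinearMap.neg_apply, Module.End.one_apply]
    linear_combination v * hα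
  have hjj : j * j = -1 := by
    ext v
    simp only [Module.End.mul_apply, hj, LinearMap.neg_apply, Module.End.one_apply, map_mul,
      map_add, map_one, hσσ, hσα]
    linear_combination v * h3 - v * hα
  have haj : a * j = - (j * a) := by
    ext v
    simp only [Module.End.mul_apply, ha, hj, LinearMap.neg_apply, map_mul, hσα]
    ring
  have hone : ∀ b : Module.End F L, b * b = -1 → (1 + b) ^ 2 ^ 3 = 1 := by
    intro b hb
    have h3' : (1 + 1 + 1 : Module.End F L) = 0 := by
      ext v
      simp only [LinearMap.add_apply, Module.End.one_apply, LinearMap.zero_apply]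
      linear_combination v * h3
    have h2 : (1 + b) ^ 2 = b + b := by
      rw [pow_two, mul_add, add_mul, add_mul, hb, mul_one, one_mul, mul_one]
      abel
    have h4 : (b + b) ^ 2 = -1 := by
      rw [pow_two, mul_add, add_mul, hb, show -1 + -1 + (-1 + -1) = -(1 + 1 + 1) - (1 : Module.End F L)
        by abel, h3', neg_zero, zero_sub]
    rw [show 2 ^ 3 = 2 * 2 * 2 from rfl, pow_mul, pow_mul, h2, h4]
    exact neg_one_sq (R := Module.End F L)
  have hval : ∀ v, ((1 + a) * (1 + j)) v = (1 + α) * (v + (1 + α) * σ v) := by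
    intro v
    simp only [Module.End.mul_apply, LinearMap.add_apply, Module.End.one_apply, ha, hj]
    ring
  have e1 : ((1 + a) * (1 + j)) α = 1 + α := by
    rw [hval, hσα]
    linear_combination (-1 - α) * hα
  refine hasOddProduct_of_factor (y := 1 + a) (z := 1 + j)
    (TwoPair.of_commute (LinearMap.mulLeft_pow_eq_one hα4) (hone a haa) ?_)
    (TwoPair.of_conj_commute (x' := 1 - j) (hone j hjj) (LinearMap.mulLeft_pow_eq_one hα4)
      ?_ ?_ ?_).symm (v := α) (m := 3) (by decide) ?_ ?_ hβ hh
  · change (1 + a) * a = a * (1 + a)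
    rw [add_mul, mul_add, one_mul, mul_one]
  · change a * (1 + j) = (1 - j) * a
    rw [mul_add, sub_mul, haj, one_mul, mul_one, sub_eq_add_neg]
  · exact ((Commute.one_right _).sub_right ((Commute.one_left j).add_left (Commute.refl j))).eq
  · change a * a * (1 + j) = (1 + j) * (a * a)
    rw [haa]
    exact ((Commute.one_right _).add_right (Commute.neg_one_left j)).eq
  · have e2 : ((1 + a) * (1 + j)) (1 + α) = α - 1 := by
      rw [hval, map_add, map_one, hσα]
      linear_combination (-α) * hα + (1 + α) * h3
    have e3 : ((1 + a) * (1 + j)) (α - 1) = α := by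
      rw [hval, map_sub, map_one, hσα]
      linear_combination (-2 - α) * hα - α * h3
    rw [pow_succ, pow_two, Module.End.mul_apply, Module.End.mul_apply, e1, e2, e3]
  · rw [e1]
    intro h
    exact one_ne_zero (add_eq_right.mp h)

/-- A two-dimensional scalar block commutes with two reflections whose product is a transvection,
which has order three. -/
theorem hasOddProduct_of_scalar (hF : Nat.card F = 3) {c : F} {β : K} {k l m : ℕ}
    (hc : c ^ 2 ^ m = 1) (hβ : β ^ 2 ^ k = 1) {h : Module.End F W} (hh : h ^ 2 ^ l = 1) :
    HasOddProduct F (((c • 1 : Module.End F (F × F))).prodMap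
      ((LinearMap.mulLeft F β).prodMap h)) := by
  let y : Module.End F (F × F) := (1 : Module.End F F).prodMap (-1)
  let z : Module.End F (F × F) := (LinearMap.fst F F F + LinearMap.snd F F F).prod
    (- LinearMap.snd F F F)
  have hy : ∀ v, y v = (v.1, - v.2) := fun v => rfl
  have hz : ∀ v, z v = (v.1 + v.2, - v.2) := fun v => rfl
  have h3 := three_eq_zero_of_card hF
  have hcc : ((c • 1 : Module.End F (F × F))) ^ 2 ^ m = 1 := by
    rw [smul_pow, hc, one_smul, one_pow]
  have hpair : ∀ y : Module.End F (F × F), y ^ 2 = 1 → TwoPair (c • 1 : Module.End F (F × F)) y :=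
    fun y hy => TwoPair.of_commute (l := 1) hcc hy (by simp)
  refine hasOddProduct_of_factor (hpair y ?_) (hpair z ?_) (v := (0, 1)) (m := 3) (by decide)
    ?_ ?_ hβ hh
  · refine LinearMap.ext fun v => ?_
    simp [pow_two, hy]
  · refine LinearMap.ext fun v => ?_
    simp [pow_two, hz]
  · simp [pow_succ, hy, hz]
    linear_combination h3
  · simp [hy, hz]

end CardThree

namespace SimilarEnd

variable {F V W U A : Type*} [Field F] [AddCommGroup V] [Module F V] [AddCommGroup W] [Module F W]
  [AddCommGroup U] [Module F U] [CommRing A] [Algebra F A]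

theorem prodComm (f : Module.End F V) (g : Module.End F W) :
    SimilarEnd (f.prodMap g) (g.prodMap f) :=
  ⟨LinearEquiv.prodComm F V W, fun _ => rfl⟩

theorem prodAssoc (f : Module.End F V) (g : Module.End F W) (h : Module.End F U) :
    SimilarEnd ((f.prodMap g).prodMap h) (f.prodMap (g.prodMap h)) :=
  ⟨LinearEquiv.prodAssoc F V W U, fun _ => rfl⟩

theorem prodLeftComm (f : Module.End F V) (g : Module.End F W) (h : Module.End F U) :
    SimilarEnd (f.prodMap (g.prodMap h)) (g.prodMap (f.prodMap h)) :=
  (prodAssoc f g h).symm.trans (((prodComm f g).prodMap (refl h)).trans (prodAssoc g f h))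

theorem mulLeft_algEquiv {B : Type*} [CommRing B] [Algebra F B] (e : A ≃ₐ[F] B) (a : A) :
    SimilarEnd (LinearMap.mulLeft F a) (LinearMap.mulLeft F (e a)) :=
  ⟨e.toLinearEquiv, fun v => by simp⟩

theorem mulLeft_fin_two (α : Fin 2 → A) :
    SimilarEnd (LinearMap.mulLeft F α)
      ((LinearMap.mulLeft F (α 0)).prodMap (LinearMap.mulLeft F (α 1))) :=
  ⟨LinearEquiv.finTwoArrow F A, fun _ => rfl⟩

theorem mulLeft_fin_cons {n : ℕ} (a : A) (α : Fin n → A) :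
    SimilarEnd ((LinearMap.mulLeft F a).prodMap (LinearMap.mulLeft F α))
      (LinearMap.mulLeft F (Fin.cons a α : Fin (n + 1) → A)) := by
  refine ⟨Fin.consLinearEquiv F fun _ => A, fun v => ?_⟩
  ext i
  refine Fin.cases ?_ (fun i => ?_) i <;> simp

end SimilarEnd

theorem hasOddProduct_of_card_three {F L : Type*} [Field F] [Finite F] [Field L] [Algebra F L]
    [Module.Finite F L] (hF : Nat.card F = 3) (hL : Module.finrank F L = 2) {α : Fin 2 → L}
    (hαF : ∀ i, α i ∉ Set.range (algebraMap F L)) {lam : Fin 2 → F} {k l : ℕ}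
    (hα : α ^ 2 ^ k = 1) (hlam : lam ^ 2 ^ l = 1)
    (hdet : LinearMap.det ((LinearMap.mulLeft F α).prodMap (LinearMap.mulLeft F lam)) = 1) :
    HasOddProduct F ((LinearMap.mulLeft F α).prodMap (LinearMap.mulLeft F lam)) := by
  have := Fintype.ofFinite F
  have : Finite L := Module.finite_of_finite F
  have hαi : ∀ i, α i ^ 2 ^ k = 1 := fun i => congrFun hα i
  have hlami : ∀ i, lam i ^ 2 ^ l = 1 := fun i => congrFun hlam i
  by_cases h01 : lam 0 = lam 1
  · have e : SimilarEnd ((LinearMap.mulLeft F α).prodMap (LinearMap.mulLeft F lam))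
        ((lam 0 • 1 : Module.End F (F × F)).prodMap
          ((LinearMap.mulLeft F (α 0)).prodMap (LinearMap.mulLeft F (α 1)))) := by
      refine (SimilarEnd.prodComm _ _).trans
        (SimilarEnd.prodMap ⟨LinearEquiv.finTwoArrow F F, fun v => ?_⟩
          (SimilarEnd.mulLeft_fin_two α))
      simp [h01]
    exact e.hasOddProduct (hasOddProduct_of_scalar hF (hlami 0) (hαi 0)
      (LinearMap.mulLeft_pow_eq_one (hαi 1)))
  · have hsq : ∀ c : F, c ≠ 0 → c = 1 ∨ c = -1 := by
      intro c hc
      have := FiniteField.pow_card_sub_one_eq_one c hc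
      rw [Fintype.card_eq_nat_card, hF] at this
      exact mul_self_eq_one_iff.mp ((pow_two c).symm.trans this)
    have hα0 : ∀ i, α i ≠ 0 := fun i h0 => by simpa [h0] using hαi i
    have hlam0 : ∀ i, lam i ≠ 0 := fun i h0 => by simpa [h0] using hlami i
    have hN : ∃ i, Algebra.norm F (α i) = 1 := by
      rw [LinearMap.det_prodMap, det_mulLeft_pi, det_mulLeft_pi, Algebra.norm_self,
        MonoidHom.id_apply, Fin.prod_univ_two, Fin.prod_univ_two, map_mul] at hdet
      by_contra! hN
      rw [(hsq _ (Algebra.norm_ne_zero_iff.mpr (hα0 0))).resolve_left (hN 0),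
        (hsq _ (Algebra.norm_ne_zero_iff.mpr (hα0 1))).resolve_left (hN 1)] at hdet
      rcases hsq _ (hlam0 0) with h0 | h0 <;> rcases hsq _ (hlam0 1) with h1 | h1 <;>
        simp_all
    have key : ∀ i, Algebra.norm F (α i) = 1 → α i ^ 2 = -1 := by
      intro i hi
      have h4 : (α i ^ 2) * (α i ^ 2) = 1 := by
        have := FiniteField.algebraMap_norm_eq_pow_sum F L (α i)
        rw [hi, hL, hF] at this
        simpa [Finset.sum_range_succ, ← pow_add, eq_comm] using this
      refine (mul_self_eq_one_iff.mp h4).resolve_left fun h2 => ?_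
      rcases mul_self_eq_one_iff.mp ((pow_two (α i)).symm.trans h2) with h | h
      · exact hαF i ⟨1, by rw [h, map_one]⟩
      · exact hαF i ⟨-1, by rw [h, map_neg, map_one]⟩
    have e := (SimilarEnd.mulLeft_fin_two (F := F) α).prodMap
      (SimilarEnd.refl (LinearMap.mulLeft F lam))
    obtain ⟨i, hi⟩ := hN
    have hi' := key i hi
    fin_cases i
    · exact (e.trans (SimilarEnd.prodAssoc _ _ _)).hasOddProduct (hasOddProduct_of_sq_eq_neg_one
        hF hL hi' (hαi 1) (LinearMap.mulLeft_pow_eq_one hlam))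
    · exact (e.trans ((SimilarEnd.prodAssoc _ _ _).trans
        (SimilarEnd.prodLeftComm _ _ _))).hasOddProduct (hasOddProduct_of_sq_eq_neg_one
        hF hL hi' (hαi 0) (LinearMap.mulLeft_pow_eq_one hlam))

section Decomposition

open Polynomial

universe u

/-- A semisimple endomorphism splits off multiplication by a generator of a field extension. -/
theorem Module.End.IsSemisimple.exists_similarEnd_mulLeft {F V : Type u} [Field F] [AddCommGroup V]
    [Module F V] [Module.Finite F V] [Nontrivial V] {f : Module.End F V} (hf : f.IsSemisimple) :
    ∃ (K W : Type u) (_ : Field K) (_ : Algebra F K) (_ : AddCommGroup W) (_ : Module F W) (ζ : K)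
      (h : Module.End F W), Module.Finite F K ∧ Module.Finite F W ∧ Algebra.adjoin F {ζ} = ⊤ ∧
      SimilarEnd f ((LinearMap.mulLeft F ζ).prodMap h) := by
  have hss : IsSemisimpleModule F[X] (Module.AEval' f) := hf
  have : Nontrivial (Module.AEval' f) := ‹Nontrivial V›
  obtain ⟨S, hS⟩ := IsSemisimpleModule.exists_simple_submodule F[X] (Module.AEval' f)
  obtain ⟨I, hI, ⟨eS⟩⟩ := isSimpleModule_iff_quot_maximal.mp hS
  obtain ⟨T, hT⟩ := exists_isCompl S
  let e : Module.AEval' f ≃ₗ[F[X]] (F[X] ⧸ I) × T :=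
    (Submodule.prodEquivOfIsCompl S T hT).symm.trans (eS.prodCongr (LinearEquiv.refl F[X] T))
  let e' : V ≃ₗ[F] (F[X] ⧸ I) × T := (Module.AEval'.of f).trans (e.restrictScalars F)
  have hfin : Module.Finite F ((F[X] ⧸ I) × T) := Module.Finite.equiv e'
  have hmk : Function.Surjective (Ideal.Quotient.mkₐ F I) := Ideal.Quotient.mk_surjective
  refine ⟨F[X] ⧸ I, T, Ideal.Quotient.field I, inferInstance, inferInstance, inferInstance,
    Ideal.Quotient.mkₐ F I X, Algebra.lsmul F F T (X : F[X]),
    Module.Finite.of_surjective (LinearMap.fst F _ T) Prod.fst_surjective,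
    Module.Finite.of_surjective (LinearMap.snd F (F[X] ⧸ I) T) Prod.snd_surjective, ?_, e', ?_⟩
  · rw [← Set.image_singleton, ← AlgHom.map_adjoin, Polynomial.adjoin_X, Algebra.map_top,
      AlgHom.range_eq_top]
    exact hmk
  · intro v
    change e (Module.AEval'.of f (f v)) = (X : F[X]) • e (Module.AEval'.of f v)
    rw [← Module.AEval'.X_smul_of, map_smul]

theorem Module.End.isSemisimple_of_two_power {F V : Type*} [Field F] [Finite F] [AddCommGroup V]
    [Module F V] (hF : Odd (Nat.card F)) {f : Module.End F V} {k : ℕ} (hf : f ^ 2 ^ k = 1) :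
    f.IsSemisimple := by
  have := Fintype.ofFinite F
  have h2 : ((2 ^ k : ℕ) : F) ≠ 0 := by
    rw [Nat.cast_pow]
    refine pow_ne_zero k fun h => ?_
    have h0 := FiniteField.cast_card_eq_zero F
    obtain ⟨s, hs⟩ := hF
    rw [Fintype.card_eq_nat_card, hs] at h0
    push_cast at h0 h
    simp [h] at h0
  refine isSemisimple_of_squarefree_aeval_eq_zero
    (p := X ^ 2 ^ k - 1) (X_pow_sub_one_separable_iff.mpr h2).squarefree ?_
  simp [hf]

theorem exists_finrank_eq_two_pow {F K : Type*} [Field F] [Finite F] [Field K] [Algebra F K]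
    [Module.Finite F K] (hF : Odd (Nat.card F)) {ζ : K} {k : ℕ} (hζ : ζ ^ 2 ^ k = 1)
    (hgen : Algebra.adjoin F {ζ} = ⊤) : ∃ j, Module.finrank F K = 2 ^ j := by
  have := Fintype.ofFinite F
  have : Finite K := Module.finite_of_finite F
  have hdvd : Module.finrank F K ∣ Nat.totient (2 ^ k) := by
    rw [← FiniteField.orderOf_frobeniusAlgHom F K]
    refine orderOf_dvd_of_pow_eq_one (AlgHom.ext_of_adjoin_eq_top hgen ?_)
    intro x hx
    rw [Set.mem_singleton_iff.mp hx]
    have hq : Nat.card F ^ Nat.totient (2 ^ k) ≡ 1 [MOD 2 ^ k] :=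
      Nat.ModEq.pow_totient (Nat.Coprime.pow_right k hF.coprime_two_right)
    rw [AlgHom.coe_pow, FiniteField.coe_frobeniusAlgHom, pow_iterate, Fintype.card_eq_nat_card]
    change ζ ^ _ = ζ
    rw [pow_eq_pow_mod _ hζ, hq, ← pow_eq_pow_mod _ hζ, pow_one]
  have htot : Nat.totient (2 ^ k) ∣ 2 ^ k := by
    rcases k with _ | k
    · simp
    · rw [Nat.totient_prime_pow_succ Nat.prime_two]
      exact ⟨2, by rw [pow_succ]; ring⟩
  obtain ⟨j, -, hj⟩ := (Nat.dvd_prime_pow Nat.prime_two).mp (hdvd.trans htot)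
  exact ⟨j, hj⟩

/-- Some factor of `f` is multiplication by an element of a field extension of degree divisible
by four. -/
def HasQuarticBlock {F V : Type u} [Field F] [AddCommGroup V] [Module F V] (f : Module.End F V) :
    Prop :=
  ∃ (K W : Type u) (_ : Field K) (_ : Algebra F K) (_ : AddCommGroup W) (_ : Module F W) (ζ : K)
    (h : Module.End F W), Module.Finite F K ∧ Module.Finite F W ∧ 4 ∣ Module.finrank F K ∧
    SimilarEnd f ((LinearMap.mulLeft F ζ).prodMap h)

theorem SimilarEnd.pow_eq_one_of_prodMap {F V W U : Type*} [Field F] [AddCommGroup V] [Module F V]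
    [AddCommGroup W] [Module F W] [AddCommGroup U] [Module F U] {f : Module.End F V}
    {g : Module.End F W} {h : Module.End F U} (hs : SimilarEnd f (g.prodMap h)) {m : ℕ}
    (hf : f ^ m = 1) : g ^ m = 1 ∧ h ^ m = 1 := by
  have := hs.pow_eq_one hf
  have hpow : (g ^ m).prodMap (h ^ m) = (1 : Module.End F (W × U)) :=
    (map_pow (LinearMap.prodMapRingHom F W U) (g, h) m).trans this
  constructor
  · ext v
    exact congrArg Prod.fst (LinearMap.congr_fun hpow (v, 0))
  · ext v
    exact congrArg Prod.snd (LinearMap.congr_fun hpow (0, v))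

theorem LinearMap.pow_eq_one_of_mulLeft {F A : Type*} [Field F] [CommRing A] [Algebra F A] {a : A}
    {m : ℕ} (h : (LinearMap.mulLeft F a : Module.End F A) ^ m = 1) : a ^ m = 1 := by
  rw [LinearMap.pow_mulLeft] at h
  simpa using LinearMap.congr_fun h 1

theorem hasQuarticBlock_or_exists_similarEnd {F : Type u} {L : Type*} [Field F] [Finite F] [Field L]
    [Algebra F L] (hF : Odd (Nat.card F))
    (hL : ∀ (K : Type u) [Field K] [Algebra F K], Module.finrank F K = 2 → Nonempty (K ≃ₐ[F] L))
    (n : ℕ) : ∀ {V : Type u} [AddCommGroup V] [Module F V] [Module.Finite F V]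
    {f : Module.End F V} {k : ℕ} (_ : f ^ 2 ^ k = 1) (_ : Module.finrank F V = n),
    HasQuarticBlock f ∨ ∃ (a b : ℕ) (α : Fin a → L) (lam : Fin b → F),
      (∀ i, α i ∉ Set.range (algebraMap F L)) ∧
      SimilarEnd f ((LinearMap.mulLeft F α).prodMap (LinearMap.mulLeft F lam)) := by
  induction n using Nat.strong_induction_on with
  | _ n ih =>
  intro V _ _ _ f k hf hn
  rcases subsingleton_or_nontrivial V with hV | hV
  · exact .inr ⟨0, 0, 0, 0, fun i => i.elim0, 0, fun v => Subsingleton.elim _ _⟩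
  obtain ⟨K, W, _, _, _, _, ζ, h, hK, hW, hgen, hs⟩ :=
    (Module.End.isSemisimple_of_two_power hF hf).exists_similarEnd_mulLeft
  obtain ⟨hζ, hh⟩ := hs.pow_eq_one_of_prodMap hf
  obtain ⟨j, hj⟩ := exists_finrank_eq_two_pow hF (LinearMap.pow_eq_one_of_mulLeft hζ) hgen
  have hlt : Module.finrank F W < n := by
    have ⟨e, _⟩ := hs
    rw [← hn, e.finrank_eq, Module.finrank_prod, hj]
    have : 0 < 2 ^ j := by positivity
    omega
  rcases ih _ hlt hh rfl with ⟨K', W', _, _, _, _, ζ', h', hK', hW', h4, hs'⟩ |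
    ⟨a, b, α, lam, hα, hs'⟩
  · exact .inl ⟨K', K × W', _, _, _, _, ζ', (LinearMap.mulLeft F ζ).prodMap h', hK', inferInstance,
      h4, hs.trans (((SimilarEnd.refl _).prodMap hs').trans (SimilarEnd.prodLeftComm _ _ _))⟩
  have hs'' := hs.trans ((SimilarEnd.refl _).prodMap hs')
  rcases j with _ | _ | j
  · have hbot : (⊥ : Subalgebra F K) = ⊤ := Subalgebra.bot_eq_top_of_finrank_eq_one hj
    obtain ⟨c, rfl⟩ := Algebra.mem_bot.mp (hbot ▸ Algebra.mem_top : ζ ∈ (⊥ : Subalgebra F K))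
    let e : F ≃ₐ[F] K := (Algebra.botEquiv F K).symm.trans
      ((Subalgebra.equivOfEq _ _ hbot).trans Subalgebra.topEquiv)
    have he : SimilarEnd (LinearMap.mulLeft F (algebraMap F K c)) (LinearMap.mulLeft F c) := by
      have := (SimilarEnd.mulLeft_algEquiv e c).symm
      rwa [show e c = algebraMap F K c from e.commutes c] at this
    exact .inr ⟨a, b + 1, α, Fin.cons c lam, hα, hs''.trans ((he.prodMap (SimilarEnd.refl _)).trans
      ((SimilarEnd.prodLeftComm _ _ _).trans
        ((SimilarEnd.refl _).prodMap (SimilarEnd.mulLeft_fin_cons c lam))))⟩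
  · obtain ⟨e⟩ := hL K hj
    refine .inr ⟨a + 1, b, Fin.cons (e ζ) α, lam, Fin.cases ?_ hα, hs''.trans
      (((SimilarEnd.mulLeft_algEquiv e ζ).prodMap (SimilarEnd.refl _)).trans
      ((SimilarEnd.prodAssoc _ _ _).symm.trans
        ((SimilarEnd.mulLeft_fin_cons (e ζ) α).prodMap (SimilarEnd.refl _))))⟩
    rintro ⟨c, hc⟩
    have hζc : ζ = algebraMap F K c := e.injective (by rw [e.commutes, hc, Fin.cons_zero])
    have htop : (⊥ : Subalgebra F K) = ⊤ := by
      rw [← hgen, hζc, Algebra.adjoin_singleton_algebraMap]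
    have := Subalgebra.bot_eq_top_iff_finrank_eq_one.mp htop
    omega
  · exact .inl ⟨K, W, _, _, _, _, ζ, h, hK, hW, ⟨2 ^ j, by rw [hj]; ring⟩, hs⟩

end Decomposition

theorem exists_odd_prime_dvd_sq_sub_one {q : ℕ} (hq : Odd q) (h1 : 1 < q) (h3 : q ≠ 3) :
    ∃ r, r.Prime ∧ Odd r ∧ r ∣ q ^ 2 - 1 := by
  rcases Nat.eq_two_pow_or_exists_odd_prime_and_dvd (q ^ 2 - 1) with ⟨k, hk⟩ | ⟨r, hr, hd, ho⟩
  · exfalso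
    have hfac : q ^ 2 - 1 = (q + 1) * (q - 1) := by simpa using Nat.sq_sub_sq q 1
    obtain ⟨i, -, hi⟩ := (Nat.dvd_prime_pow Nat.prime_two).mp
      (hk ▸ hfac ▸ Dvd.intro_left _ rfl : q - 1 ∣ 2 ^ k)
    obtain ⟨j, -, hj⟩ := (Nat.dvd_prime_pow Nat.prime_two).mp
      (hk ▸ hfac ▸ Dvd.intro _ rfl : q + 1 ∣ 2 ^ k)
    obtain ⟨s, hs⟩ := hq
    rcases i with _ | _ | i
    · omega
    · omega
    rcases j with _ | _ | j
    · omega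
    · omega
    have e1 : 2 ^ (i + 1 + 1) = 4 * 2 ^ i := by ring
    have e2 : 2 ^ (j + 1 + 1) = 4 * 2 ^ j := by ring
    omega
  · exact ⟨r, hr, ho, hd⟩

universe u

theorem hasOddProduct_of_six_le_finrank {F V : Type u} [Field F] [Finite F] [AddCommGroup V]
    [Module F V] [Module.Finite F V] (hF : Odd (Nat.card F)) (hV : 6 ≤ Module.finrank F V)
    {f : Module.End F V} {k : ℕ} (hf : f ^ 2 ^ k = 1) (hdet : LinearMap.det f = 1) :
    HasOddProduct F f := by
  obtain ⟨p, hp⟩ := CharP.exists F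
  have : Fact p.Prime := ⟨CharP.char_is_prime F p⟩
  let L := FiniteField.Extension F p 2
  have hL2 : Module.finrank F L = 2 := FiniteField.finrank_extension F p 2
  rcases hasQuarticBlock_or_exists_similarEnd (L := L) hF
      (fun K _ _ h => ⟨FiniteField.algEquivExtension F p 2 K h⟩) _ hf rfl with
    ⟨K, W, _, _, _, _, ζ, h, hK, hW, h4, hs⟩ | ⟨a, b, α, lam, hα, hs⟩
  · obtain ⟨hζ, hh⟩ := hs.pow_eq_one_of_prodMap hf
    exact hs.hasOddProduct
      (hasOddProduct_of_four_dvd_finrank hF h4 (LinearMap.pow_eq_one_of_mulLeft hζ) hh)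
  obtain ⟨hα1, hlam1⟩ := hs.pow_eq_one_of_prodMap hf
  have hα2 := LinearMap.pow_eq_one_of_mulLeft hα1
  have hlam2 := LinearMap.pow_eq_one_of_mulLeft hlam1
  rcases le_or_gt 3 a with ha | ha
  · have hne := fun i j => (Fin.castLE_injective ha).ne (a₁ := i) (a₂ := j)
    exact hs.hasOddProduct (hasOddProduct_of_three (hne 0 1 (by decide)) (hne 1 2 (by decide))
      (hne 0 2 (by decide)) hα2 hlam1)
  rcases le_or_gt 3 b with hb | hb
  · have hne := fun i j => (Fin.castLE_injective hb).ne (a₁ := i) (a₂ := j)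
    exact (hs.trans (SimilarEnd.prodComm _ _)).hasOddProduct (hasOddProduct_of_three
      (hne 0 1 (by decide)) (hne 1 2 (by decide)) (hne 0 2 (by decide)) hlam2 hα1)
  have hdim : Module.finrank F V = a * 2 + b := by
    have ⟨e, _⟩ := hs
    rw [e.finrank_eq, Module.finrank_prod, Module.finrank_pi_fintype]
    simp [hL2]
  obtain rfl : a = 2 := by omega
  obtain rfl : b = 2 := by omega
  by_cases h3 : Nat.card F = 3
  · exact hs.hasOddProduct (hasOddProduct_of_card_three h3 hL2 hα hα2 hlam2 (hs.det_eq ▸ hdet))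
  · obtain ⟨r, hr, hodd, hdvd⟩ := exists_odd_prime_dvd_sq_sub_one hF Finite.one_lt_card h3
    have : Fact r.Prime := ⟨hr⟩
    have hcard : Nat.card Lˣ = Nat.card F ^ 2 - 1 := by
      rw [Nat.card_units, FiniteField.natCard_extension]
    obtain ⟨c, hc⟩ := exists_prime_orderOf_dvd_card' (G := Lˣ) r (hcard ▸ hdvd)
    refine hs.hasOddProduct (hasOddProduct_of_two (i := 0) (j := 1) (by simp) hodd c
      (hc ▸ pow_orderOf_eq_one c) ?_ hα2 hlam1)
    rintro rfl
    exact hr.one_lt.ne (orderOf_one.symm.trans hc)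

/-- `SL_n(𝔽_q)` for `q` odd and `n ≥ 6` has no picky `2`-element: no element of
`2`-power order lies in a unique Sylow `2`-subgroup. -/
theorem no_picky_two_element_SL
    (q : ℕ) (hq : IsPrimePow q) (hodd : Odd q) (n : ℕ) (hn : 6 ≤ n)
    (F : Type*) [Field F] [Fintype F] [DecidableEq F] (hF : Fintype.card F = q)
    (x : Matrix.SpecialLinearGroup (Fin n) F) (hx : ∃ k : ℕ, orderOf x = 2 ^ k) :
    ¬ ∃! P : Sylow 2 (Matrix.SpecialLinearGroup (Fin n) F), x ∈ P := by
  obtain ⟨k, hk⟩ := hx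
  refine not_existsUnique_sylow_of_hasOddProduct (hasOddProduct_of_six_le_finrank (k := k)
    (by rwa [← Fintype.card_eq_nat_card, hF]) (by simpa using hn) ?_ ?_)
  · rw [← Matrix.toLin'_pow, ← Matrix.SpecialLinearGroup.coe_pow, ← hk, pow_orderOf_eq_one,
      Matrix.SpecialLinearGroup.coe_one, Matrix.toLin'_one]
    rfl
  · rw [LinearMap.det_toLin', x.det_coe]
end

section
/- Let q be an odd prime power and n ≥ 6 an integer. Then the group Sp_{2n}(𝔽_q) possesses no picky 2-element; that is, no element of 2-power order of Sp_{2n}(𝔽_q) lies in a unique Sylow 2-subgroup. -/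
/-- `x` lies in exactly one Sylow `2`-subgroup. -/
def IsPicky {G : Type*} [Group G] (x : G) : Prop := ∃! P : Sylow 2 G, x ∈ P

section Picky

variable {G H : Type*} [Group G] [Group H]

/-- If every Sylow `2`-subgroup containing `x` equals `P`, then every `2`-subgroup containing `x`
is contained in `P`. -/
theorem le_of_unique_sylow {x : G} {P : Sylow 2 G} (hP : ∀ R : Sylow 2 G, x ∈ R → R = P)
    {Y : Subgroup G} (hY : IsPGroup 2 Y) (hxY : x ∈ Y) : Y ≤ P := by
  obtain ⟨R, hR⟩ := hY.exists_le_sylow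
  rw [← hP R (hR hxY)]
  exact hR

theorem isPGroup_zpowers_of_pow_eq_one {g : G} {k : ℕ} (hg : g ^ 2 ^ k = 1) :
    IsPGroup 2 (Subgroup.zpowers g) := by
  rintro ⟨_, m, rfl⟩
  refine ⟨k, ?_⟩
  ext
  change (g ^ m) ^ 2 ^ k = 1
  rw [← zpow_natCast, zpow_comm, zpow_natCast, hg, one_zpow]

/-- A `2`-element normalizing a `2`-subgroup that contains the picky element `x` lies in the unique
Sylow `2`-subgroup containing `x`. -/
theorem mem_of_normalizes {x : G} {P : Sylow 2 G} (hP : ∀ R : Sylow 2 G, x ∈ R → R = P)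
    {Y : Subgroup G} (hY : IsPGroup 2 Y) (hxY : x ∈ Y) {g : G} {k : ℕ} (hg : g ^ 2 ^ k = 1)
    (hgY : ∀ y ∈ Y, g⁻¹ * y * g ∈ Y) : g ∈ P := by
  have hYP := le_of_unique_sylow hP hY hxY
  have hmem : x ∈ g • P := by
    change x ∈ (g • P).toSubgroup
    rw [Sylow.coe_subgroup_smul, Subgroup.mem_pointwise_smul_iff_inv_smul_mem]
    have := hYP (hgY x hxY)
    simpa [MulAut.smul_def] using this
  have hN := Sylow.smul_eq_iff_mem_normalizer.1 (hP _ hmem)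
  have h := (isPGroup_zpowers_of_pow_eq_one hg).inf_normalizer_sylow P
  have : g ∈ Subgroup.zpowers g ⊓ Subgroup.normalizer (P : Set G) :=
    ⟨Subgroup.mem_zpowers g, hN⟩
  rw [h] at this
  exact this.2

theorem mem_of_commute {x : G} {P : Sylow 2 G} (hP : ∀ R : Sylow 2 G, x ∈ R → R = P)
    (hx : x ∈ P) {g : G} {k : ℕ} (hg : g ^ 2 ^ k = 1) (hgx : Commute g x) : g ∈ P := by
  refine mem_of_normalizes hP (Y := Subgroup.zpowers x)
    (P.isPGroup'.to_le (Subgroup.zpowers_le.2 hx)) (Subgroup.mem_zpowers x) hg ?_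
  rintro _ ⟨m, rfl⟩
  have h : Commute g (x ^ m) := hgx.zpow_right m
  simp only
  rw [mul_assoc, ← h.eq, inv_mul_cancel_left]
  exact ⟨m, rfl⟩

/-- An element inverting the picky element `x`. -/
theorem mem_of_inverts {x : G} {P : Sylow 2 G} (hP : ∀ R : Sylow 2 G, x ∈ R → R = P)
    (hx : x ∈ P) {g : G} {k : ℕ} (hg : g ^ 2 ^ k = 1) (hgx : x * g * x = g) : g ∈ P := by
  refine mem_of_normalizes hP (Y := Subgroup.zpowers x)
    (P.isPGroup'.to_le (Subgroup.zpowers_le.2 hx)) (Subgroup.mem_zpowers x) hg ?_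
  have h1 : g⁻¹ * x * g = x⁻¹ := by
    rw [mul_assoc, inv_mul_eq_iff_eq_mul, eq_mul_inv_iff_mul_eq, hgx]
  rintro _ ⟨m, rfl⟩
  refine ⟨-m, ?_⟩
  have h2 := conj_zpow (i := m) (a := g⁻¹) (b := x)
  rw [inv_inv, h1] at h2
  simp only
  rw [← h2, inv_zpow, zpow_neg]

theorem exists_pow_eq_one_of_mem_sylow {P : Sylow 2 G} {g : G} (hg : g ∈ P) :
    ∃ k : ℕ, g ^ 2 ^ k = 1 := by
  obtain ⟨k, hk⟩ := P.isPGroup' ⟨g, hg⟩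
  exact ⟨k, by simpa [Subtype.ext_iff] using hk⟩

theorem IsPicky.exists_pow_eq_one {x : G} (hx : IsPicky x) : ∃ k : ℕ, x ^ 2 ^ k = 1 :=
  exists_pow_eq_one_of_mem_sylow hx.choose_spec.1

/-- Pickiness is inherited by a factor of a central product inside the ambient group. -/
theorem IsPicky.of_injective {x : G} (hx : IsPicky x) (f : H →* G) (hf : Function.Injective f)
    {y : H} (hy : ∃ k : ℕ, y ^ 2 ^ k = 1)
    (hc : ∀ h, Commute ((f y)⁻¹ * x) (f h)) : IsPicky y := by
  obtain ⟨P, hxP, hP⟩ := hx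
  obtain ⟨a, ha⟩ := exists_pow_eq_one_of_mem_sylow hxP
  obtain ⟨b, hb⟩ := hy
  set c := (f y)⁻¹ * x with hcdef
  have hxc : x = f y * c := by simp [hcdef]
  have hcpow : c ^ 2 ^ (a + b) = 1 := by
    have h1 : x ^ 2 ^ (a + b) = 1 := by rw [pow_add, pow_mul, ha, one_pow]
    have h2 : f y ^ 2 ^ (a + b) = 1 := by
      rw [pow_add, mul_comm, pow_mul, ← map_pow, hb, map_one, one_pow]
    rw [hxc, ((hc y).symm).mul_pow, h2, one_mul] at h1
    exact h1
  have hle : ∀ Q : Sylow 2 H, y ∈ Q → (Q : Subgroup H) ≤ (P : Subgroup G).comap f := by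
    intro Q hQ
    have hn : Subgroup.map f (Q : Subgroup H) ≤
        Subgroup.normalizer (Subgroup.zpowers c : Set G) := by
      rintro _ ⟨h, -, rfl⟩
      have hcomm : ∀ m : ℤ, f h * c ^ m * (f h)⁻¹ = c ^ m := fun m => by
        rw [← ((hc h).zpow_left m).eq, mul_inv_cancel_right]
      rw [Subgroup.mem_normalizer_iff]
      intro z
      constructor
      · rintro ⟨m, rfl⟩
        exact ⟨m, (hcomm m).symm⟩
      · rintro ⟨m, hm⟩
        refine ⟨m, ?_⟩
        have h3 : f h * c ^ m = f h * z := by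
          rw [← ((hc h).zpow_left m).eq, ← eq_mul_inv_iff_mul_eq]
          exact hm
        exact mul_left_cancel h3
    have hp : IsPGroup 2 (Subgroup.map f (Q : Subgroup H) ⊔ Subgroup.zpowers c : Subgroup G) :=
      IsPGroup.to_sup_of_normal_right' (Q.isPGroup'.map f)
        (isPGroup_zpowers_of_pow_eq_one hcpow) hn
    have h := le_of_unique_sylow hP hp (by
      rw [hxc]
      exact mul_mem (Subgroup.mem_sup_left ⟨y, hQ, rfl⟩)
        (Subgroup.mem_sup_right (Subgroup.mem_zpowers c)))
    exact Subgroup.map_le_iff_le_comap.1 (le_sup_left.trans h)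
  have hcomap : IsPGroup 2 ((P : Subgroup G).comap f) :=
    P.isPGroup'.comap_of_injective f hf
  obtain ⟨Q, hQ⟩ := (isPGroup_zpowers_of_pow_eq_one hb).exists_le_sylow
  have hyQ : y ∈ Q := hQ (Subgroup.mem_zpowers y)
  refine ⟨Q, hyQ, fun R hR => Sylow.ext ?_⟩
  rw [← Q.is_maximal' hcomap (hle Q hyQ), ← R.is_maximal' hcomap (hle R hR)]

theorem IsPicky.conj {x : G} (hx : IsPicky x) (h : G) : IsPicky (h * x * h⁻¹) := by
  obtain ⟨k, hk⟩ := hx.exists_pow_eq_one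
  refine hx.of_injective (MulAut.conj h⁻¹).toMonoidHom (MulAut.conj h⁻¹).injective
    ⟨k, by rw [conj_pow, hk]; simp⟩ fun g => ?_
  have : ((MulAut.conj h⁻¹).toMonoidHom (h * x * h⁻¹))⁻¹ * x = 1 := by simp [mul_assoc]
  rw [this]
  exact Commute.one_left _

end Picky

section Isometry

variable {F V E : Type*} [Field F] [AddCommGroup V] [Module F V] [AddCommGroup E] [Module F E]

/-- The group of linear automorphisms preserving a bilinear form. -/
def isometryGroup (B : LinearMap.BilinForm F V) : Subgroup (V ≃ₗ[F] V) where
  carrier := {g | ∀ u v, B (g u) (g v) = B u v}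
  mul_mem' {a b} ha hb u v := by
    change B (a (b u)) (a (b v)) = _
    rw [ha, hb]
  one_mem' _ _ := rfl
  inv_mem' {a} ha u v := by
    have := ha (a⁻¹ u) (a⁻¹ v)
    change B (a (a.symm u)) (a (a.symm v)) = _ at this
    rw [a.apply_symm_apply, a.apply_symm_apply] at this
    exact this.symm

variable {B : LinearMap.BilinForm F V} {C : LinearMap.BilinForm F E}

theorem isometryGroup.inv_apply_self (g : isometryGroup B) (u : V) :
    (g⁻¹).1 (g.1 u) = u := g.1.symm_apply_apply u

theorem isometryGroup.apply_inv_self (g : isometryGroup B) (u : V) :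
    g.1 ((g⁻¹).1 u) = u := g.1.apply_symm_apply u

theorem isometryGroup.mul_apply (g h : isometryGroup B) (u : V) :
    (g * h).1 u = g.1 (h.1 u) := rfl

/-- A bijective linear isometry, as an element of the isometry group. -/
def isometryGroup.mk (f g : V →ₗ[F] V) (hfg : ∀ v, f (g v) = v) (hgf : ∀ v, g (f v) = v)
    (hf : ∀ u v, B (f u) (f v) = B u v) : isometryGroup B :=
  ⟨LinearEquiv.ofLinearMap f g (LinearMap.ext hfg) (LinearMap.ext hgf), hf⟩

/-- Extend an isometry of an embedded nondegenerate space by the identity on the orthogonal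
complement, where `π` is the adjoint of the embedding `ι`. -/
def extendIsometry (ι : E →ₗ[F] V) (π : V →ₗ[F] E) (hι : ∀ u v, B (ι u) (ι v) = C u v)
    (hπ : ∀ v e, C (π v) e = B v (ι e)) (hπ' : ∀ v e, C e (π v) = B (ι e) v)
    (hπι : ∀ e, π (ι e) = e) :
    isometryGroup C →* isometryGroup B where
  toFun h := isometryGroup.mk
    (LinearMap.id + ι ∘ₗ ((h.1 : E →ₗ[F] E) - LinearMap.id) ∘ₗ π)
    (LinearMap.id + ι ∘ₗ (((h⁻¹).1 : E →ₗ[F] E) - LinearMap.id) ∘ₗ π)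
    (fun v => by
      simp [hπι]
      abel)
    (fun v => by
      simp [hπι]
      abel)
    (fun u v => by
      have := h.2 (π u) (π v)
      simp [hι, hπ', ← hπ, this]
      simp [hπ]
      abel)
  map_one' := by
    ext v
    simp [isometryGroup.mk]
  map_mul' a b := by
    ext v
    simp [isometryGroup.mk, hπι]
    abel

theorem extendIsometry_apply (ι : E →ₗ[F] V) (π : V →ₗ[F] E)
    (hι : ∀ u v, B (ι u) (ι v) = C u v)
    (hπ : ∀ v e, C (π v) e = B v (ι e)) (hπ' : ∀ v e, C e (π v) = B (ι e) v)
    (hπι : ∀ e, π (ι e) = e) (h : isometryGroup C) (v : V) :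
    (extendIsometry ι π hι hπ hπ' hπι h).1 v = v + ι (h.1 (π v) - π v) := by
  simp [extendIsometry, isometryGroup.mk]

/-- Pickiness is inherited by the restriction to an invariant nondegenerate subspace. -/
theorem IsPicky.of_embedding [FiniteDimensional F E] (hB : B.IsAlt) (hC : C.IsAlt)
    (hCn : ∀ u, (∀ v, C u v = 0) → u = 0)
    (ι : E →ₗ[F] V) (hι : ∀ u v, B (ι u) (ι v) = C u v)
    {x : isometryGroup B} (hx : IsPicky x) {y : isometryGroup C}
    (hxy : ∀ e, x.1 (ι e) = ι (y.1 e)) : IsPicky y := by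
  have hCnd : C.Nondegenerate := by
    refine ⟨hCn, fun u hu => hCn u fun v => ?_⟩
    rw [← LinearMap.IsAlt.neg hC, hu, neg_zero]
  let π : V →ₗ[F] E := (C.toDual hCnd).symm.toLinearMap ∘ₗ (LinearMap.lcomp F F ι) ∘ₗ B
  have hπ : ∀ v e, C (π v) e = B v (ι e) := fun v e => by
    simp only [π, LinearMap.comp_apply, LinearEquiv.coe_coe]
    rw [LinearMap.BilinForm.apply_toDual_symm_apply]
    rfl
  have hπ' : ∀ v e, C e (π v) = B (ι e) v := fun v e => by
    rw [← LinearMap.IsAlt.neg hC, hπ, LinearMap.IsAlt.neg hB]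
  have key : ∀ u w, (∀ e, C u e = C w e) → u = w := fun u w h =>
    sub_eq_zero.1 (hCn _ fun e => by rw [map_sub, LinearMap.sub_apply, h, sub_self])
  have hπι : ∀ e, π (ι e) = e := fun e => key _ _ fun e' => by rw [hπ, hι]
  have hιinj : Function.Injective ι := fun a b hab => by rw [← hπι a, hab, hπι]
  let φ := extendIsometry ι π hι hπ hπ' hπι
  have hφ : ∀ h v, (φ h).1 v = v + ι (h.1 (π v) - π v) :=
    extendIsometry_apply ι π hι hπ hπ' hπι
  have hπx : ∀ v, π (x.1 v) = y.1 (π v) := fun v => key _ _ fun e => by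
    have h1 : x.1 (ι ((y⁻¹).1 e)) = ι e := by
      rw [hxy, isometryGroup.apply_inv_self]
    rw [hπ, ← h1, x.2, ← hπ, ← y.2, isometryGroup.apply_inv_self]
  have hφinj : Function.Injective φ := fun a b hab => by
    ext e
    have h := congrArg (fun g => g.1 (ι e)) hab
    simp only [hφ, hπι, map_sub, add_sub_cancel] at h
    exact hιinj h
  obtain ⟨k, hk⟩ := hx.exists_pow_eq_one
  refine hx.of_injective φ hφinj ⟨k, ?_⟩ fun h => ?_
  · have hpow : ∀ (m : ℕ) e, (x ^ m).1 (ι e) = ι ((y ^ m).1 e) := by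
      intro m
      induction m with
      | zero => intro e; rfl
      | succ m ih =>
        intro e
        rw [pow_succ, pow_succ, isometryGroup.mul_apply, isometryGroup.mul_apply, hxy, ih]
    ext e
    apply hιinj
    rw [← hpow, hk]
    rfl
  · have h1 : x * φ h = φ (y * h * y⁻¹) * x := by
      ext v
      simp only [isometryGroup.mul_apply, hφ, hπx, map_add, hxy, map_sub,
        isometryGroup.inv_apply_self]
    rw [map_mul, map_mul, map_inv] at h1
    change (φ y)⁻¹ * x * φ h = φ h * ((φ y)⁻¹ * x)
    rw [mul_assoc, h1]
    group

end Isometry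

section Symplectic

variable {n : ℕ} {F : Type*} [Field F]

/-- The standard symplectic form on `F ^ (n + n)`. -/
def stdForm (n : ℕ) (F : Type*) [Field F] : LinearMap.BilinForm F (Fin n ⊕ Fin n → F) :=
  Matrix.toLinearMap₂' F (Matrix.J (Fin n) F)

theorem stdForm_apply (u v : Fin n ⊕ Fin n → F) :
    stdForm n F u v = ∑ i, (u (.inr i) * v (.inl i) - u (.inl i) * v (.inr i)) := by
  simp [stdForm, Matrix.toLinearMap₂'_apply', Matrix.J, Matrix.fromBlocks_mulVec, dotProduct,
    Finset.sum_sub_distrib, Matrix.neg_mulVec]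
  ring

theorem stdForm_isAlt : (stdForm n F).IsAlt := fun u => by
  simp [stdForm_apply, mul_comm]

theorem stdForm_nondegenerate (u : Fin n ⊕ Fin n → F) (hu : ∀ v, stdForm n F u v = 0) :
    u = 0 := by
  funext i
  rcases i with i | i
  · simpa [stdForm_apply, Pi.single_apply] using hu (Pi.single (.inr i) 1)
  · simpa [stdForm_apply, Pi.single_apply] using hu (Pi.single (.inl i) 1)

/-- The matrix of an isometry of the standard symplectic form. -/
def toSymplecticGroup (n : ℕ) (F : Type*) [Field F] :
    isometryGroup (stdForm n F) →* Matrix.symplecticGroup (Fin n) F where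
  toFun g := ⟨LinearMap.toMatrix' (g.1 : (Fin n ⊕ Fin n → F) →ₗ[F] (Fin n ⊕ Fin n → F)), by
    rw [SymplecticGroup.mem_iff']
    set A := LinearMap.toMatrix' (g.1 : (Fin n ⊕ Fin n → F) →ₗ[F] (Fin n ⊕ Fin n → F)) with hA
    have h : (Matrix.toLinearMap₂' F (A.transpose * Matrix.J (Fin n) F * A) :
        LinearMap.BilinForm F (Fin n ⊕ Fin n → F)) =
          Matrix.toLinearMap₂' F (Matrix.J (Fin n) F) := by
      refine LinearMap.ext fun u => LinearMap.ext fun v => ?_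
      have := g.2 u v
      simp only [stdForm, Matrix.toLinearMap₂'_apply'] at this
      simp only [Matrix.toLinearMap₂'_apply', ← Matrix.mulVec_mulVec]
      rw [← this, Matrix.dotProduct_mulVec, Matrix.vecMul_transpose, hA,
        LinearMap.toMatrix'_mulVec, LinearMap.toMatrix'_mulVec]
      rfl
    exact (Matrix.toLinearMap₂' F).injective h⟩
  map_one' := by
    ext : 1
    exact LinearMap.toMatrix'_id
  map_mul' a b := by
    ext : 1
    exact LinearMap.toMatrix'_comp _ _

theorem toSymplecticGroup_bijective : Function.Bijective (toSymplecticGroup n F) := by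
  constructor
  · intro a b hab
    have h : LinearMap.toMatrix' (a.1 : (Fin n ⊕ Fin n → F) →ₗ[F] (Fin n ⊕ Fin n → F)) =
        LinearMap.toMatrix' (b.1 : (Fin n ⊕ Fin n → F) →ₗ[F] (Fin n ⊕ Fin n → F)) :=
      congrArg Subtype.val hab
    refine Subtype.ext (LinearEquiv.ext fun v => ?_)
    exact LinearMap.congr_fun (LinearMap.toMatrix'.injective h) _
  · intro A
    refine ⟨isometryGroup.mk (Matrix.toLin' A.1) (Matrix.toLin' (A⁻¹).1) (fun v => ?_)
      (fun v => ?_) (fun u v => ?_), ?_⟩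
    · have : A.1 * (A⁻¹).1 = 1 := congrArg Subtype.val (mul_inv_cancel A)
      rw [← Matrix.toLin'_mul_apply, this, Matrix.toLin'_one, LinearMap.id_apply]
    · have : (A⁻¹).1 * A.1 = 1 := congrArg Subtype.val (inv_mul_cancel A)
      rw [← Matrix.toLin'_mul_apply, this, Matrix.toLin'_one, LinearMap.id_apply]
    · have h := SymplecticGroup.mem_iff'.1 A.2
      have h2 : stdForm n F u v = u ⬝ᵥ ((A.1.transpose * Matrix.J (Fin n) F * A.1).mulVec v) := by
        rw [h, stdForm, Matrix.toLinearMap₂'_apply']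
      rw [h2]
      simp [stdForm, Matrix.toLinearMap₂'_apply', ← Matrix.mulVec_mulVec,
        Matrix.dotProduct_mulVec, Matrix.vecMul_transpose]
    · ext : 1
      exact LinearMap.toMatrix'_toLin' A.1

end Symplectic

section Arithmetic

theorem pow_modEq_of_sq_modEq_one {q N m : ℕ} (h : q ^ 2 ≡ 1 [MOD N]) (hm : Odd m) :
    q ^ m ≡ q [MOD N] := by
  obtain ⟨k, rfl⟩ := hm
  rw [pow_add, pow_mul, pow_one]
  simpa using (h.pow k).mul_right q

theorem not_pow_add_one_dvd_two_pow {q m j : ℕ} (hq : Odd q) (hq3 : 3 ≤ q) (hm : 2 ≤ m)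
    (h : q ^ m + 1 ∣ 2 ^ j) : False := by
  rcases Nat.even_or_odd m with hme | hmo
  · obtain ⟨k, rfl⟩ := hme
    obtain ⟨i, -, hi⟩ := (Nat.dvd_prime_pow Nat.prime_two).1 h
    have h1 : (q ^ k) ^ 2 % 4 = 1 := by
      obtain ⟨c, hc⟩ := hq.pow (n := k)
      rw [hc]
      ring_nf
      omega
    have h2 : q ^ (k + k) = (q ^ k) ^ 2 := by ring
    have h3 : 3 ^ 1 ≤ q ^ (k + k) :=
      (Nat.pow_le_pow_left hq3 1).trans (Nat.pow_le_pow_right (by omega) (by omega))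
    rw [← h2] at h1
    rcases i with _ | _ | i
    · omega
    · omega
    · rw [pow_succ, pow_succ] at hi
      omega
  · obtain ⟨a, -, ha⟩ := (Nat.dvd_prime_pow Nat.prime_two).1
      ((hmo.nat_add_dvd_pow_add_pow q 1).trans (by simpa using h))
    obtain ⟨i, -, hi⟩ := (Nat.dvd_prime_pow Nat.prime_two).1 h
    have hlt : 2 ^ a < 2 ^ i := by
      rw [← ha, ← hi]
      have := Nat.pow_lt_pow_right (a := q) (by omega) (show 1 < m by omega)
      rw [pow_one] at this
      omega
    have hai : 2 ^ (a + 1) ∣ 2 ^ i :=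
      pow_dvd_pow 2 ((Nat.pow_lt_pow_iff_right (by norm_num)).1 hlt)
    have ha1 : 1 ≤ a := by
      rcases a with _ | a
      · omega
      · omega
    have hsq : q ^ 2 ≡ 1 [MOD 2 ^ (a + 1)] := by
      obtain ⟨b, rfl⟩ : ∃ b, a = b + 1 := ⟨a - 1, by omega⟩
      have hq' : q = 2 ^ (b + 1) - 1 := by omega
      have h4 : 2 ≤ 2 ^ (b + 1) := by omega
      refine ((Nat.modEq_iff_dvd' (by nlinarith)).2 ?_).symm
      refine ⟨2 ^ b - 1, ?_⟩
      zify [show 1 ≤ q ^ 2 by nlinarith, show 1 ≤ 2 ^ b from Nat.one_le_two_pow]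
      have : (q : ℤ) = 2 * 2 ^ b - 1 := by
        have : (q : ℤ) + 1 = 2 ^ (b + 1) := by exact_mod_cast ha
        rw [pow_succ] at this
        linarith
      rw [this]
      ring
    have hmod := (pow_modEq_of_sq_modEq_one hsq hmo).add_right 1
    rw [ha, hi] at hmod
    have := (Nat.modEq_zero_iff_dvd.2 hai).symm.trans hmod
    have := Nat.le_of_dvd (by positivity) (Nat.modEq_zero_iff_dvd.1 this.symm)
    rw [pow_succ] at this
    have : 0 < 2 ^ a := by positivity
    omega

theorem eq_three_of_pow_sub_one_dvd_two_pow {q m j : ℕ} (hq : Odd q) (hq3 : 3 ≤ q) (hm : 2 ≤ m)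
    (h : q ^ m - 1 ∣ 2 ^ j) : q = 3 ∧ m = 2 := by
  have hqm : ∀ k, 1 ≤ q ^ k := fun k => Nat.one_le_pow _ _ (by omega)
  rcases Nat.even_or_odd m with hme | hmo
  · obtain ⟨k, rfl⟩ := hme
    have hfac : q ^ (k + k) - 1 = (q ^ k + 1) * (q ^ k - 1) := by
      have := Nat.sq_sub_sq (q ^ k) 1
      rw [← this]
      ring_nf
    rw [hfac] at h
    have hk : k = 1 := by
      by_contra hk
      exact not_pow_add_one_dvd_two_pow hq hq3 (by omega) ((Dvd.intro _ rfl).trans h)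
    subst hk
    refine ⟨?_, rfl⟩
    obtain ⟨a, -, ha⟩ := (Nat.dvd_prime_pow Nat.prime_two).1 ((Dvd.intro _ rfl).trans h)
    obtain ⟨b, -, hb⟩ := (Nat.dvd_prime_pow Nat.prime_two).1 ((Dvd.intro_left _ rfl).trans h)
    rw [pow_one] at ha hb
    rcases a with _ | _ | a
    · omega
    · omega
    · rcases b with _ | _ | b
      · omega
      · omega
      · rw [pow_add] at ha hb
        omega
  · have hdvd : q - 1 ∣ q ^ m - 1 := by simpa using Nat.sub_dvd_pow_sub_pow q 1 m
    obtain ⟨a, -, ha⟩ := (Nat.dvd_prime_pow Nat.prime_two).1 (hdvd.trans h)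
    obtain ⟨i, -, hi⟩ := (Nat.dvd_prime_pow Nat.prime_two).1 h
    have hlt : 2 ^ a < 2 ^ i := by
      rw [← ha, ← hi]
      have := Nat.pow_lt_pow_right (a := q) (by omega) (show 1 < m by omega)
      rw [pow_one] at this
      omega
    have hai : 2 ^ (a + 1) ∣ 2 ^ i :=
      pow_dvd_pow 2 ((Nat.pow_lt_pow_iff_right (by norm_num)).1 hlt)
    have hsq : q ^ 2 ≡ 1 [MOD 2 ^ (a + 1)] := by
      rcases a with _ | b
      · omega
      refine ((Nat.modEq_iff_dvd' (hqm 2)).2 ?_).symm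
      refine ⟨2 ^ b + 1, ?_⟩
      zify [hqm 2]
      have : (q : ℤ) = 2 * 2 ^ b + 1 := by
        have : (q : ℤ) - 1 = 2 ^ (b + 1) := by
          rw [← Nat.cast_one, ← Nat.cast_sub (by omega)]
          exact_mod_cast ha
        rw [pow_succ] at this
        linarith
      rw [this]
      ring
    have hmod := pow_modEq_of_sq_modEq_one hsq hmo
    have hq' : q = 2 ^ a + 1 := by omega
    have hqm' : q ^ m = 2 ^ i + 1 := by have := hqm m; omega
    rw [hqm'] at hmod
    rw [hq'] at hmod
    have hmod := Nat.ModEq.add_right_cancel' 1 hmod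
    have := (Nat.modEq_zero_iff_dvd.2 hai).symm.trans hmod
    have := Nat.le_of_dvd (by positivity) (Nat.modEq_zero_iff_dvd.1 this.symm)
    rw [pow_succ] at this
    have : 0 < 2 ^ a := by positivity
    omega

end Arithmetic

section SpecialLinear

open Polynomial
open scoped MatrixGroups

variable {L : Type*} [Field L]

/-- The companion matrix of `T² - ρ T + 1`. -/
def companionSL (ρ : L) : SL(2, L) := ⟨!![0, -1; 1, ρ], by simp [Matrix.det_fin_two]⟩

/-- The element `α + β X` of determinant one, where `X` is the companion matrix. -/
def torusSL (ρ α β : L) (h : α ^ 2 + ρ * α * β + β ^ 2 = 1) : SL(2, L) :=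
  ⟨!![α, -β; β, α + ρ * β], by rw [Matrix.det_fin_two_of, ← h]; ring⟩

/-- An element of order four inverting the companion matrix. -/
def flipSL (ρ a b : L) (h : a ^ 2 - ρ * a * b + b ^ 2 = -1) : SL(2, L) :=
  ⟨!![a, b; b - ρ * a, -a], by
    rw [Matrix.det_fin_two_of]; linear_combination -h⟩

theorem exists_flip [Fintype L] (hodd : Fintype.card L % 2 = 1) {ρ : L} (hρ : ρ ^ 2 ≠ 4) :
    ∃ a b : L, a ^ 2 - ρ * a * b + b ^ 2 = -1 := by
  have h2 : (2 : L) ≠ 0 := fun h => by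
    have := FiniteField.even_card_iff_char_two (F := L)
    have hc : ringChar L = 2 := by
      have : ringChar L ∣ 2 := ringChar.dvd (by exact_mod_cast h)
      rcases (Nat.dvd_prime Nat.prime_two).1 this with h1 | h1
      · exact absurd h1 (CharP.ringChar_ne_one)
      · exact h1
    rw [this] at hc
    omega
  have hd : (1 - ρ ^ 2 / 4 : L) ≠ 0 := by
    intro h
    apply hρ
    have h4 : (4 : L) ≠ 0 := by
      have : (4 : L) = 2 * 2 := by norm_num
      rw [this]; exact mul_ne_zero h2 h2
    field_simp at h
    linear_combination -h
  obtain ⟨a, b, hab⟩ := FiniteField.exists_root_sum_quadratic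
    (f := (X ^ 2 + 1 : L[X])) (g := C (1 - ρ ^ 2 / 4) * X ^ 2)
    (by compute_degree!) (by compute_degree!) hodd
  refine ⟨a + ρ * b / 2, b, ?_⟩
  simp at hab
  have h4 : (4 : L) = 2 * 2 := by norm_num
  rw [h4] at hab
  field_simp at hab ⊢
  linear_combination hab

theorem torus_pow_eigenvalue {K : Type*} [Field K] [Algebra L K] {ρ α β : L} {θ : K}
    (hθ : θ ^ 2 - algebraMap L K ρ * θ + 1 = 0) (h : α ^ 2 + ρ * α * β + β ^ 2 = 1) {n : ℕ}
    (hn : torusSL ρ α β h ^ n = 1) : (algebraMap L K α + algebraMap L K β * θ) ^ n = 1 := by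
  set μ := algebraMap L K α + algebraMap L K β * θ with hμ
  have key : ∀ m : ℕ,
      algebraMap L K ((torusSL ρ α β h ^ m).1 0 0) -
        θ * algebraMap L K ((torusSL ρ α β h ^ m).1 0 1) = μ ^ m := by
    intro m
    induction m with
    | zero => simp
    | succ m ih =>
      rw [pow_succ, pow_succ, ← ih]
      simp only [Matrix.SpecialLinearGroup.coe_mul, Matrix.mul_apply, Fin.sum_univ_two]
      generalize (torusSL ρ α β h ^ m).1 0 0 = p
      generalize (torusSL ρ α β h ^ m).1 0 1 = r
      simp [torusSL, hμ]
      linear_combination (algebraMap L K r * algebraMap L K β) * hθ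
  have := key n
  rw [hn] at this
  simpa using this.symm

theorem torus_pow_card [Fintype L] (hodd : Fintype.card L % 2 = 1) {ρ : L} (hρ : ρ ^ 2 ≠ 4)
    (hX : IsPicky (companionSL ρ)) :
    ∃ k : ℕ, ∀ α β : L, ∀ h : α ^ 2 + ρ * α * β + β ^ 2 = 1, torusSL ρ α β h ^ 2 ^ k = 1 := by
  obtain ⟨P, hXP, hP⟩ := hX
  have hfin : Finite SL(2, L) := inferInstance
  have hflip : ∀ a b : L, ∀ h : a ^ 2 - ρ * a * b + b ^ 2 = -1, flipSL ρ a b h ∈ P := by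
    intro a b h
    refine mem_of_inverts hP hXP (k := 2) ?_ ?_
    · have h1 : flipSL ρ a b h * flipSL ρ a b h = -1 := by
        ext i j
        rw [Matrix.SpecialLinearGroup.coe_mul, Matrix.mul_apply, Fin.sum_univ_two]
        fin_cases i <;> fin_cases j <;> simp [flipSL] <;>
          first | ring1 | linear_combination h
      rw [show 2 ^ 2 = 2 + 2 by norm_num, pow_add, pow_two, h1]
      simp
    · ext i j
      simp only [Matrix.SpecialLinearGroup.coe_mul, Matrix.mul_apply, Fin.sum_univ_two]
      fin_cases i <;> fin_cases j <;> simp [flipSL, companionSL] <;> ring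
  obtain ⟨k, hk⟩ := IsPGroup.iff_card.1 P.isPGroup'
  refine ⟨k, fun α β h => ?_⟩
  obtain ⟨a, b, hab⟩ := exists_flip hodd hρ
  have hab' : (a * α + b * β) ^ 2 - ρ * (a * α + b * β) * (b * α - a * β + ρ * b * β) +
      (b * α - a * β + ρ * b * β) ^ 2 = -1 := by
    linear_combination (α ^ 2 + ρ * α * β + β ^ 2) * hab - h
  have hmul : flipSL ρ a b hab * torusSL ρ α β h = flipSL ρ _ _ hab' := by
    ext i j
    simp only [Matrix.SpecialLinearGroup.coe_mul, Matrix.mul_apply, Fin.sum_univ_two]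
    fin_cases i <;> fin_cases j <;> simp [flipSL, torusSL] <;> ring
  have hmem : torusSL ρ α β h ∈ P := by
    rw [← inv_mul_cancel_left (flipSL ρ a b hab) (torusSL ρ α β h), hmul]
    exact mul_mem (inv_mem (hflip _ _ _)) (hflip _ _ _)
  have := pow_card_eq_one' (x := (⟨_, hmem⟩ : P))
  change _ ^ Nat.card (P : Subgroup SL(2, L)) = 1 at this
  rw [hk] at this
  simpa [Subtype.ext_iff] using this

theorem card_dvd_of_picky_companion [Fintype L] (hodd : Fintype.card L % 2 = 1) {ρ : L}
    (hρ : ρ ^ 2 ≠ 4) (hX : IsPicky (companionSL ρ)) :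
    (∃ ω : L, ω ^ 2 - ρ * ω + 1 = 0 ∧ ∃ j, Fintype.card L - 1 ∣ 2 ^ j) ∨
      ∃ j, Fintype.card L + 1 ∣ 2 ^ j := by
  classical
  obtain ⟨k, hk⟩ := torus_pow_card hodd hρ hX
  by_cases hω : ∃ ω : L, ω ^ 2 - ρ * ω + 1 = 0
  · left
    obtain ⟨ω, hω⟩ := hω
    refine ⟨ω, hω, k, ?_⟩
    have hω0 : ω ≠ 0 := by rintro rfl; simp at hω
    have hd : ω - ω⁻¹ ≠ 0 := by
      intro h
      apply hρ
      have h1 : ω ^ 2 = 1 := by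
        field_simp at h
        linear_combination h
      have h2 : ρ = 2 * ω := by
        apply mul_right_cancel₀ hω0
        linear_combination -hω - h1
      rw [h2, mul_pow, h1]
      norm_num
    have hpow : ∀ μ : Lˣ, μ ^ 2 ^ k = 1 := by
      intro μ
      set β := ((μ : L) - (μ : L)⁻¹) / (ω - ω⁻¹) with hβ
      have hβ' : β * (ω - ω⁻¹) = (μ : L) - (μ : L)⁻¹ := div_mul_cancel₀ _ hd
      have hμ : (μ : L) * (μ : L)⁻¹ = 1 := mul_inv_cancel₀ μ.ne_zero
      have hωi : ω * ω⁻¹ = 1 := mul_inv_cancel₀ hω0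
      have hρω : ρ = ω + ω⁻¹ := by
        apply mul_right_cancel₀ hω0
        linear_combination -hω - hωi
      have hN : ((μ : L) - β * ω) ^ 2 + ρ * ((μ : L) - β * ω) * β + β ^ 2 = 1 := by
        rw [hρω]
        linear_combination (-(μ : L)) * hβ' + hμ - β ^ 2 * hωi
      have := torus_pow_eigenvalue (K := L) (θ := ω) (by simpa using hω) hN (hk _ _ hN)
      ext
      simpa using this
    have := Monoid.exponent_dvd_of_forall_pow_eq_one hpow
    rwa [IsCyclic.exponent_eq_card, Nat.card_eq_fintype_card, Fintype.card_units] at this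
  · right
    push Not at hω
    set p : L[X] := X ^ 2 - C ρ * X + 1 with hp
    have hpdeg : p.natDegree = 2 := by rw [hp]; compute_degree!
    have hpm : p.Monic := by
      rw [hp]; monicity!
    have hirr : Irreducible p := by
      refine (irreducible_iff_roots_eq_zero_of_degree_le_three (by omega) (by omega)).2 ?_
      refine Multiset.eq_zero_of_forall_notMem fun z hz => hω z ?_
      have := (mem_roots'.1 hz).2
      simpa [hp, IsRoot] using this
    have := Fact.mk hirr
    let K := AdjoinRoot p
    set θ : K := AdjoinRoot.root p with hθdef
    have hθ : θ ^ 2 - algebraMap L K ρ * θ + 1 = 0 := by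
      have := AdjoinRoot.aeval_eq (f := p) p
      rw [AdjoinRoot.mk_self] at this
      have h1 : AdjoinRoot.root p ^ 2 - AdjoinRoot.of p ρ * AdjoinRoot.root p + 1 = 0 := by
        simpa [hp] using this
      exact h1
    have hfd : Module.Finite L K := (AdjoinRoot.powerBasis hirr.ne_zero).finite
    have : Finite K := Module.finite_of_finite L
    have : Fintype K := Fintype.ofFinite K
    have hcard : Fintype.card K = Fintype.card L ^ 2 := by
      rw [Module.card_eq_pow_finrank (K := L), (AdjoinRoot.powerBasis hirr.ne_zero).finrank,
        AdjoinRoot.powerBasis_dim, hpdeg]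
    have hrep : ∀ κ : K, ∃ a b : L, κ = algebraMap L K a + algebraMap L K b * θ := by
      intro κ
      obtain ⟨f, rfl⟩ := AdjoinRoot.mk_surjective κ
      have h1 : AdjoinRoot.mk p f = AdjoinRoot.mk p (f %ₘ p) := by
        conv_lhs => rw [← modByMonic_add_div f p]
        simp
      have h2 : (f %ₘ p).natDegree ≤ 1 := by
        have := natDegree_modByMonic_lt f hpm (by rintro h; rw [h] at hpdeg; simp at hpdeg)
        omega
      obtain ⟨b, a, hab⟩ := exists_eq_X_add_C_of_natDegree_le_one h2
      refine ⟨a, b, ?_⟩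
      rw [h1, hab, map_add, map_mul, AdjoinRoot.mk_C, AdjoinRoot.mk_C, AdjoinRoot.mk_X]
      change AdjoinRoot.of p b * θ + AdjoinRoot.of p a = AdjoinRoot.of p a + AdjoinRoot.of p b * θ
      ring
    have hpow : ∀ κ : Kˣ, κ ^ (2 ^ (k + 1) * (Fintype.card L - 1)) = 1 := by
      intro κ
      obtain ⟨a, b, hab⟩ := hrep κ
      set N := a ^ 2 + ρ * a * b + b ^ 2 with hN
      have hN0 : N ≠ 0 := by
        intro h0
        by_cases hb : b = 0
        · have ha : a = 0 := by
            rw [hN, hb] at h0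
            simpa using h0
          exact κ.ne_zero (by rw [hab, ha, hb]; simp)
        · apply hω (-a / b)
          field_simp
          linear_combination h0
      have hNt : ((a ^ 2 - b ^ 2) / N) ^ 2 + ρ * ((a ^ 2 - b ^ 2) / N) *
          ((2 * a * b + ρ * b ^ 2) / N) + ((2 * a * b + ρ * b ^ 2) / N) ^ 2 = 1 := by
        field_simp
        rw [hN]
        ring
      have h1 := torus_pow_eigenvalue (K := K) hθ hNt (hk _ _ hNt)
      have h2 : algebraMap L K ((a ^ 2 - b ^ 2) / N) +
          algebraMap L K ((2 * a * b + ρ * b ^ 2) / N) * θ = (κ : K) ^ 2 / algebraMap L K N := by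
        have : algebraMap L K N ≠ 0 := by simpa using hN0
        rw [hab, map_div₀, map_div₀]
        field_simp
        simp only [map_sub, map_add, map_mul, map_pow, map_ofNat]
        linear_combination (-(algebraMap L K b) ^ 2 * (algebraMap L K N)⁻¹) * hθ
      rw [h2, div_pow, div_eq_one_iff_eq (pow_ne_zero _ (by simpa using hN0)), ← pow_mul,
        ← pow_succ'] at h1
      ext
      push_cast
      rw [pow_mul, h1, ← map_pow, ← map_pow, ← pow_mul, mul_comm, pow_mul,
        FiniteField.pow_card_sub_one_eq_one _ hN0]
      simp
    have := Monoid.exponent_dvd_of_forall_pow_eq_one hpow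
    rw [IsCyclic.exponent_eq_card, Nat.card_eq_fintype_card, Fintype.card_units, hcard] at this
    have h1 : Fintype.card L ^ 2 - 1 = (Fintype.card L + 1) * (Fintype.card L - 1) := by
      simpa using Nat.sq_sub_sq (Fintype.card L) 1
    rw [h1] at this
    refine ⟨k + 1, Nat.dvd_of_mul_dvd_mul_right ?_ this⟩
    have := Fintype.one_lt_card (α := L)
    omega

end SpecialLinear

section Invariant

open Polynomial

variable {F V : Type*} [Field F] [AddCommGroup V] [Module F V] {B : LinearMap.BilinForm F V}

namespace isometryGroup

theorem apply_left (hx : isometryGroup B) (u v : V) : B (hx.1 u) v = B u ((hx⁻¹).1 v) := by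
  rw [← hx.2 u, apply_inv_self]

theorem apply_right (hx : isometryGroup B) (u v : V) : B u (hx.1 v) = B ((hx⁻¹).1 u) v := by
  rw [← hx.2 _ v, apply_inv_self]

/-- The endomorphism `x + x⁻¹`. -/
def addInv (x : isometryGroup B) : Module.End F V :=
  (x.1 : V →ₗ[F] V) + ((x⁻¹).1 : V →ₗ[F] V)

variable (x : isometryGroup B)

theorem addInv_apply (u : V) : addInv x u = x.1 u + (x⁻¹).1 u := rfl

theorem addInv_adjoint (u v : V) : B (addInv x u) v = B u (addInv x v) := by
  have h := apply_left x⁻¹ u v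
  rw [inv_inv] at h
  simp only [addInv_apply, map_add, LinearMap.add_apply, apply_left, h]
  abel

theorem aeval_adjoint (p : F[X]) (u v : V) :
    B (aeval (addInv x) p u) v = B u (aeval (addInv x) p v) := by
  induction p using Polynomial.induction_on' generalizing u v with
  | add p q hp hq => simp [hp, hq]
  | monomial n a =>
    have h : ∀ n : ℕ, ∀ u v, B ((addInv x ^ n) u) v = B u ((addInv x ^ n) v) := by
      intro n
      induction n with
      | zero => intro u v; rfl
      | succ n ih =>
        intro u v
        rw [pow_succ, Module.End.mul_apply, ih, addInv_adjoint, ← Module.End.mul_apply,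
          ← pow_succ', pow_succ]
    simp [aeval_monomial, h]

theorem apply_aeval (p : F[X]) (u : V) :
    x.1 (aeval (addInv x) p u) = aeval (addInv x) p (x.1 u) := by
  have h : Commute (addInv x) (x.1 : V →ₗ[F] V) := by
    ext v
    change x.1 (x.1 v) + (x⁻¹).1 (x.1 v) = x.1 (x.1 v + (x⁻¹).1 v)
    rw [map_add, apply_inv_self, inv_apply_self]
  have h2 : Commute (aeval (addInv x) p) (x.1 : V →ₗ[F] V) :=
    (Algebra.commute_of_mem_adjoin_singleton_of_commute
      (aeval_mem_adjoin_singleton F _) h.symm).symm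
  exact (LinearMap.congr_fun h2.eq u).symm

theorem addInv_inv : addInv x⁻¹ = addInv x := by
  ext v
  rw [addInv_apply, addInv_apply, inv_inv, add_comm]

theorem inv_apply_aeval (p : F[X]) (u : V) :
    (x⁻¹).1 (aeval (addInv x) p u) = aeval (addInv x) p ((x⁻¹).1 u) := by
  rw [← addInv_inv]
  exact apply_aeval x⁻¹ p u

/-- `U` is invariant under `x` and the form is nondegenerate on `U`. -/
structure IsNondegInvariant (U : Submodule F V) : Prop where
  map_mem : ∀ u ∈ U, x.1 u ∈ U
  inv_mem : ∀ u ∈ U, (x⁻¹).1 u ∈ U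
  nondeg : ∀ u ∈ U, (∀ v ∈ U, B u v = 0) → u = 0

variable {x}

theorem isNondegInvariant_top (hB : ∀ u, (∀ v, B u v = 0) → u = 0) :
    IsNondegInvariant x ⊤ :=
  ⟨fun _ _ => trivial, fun _ _ => trivial, fun u _ h => hB u fun v => h v trivial⟩

namespace IsNondegInvariant

variable {U : Submodule F V}

theorem addInv_mem (hU : IsNondegInvariant x U) {u : V} (hu : u ∈ U) : addInv x u ∈ U :=
  add_mem (hU.map_mem u hu) (hU.inv_mem u hu)

theorem aeval_mem (hU : IsNondegInvariant x U) (p : F[X]) {u : V} (hu : u ∈ U) :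
    aeval (addInv x) p u ∈ U := by
  induction p using Polynomial.induction_on' with
  | add p q hp hq => simpa using add_mem hp hq
  | monomial n a =>
    have h : ∀ n : ℕ, (addInv x ^ n) u ∈ U := by
      intro n
      induction n with
      | zero => exact hu
      | succ n ih =>
        rw [pow_succ', Module.End.mul_apply]
        exact hU.addInv_mem ih
    simpa [aeval_monomial] using U.smul_mem a (h n)

/-- Primary components are nondegenerate. -/
theorem inf_ker (hU : IsNondegInvariant x U) {g h : F[X]} (hgh : IsCoprime g h)
    (hz : ∀ u ∈ U, aeval (addInv x) (g * h) u = 0) :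
    IsNondegInvariant x (U ⊓ LinearMap.ker (aeval (addInv x) g)) := by
  refine ⟨fun u hu => ⟨hU.map_mem u hu.1, ?_⟩, fun u hu => ⟨hU.inv_mem u hu.1, ?_⟩,
    fun u hu hu' => hU.nondeg u hu.1 fun v hv => ?_⟩
  · change aeval (addInv x) g (x.1 u) = 0
    rw [← apply_aeval, LinearMap.mem_ker.1 hu.2, map_zero]
  · change aeval (addInv x) g ((x⁻¹).1 u) = 0
    rw [← inv_apply_aeval, LinearMap.mem_ker.1 hu.2, map_zero]
  · obtain ⟨a, b, hab⟩ := hgh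
    have h1 : aeval (addInv x) (b * h) u = u := by
      have : b * h = 1 - a * g := by rw [← hab]; ring
      rw [this]
      simp [LinearMap.mem_ker.1 hu.2]
    rw [← h1, aeval_adjoint]
    refine hu' _ ⟨hU.aeval_mem _ hv, ?_⟩
    change aeval (addInv x) g (aeval (addInv x) (b * h) v) = 0
    rw [← Module.End.mul_apply, ← map_mul, show g * (b * h) = b * (g * h) by ring, map_mul,
      Module.End.mul_apply, hz v hv, map_zero]

theorem eq_inv_of_forall (hB : B.IsAlt) (hU : IsNondegInvariant x U)
    (h : ∀ v ∈ U, B v (x.1 v) = 0) {u : V} (hu : u ∈ U) : x.1 u = (x⁻¹).1 u := by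
  refine sub_eq_zero.1 (hU.nondeg _ (sub_mem (hU.map_mem u hu) (hU.inv_mem u hu)) fun v hv => ?_)
  have h1 := h _ (add_mem hu hv)
  have h2 := apply_right x u v
  have h3 := LinearMap.IsAlt.neg hB v ((x⁻¹).1 u)
  simp only [map_add, LinearMap.add_apply, h u hu, h v hv] at h1
  rw [← LinearMap.IsAlt.neg hB, map_sub]
  linear_combination -h1 + h2 - h3

end IsNondegInvariant

end isometryGroup

end Invariant

section Diagonal

open scoped MatrixGroups

variable {F : Type*} [Field F]

/-- The orthogonal sum of three hyperbolic planes. -/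
def threePlanes (F : Type*) [Field F] : LinearMap.BilinForm F (Fin 3 → Fin 2 → F) :=
  LinearMap.mk₂ F (fun u v => ∑ i, (u i 0 * v i 1 - u i 1 * v i 0))
    (fun u v w => by
      rw [← Finset.sum_add_distrib]
      exact Finset.sum_congr rfl fun i _ => by simp only [Pi.add_apply]; ring)
    (fun c u v => by
      rw [smul_eq_mul, Finset.mul_sum]
      exact Finset.sum_congr rfl fun i _ => by simp only [Pi.smul_apply, smul_eq_mul]; ring)
    (fun u v w => by
      rw [← Finset.sum_add_distrib]
      exact Finset.sum_congr rfl fun i _ => by simp only [Pi.add_apply]; ring)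
    (fun c u v => by
      rw [smul_eq_mul, Finset.mul_sum]
      exact Finset.sum_congr rfl fun i _ => by simp only [Pi.smul_apply, smul_eq_mul]; ring)

theorem threePlanes_apply (u v : Fin 3 → Fin 2 → F) :
    threePlanes F u v = ∑ i, (u i 0 * v i 1 - u i 1 * v i 0) := rfl

theorem threePlanes_isAlt : (threePlanes F).IsAlt := fun u => by
  simp [threePlanes_apply, mul_comm]

theorem threePlanes_nondegenerate (u : Fin 3 → Fin 2 → F) (hu : ∀ v, threePlanes F u v = 0) :
    u = 0 := by
  funext i j
  have h : ∀ j, threePlanes F u (Pi.single i (Pi.single j 1)) = 0 := fun j => hu _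
  have h0 := h 0
  have h1 := h 1
  rw [threePlanes_apply, Finset.sum_eq_single i (by intro k _ hk; simp [hk]) (by simp)] at h0 h1
  fin_cases j
  · simpa using h1
  · simpa using h0

/-- Block diagonal isometries. -/
def diagIsometry (F : Type*) [Field F] : (Fin 3 → SL(2, F)) →* isometryGroup (threePlanes F) where
  toFun M := isometryGroup.mk
    (LinearMap.pi fun i => Matrix.toLin' (M i).1 ∘ₗ LinearMap.proj i)
    (LinearMap.pi fun i => Matrix.toLin' (M⁻¹ i).1 ∘ₗ LinearMap.proj i)
    (fun v => by
      funext i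
      have h : (M i).1 * (M⁻¹ i).1 = 1 := congrArg Subtype.val (mul_inv_cancel (M i))
      simp only [LinearMap.pi_apply, LinearMap.comp_apply, LinearMap.proj_apply]
      rw [← Matrix.toLin'_mul_apply, h, Matrix.toLin'_one, LinearMap.id_apply])
    (fun v => by
      funext i
      have h : (M⁻¹ i).1 * (M i).1 = 1 := congrArg Subtype.val (inv_mul_cancel (M i))
      simp only [LinearMap.pi_apply, LinearMap.comp_apply, LinearMap.proj_apply]
      rw [← Matrix.toLin'_mul_apply, h, Matrix.toLin'_one, LinearMap.id_apply])
    (fun u v => by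
      rw [threePlanes_apply, threePlanes_apply]
      refine Finset.sum_congr rfl fun i _ => ?_
      have h := (M i).2
      rw [Matrix.det_fin_two] at h
      simp only [LinearMap.pi_apply, LinearMap.comp_apply, LinearMap.proj_apply,
        Matrix.toLin'_apply, Matrix.mulVec, dotProduct, Fin.sum_univ_two]
      linear_combination (u i 0 * v i 1 - u i 1 * v i 0) * h)
  map_one' := by
    ext v
    simp [isometryGroup.mk]
  map_mul' a b := by
    ext v
    simp [isometryGroup.mk]

theorem diagIsometry_apply (M : Fin 3 → SL(2, F)) (u : Fin 3 → Fin 2 → F) (i : Fin 3) :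
    (diagIsometry F M).1 u i = (M i).1.mulVec (u i) := by
  simp [diagIsometry, isometryGroup.mk]

theorem diagIsometry_injective : Function.Injective (diagIsometry F) := by
  intro M N h
  funext i
  ext j k
  have h1 := congrArg (fun g => g.1 (fun _ => Pi.single k 1) i j) h
  simpa [diagIsometry_apply] using h1

/-- Permutations of the three planes. -/
def permIsometry (F : Type*) [Field F] : Equiv.Perm (Fin 3) →* isometryGroup (threePlanes F) where
  toFun σ := isometryGroup.mk (LinearMap.funLeft F _ (σ⁻¹ : Equiv.Perm (Fin 3)))
    (LinearMap.funLeft F _ σ)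
    (fun v => by
      funext i
      simp [LinearMap.funLeft_apply])
    (fun v => by
      funext i
      simp [LinearMap.funLeft_apply])
    (fun u v => by
      rw [threePlanes_apply, threePlanes_apply]
      exact Equiv.sum_comp σ⁻¹ (fun i => u i 0 * v i 1 - u i 1 * v i 0))
  map_one' := rfl
  map_mul' a b := by
    ext v
    simp [isometryGroup.mk, LinearMap.funLeft_apply]

theorem permIsometry_apply (σ : Equiv.Perm (Fin 3)) (u : Fin 3 → Fin 2 → F) (i : Fin 3) :
    (permIsometry F σ).1 u i = u (σ⁻¹ i) := rfl

theorem permIsometry_injective : Function.Injective (permIsometry F) := by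
  intro σ τ h
  have h2 : σ⁻¹ = τ⁻¹ := by
    ext i
    by_contra hne
    have h1 := congrArg (fun g => g.1 (Pi.single (σ⁻¹ i) (fun _ => 1)) i 0) h
    simp only [permIsometry_apply] at h1
    rw [Pi.single_eq_same, Pi.single_eq_of_ne (fun h => hne (by rw [h]))] at h1
    exact one_ne_zero h1
  exact inv_injective h2

theorem permIsometry_conj (σ : Equiv.Perm (Fin 3)) (M : Fin 3 → SL(2, F)) :
    (permIsometry F σ)⁻¹ * diagIsometry F M * permIsometry F σ =
      diagIsometry F (fun i => M (σ i)) := by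
  rw [mul_assoc, inv_mul_eq_iff_eq_mul]
  ext u i
  have hσ : σ (σ⁻¹ i) = i := σ.apply_symm_apply i
  simp only [isometryGroup.mul_apply, permIsometry_apply, diagIsometry_apply, hσ]

theorem not_isPicky_diagIsometry [Finite F] (M : Fin 3 → SL(2, F)) :
    ¬ IsPicky (diagIsometry F M) := by
  intro hM
  have hfin : Finite SL(2, F) := inferInstance
  obtain ⟨k, hk⟩ := hM.exists_pow_eq_one
  rw [← map_pow, ← map_one (diagIsometry F)] at hk
  have hk' : ∀ i, M i ^ 2 ^ k = 1 := fun i => congrFun (diagIsometry_injective hk) i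
  have Q : Sylow 2 SL(2, F) := default
  have hg : ∀ i, ∃ g : SL(2, F), g * M i * g⁻¹ ∈ Q := by
    intro i
    obtain ⟨R, hR⟩ := (isPGroup_zpowers_of_pow_eq_one (hk' i)).exists_le_sylow
    obtain ⟨g, hg⟩ := MulAction.exists_smul_eq SL(2, F) R Q
    refine ⟨g, ?_⟩
    rw [← hg]
    change _ ∈ (g • R).toSubgroup
    rw [Sylow.coe_subgroup_smul, Subgroup.mem_pointwise_smul_iff_inv_smul_mem]
    have h := hR (Subgroup.mem_zpowers (M i))
    simpa [MulAut.smul_def, mul_assoc] using h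
  choose g hg using hg
  have hN := hM.conj (diagIsometry F g)
  rw [← map_inv, ← map_mul, ← map_mul] at hN
  obtain ⟨P, hNP, hP⟩ := hN
  obtain ⟨c, hc⟩ := IsPGroup.iff_card.1 Q.isPGroup'
  have hQ : ∀ A ∈ Q, A ^ 2 ^ c = 1 := by
    intro A hA
    have := pow_card_eq_one' (x := (⟨A, hA⟩ : Q))
    change _ ^ Nat.card (Q : Subgroup SL(2, F)) = 1 at this
    rw [hc] at this
    simpa [Subtype.ext_iff] using this
  set Y := (Subgroup.pi Set.univ fun _ : Fin 3 => (Q : Subgroup SL(2, F))).map (diagIsometry F)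
  have hY : IsPGroup 2 Y := by
    refine IsPGroup.map ?_ _
    rintro ⟨A, hA⟩
    refine ⟨c, Subtype.ext ?_⟩
    funext i
    exact hQ _ (hA i trivial)
  have hperm : ∀ σ : Equiv.Perm (Fin 3), σ ^ 2 ^ 1 = 1 → permIsometry F σ ∈ P := by
    intro σ hσ
    refine mem_of_normalizes hP hY ⟨_, fun i _ => hg i, rfl⟩ (k := 1)
      (by rw [← map_pow, hσ, map_one]) ?_
    rintro _ ⟨A, hA, rfl⟩
    rw [permIsometry_conj]
    exact ⟨_, fun i _ => hA (σ i) trivial, rfl⟩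
  have h := mul_mem (hperm (Equiv.swap 0 1) (by decide)) (hperm (Equiv.swap 1 2) (by decide))
  obtain ⟨j, hj⟩ := exists_pow_eq_one_of_mem_sylow h
  rw [← map_mul, ← map_pow, ← map_one (permIsometry F)] at hj
  have h3 := orderOf_dvd_of_pow_eq_one (permIsometry_injective hj)
  have h4 : orderOf (Equiv.swap 0 1 * Equiv.swap 1 2 : Equiv.Perm (Fin 3)) = 3 :=
    orderOf_eq_prime (by decide) (by decide)
  rw [h4] at h3
  have := (Nat.prime_dvd_prime_iff_eq Nat.prime_three Nat.prime_two).1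
    (Nat.prime_three.dvd_of_dvd_pow h3)
  omega

end Diagonal

section Planes

open Polynomial
open scoped MatrixGroups

variable {F V : Type*} [Field F] [AddCommGroup V] [Module F V] {B : LinearMap.BilinForm F V}

theorem X_pow_card_sub_X_eq_prod (F : Type*) [Field F] [Fintype F] :
    (X ^ Fintype.card F - X : F[X]) = ∏ c : F, (X - C c) := by
  have h1 : 1 < Fintype.card F := Fintype.one_lt_card
  have hm : (X ^ Fintype.card F - X : F[X]).Monic :=
    monic_X_pow_sub (by rw [degree_X]; exact_mod_cast h1)
  have h := prod_multiset_X_sub_C_of_monic_of_roots_card_eq hm (by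
    rw [FiniteField.roots_X_pow_card_sub_X, FiniteField.X_pow_card_sub_X_natDegree_eq F h1]
    rfl)
  rw [FiniteField.roots_X_pow_card_sub_X] at h
  exact h.symm

namespace isometryGroup

/-- A hyperbolic pair spanning a plane invariant under `x`. -/
structure IsInvariantPlane (x : isometryGroup B) (v w : V) : Prop where
  pairing : B v w = 1
  map_left : x.1 v ∈ Submodule.span F {v, w}
  map_right : x.1 w ∈ Submodule.span F {v, w}
  inv_left : (x⁻¹).1 v ∈ Submodule.span F {v, w}
  inv_right : (x⁻¹).1 w ∈ Submodule.span F {v, w}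

variable {x : isometryGroup B}

theorem IsNondegInvariant.exists_plane [Fintype F] (h2 : (2 : F) ≠ 0) (hB : B.IsAlt)
    {U : Submodule F V}
    (hU : IsNondegInvariant x U) (hU0 : U ≠ ⊥)
    (hY : ∀ u ∈ U, aeval (addInv x) (X ^ Fintype.card F - X : F[X]) u = 0) :
    ∃ v ∈ U, ∃ w ∈ U, IsInvariantPlane x v w := by
  classical
  rw [X_pow_card_sub_X_eq_prod] at hY
  obtain ⟨c, u, hu, hu0, hcu⟩ : ∃ c : F, ∃ u ∈ U, u ≠ 0 ∧ aeval (addInv x) (X - C c) u = 0 := by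
    by_contra! hne
    have h : ∀ s : Finset F, ∀ u ∈ U, aeval (addInv x) (∏ c ∈ s, (X - C c)) u = 0 → u = 0 := by
      intro s
      induction s using Finset.induction_on with
      | empty => simp
      | insert c s hc ih =>
        intro u hu hz
        rw [Finset.prod_insert hc, map_mul, Module.End.mul_apply] at hz
        refine ih u hu ?_
        by_contra hz'
        exact hne c _ (hU.aeval_mem _ hu) hz' hz
    exact hU0 ((Submodule.eq_bot_iff _).2 fun u hu => h Finset.univ u hu (hY u hu))
  have hcop : IsCoprime (X - C c) (∏ d ∈ Finset.univ.erase c, (X - C d)) :=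
    IsCoprime.prod_right fun d hd =>
      pairwise_coprime_X_sub_C Function.injective_id (Finset.ne_of_mem_erase hd).symm
  have hW := hU.inf_ker hcop (by
    intro u hu
    rw [Finset.mul_prod_erase Finset.univ (fun d => X - C d) (Finset.mem_univ c)]
    exact hY u hu)
  set W := U ⊓ LinearMap.ker (aeval (addInv x) (X - C c)) with hWdef
  have hWc : ∀ v ∈ W, x.1 v + (x⁻¹).1 v = c • v := by
    intro v hv
    have h := LinearMap.mem_ker.1 hv.2
    rw [map_sub, aeval_X, aeval_C, LinearMap.sub_apply, sub_eq_zero] at h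
    exact h
  have huW : u ∈ W := ⟨hu, hcu⟩
  by_cases hex : ∃ v ∈ W, B v (x.1 v) ≠ 0
  · obtain ⟨v, hv, hb⟩ := hex
    set b := B v (x.1 v) with hbdef
    have hinv : (x⁻¹).1 v = c • v - x.1 v := by rw [← hWc v hv]; abel
    have hsq : x.1 (x.1 v) = c • x.1 v - v := by
      have h := congrArg x.1 hinv
      rw [apply_inv_self, map_sub, map_smul] at h
      exact eq_sub_of_add_eq' (eq_sub_iff_add_eq.1 h)
    refine ⟨v, hv.1, b⁻¹ • x.1 v, U.smul_mem _ (hU.map_mem v hv.1), ?_, ?_, ?_, ?_, ?_⟩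
    · rw [map_smul, smul_eq_mul, inv_mul_cancel₀ hb]
    · exact Submodule.mem_span_pair.2 ⟨0, b, by rw [smul_smul, mul_inv_cancel₀ hb]; simp⟩
    · refine Submodule.mem_span_pair.2 ⟨-b⁻¹, c, ?_⟩
      rw [map_smul, hsq]
      module
    · refine Submodule.mem_span_pair.2 ⟨c, -b, ?_⟩
      rw [hinv, smul_smul, neg_mul, mul_inv_cancel₀ hb]
      module
    · refine Submodule.mem_span_pair.2 ⟨b⁻¹, 0, ?_⟩
      rw [map_smul, inv_apply_self]
      module
  · push Not at hex
    have hx : ∀ v ∈ W, x.1 v = (2⁻¹ * c) • v ∧ (x⁻¹).1 v = (2⁻¹ * c) • v := by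
      intro v hv
      have h1 := hW.eq_inv_of_forall hB hex hv
      have h3 := hWc v hv
      have h4 : x.1 v = (2⁻¹ * c) • v := by
        rw [mul_smul, ← h3, ← h1, ← two_smul F, smul_smul, inv_mul_cancel₀ h2, one_smul]
      exact ⟨h4, h1 ▸ h4⟩
    obtain ⟨w, hw, huw⟩ : ∃ w ∈ W, B u w ≠ 0 := by
      by_contra! h
      exact hu0 (hW.nondeg u huW h)
    have hw' : (B u w)⁻¹ • w ∈ W := W.smul_mem _ hw
    refine ⟨u, hu, (B u w)⁻¹ • w, hw'.1, ?_, ?_, ?_, ?_, ?_⟩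
    · rw [map_smul, smul_eq_mul, inv_mul_cancel₀ huw]
    · rw [(hx _ huW).1]
      exact Submodule.smul_mem _ _ (Submodule.subset_span (by simp))
    · rw [(hx _ hw').1]
      exact Submodule.smul_mem _ _ (Submodule.subset_span (by simp))
    · rw [(hx _ huW).2]
      exact Submodule.smul_mem _ _ (Submodule.subset_span (by simp))
    · rw [(hx _ hw').2]
      exact Submodule.smul_mem _ _ (Submodule.subset_span (by simp))

theorem IsNondegInvariant.inf_plane (hB : B.IsAlt) {U : Submodule F V}
    (hU : IsNondegInvariant x U) {v w : V} (hv : v ∈ U) (hw : w ∈ U)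
    (h : IsInvariantPlane x v w) :
    IsNondegInvariant x (U ⊓ (LinearMap.ker (B v) ⊓ LinearMap.ker (B w))) := by
  have hspan : ∀ u ∈ U ⊓ (LinearMap.ker (B v) ⊓ LinearMap.ker (B w)),
      ∀ z ∈ Submodule.span F {v, w}, B z u = 0 := by
    rintro u ⟨-, hu1, hu2⟩ z hz
    obtain ⟨a, b, rfl⟩ := Submodule.mem_span_pair.1 hz
    simp [LinearMap.mem_ker.1 hu1, LinearMap.mem_ker.1 hu2]
  have hwv : B w v = -1 := by rw [← LinearMap.IsAlt.neg hB, h.pairing]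
  refine ⟨fun u hu => ⟨hU.map_mem u hu.1, ?_, ?_⟩, fun u hu => ⟨hU.inv_mem u hu.1, ?_, ?_⟩, ?_⟩
  · change B v (x.1 u) = 0
    rw [apply_right]
    exact hspan u hu _ h.inv_left
  · change B w (x.1 u) = 0
    rw [apply_right]
    exact hspan u hu _ h.inv_right
  · change B v ((x⁻¹).1 u) = 0
    rw [← apply_left]
    exact hspan u hu _ h.map_left
  · change B w ((x⁻¹).1 u) = 0
    rw [← apply_left]
    exact hspan u hu _ h.map_right
  · intro u hu hz
    refine hU.nondeg u hu.1 fun z hzU => ?_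
    have h1 := hz (z - B z w • v + B z v • w) ⟨add_mem (sub_mem hzU (U.smul_mem _ hv))
      (U.smul_mem _ hw), by
        change B v _ = 0
        have := LinearMap.IsAlt.neg hB v z
        simp [hB v, h.pairing]
        linear_combination -this, by
        change B w _ = 0
        have := LinearMap.IsAlt.neg hB w z
        simp [hB w, hwv]
        linear_combination -this⟩
    have h3 : B u v = 0 := by
      rw [← LinearMap.IsAlt.neg hB, LinearMap.mem_ker.1 hu.2.1, neg_zero]
    have h4 : B u w = 0 := by
      rw [← LinearMap.IsAlt.neg hB, LinearMap.mem_ker.1 hu.2.2, neg_zero]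
    simpa [h3, h4] using h1

theorem finrank_le_finrank_inf_plane [FiniteDimensional F V] (hB : B.IsAlt) {U : Submodule F V}
    {v w : V} (hv : v ∈ U) (hw : w ∈ U) (h : B v w = 1) :
    Module.finrank F U ≤
      Module.finrank F ↥(U ⊓ (LinearMap.ker (B v) ⊓ LinearMap.ker (B w))) + 2 := by
  classical
  have hwv : B w v = -1 := by rw [← LinearMap.IsAlt.neg hB, h]
  have hle : U ≤ (U ⊓ (LinearMap.ker (B v) ⊓ LinearMap.ker (B w))) ⊔ Submodule.span F {v, w} := by
    intro z hzU
    have hz : z = (z - B z w • v + B z v • w) + (B z w • v - B z v • w) := by abel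
    rw [hz]
    refine Submodule.add_mem_sup ⟨add_mem (sub_mem hzU (U.smul_mem _ hv))
      (U.smul_mem _ hw), ?_, ?_⟩ ?_
    · change B v _ = 0
      have := LinearMap.IsAlt.neg hB v z
      simp [hB v, h]
      linear_combination -this
    · change B w _ = 0
      have := LinearMap.IsAlt.neg hB w z
      simp [hB w, hwv]
      linear_combination -this
    · exact Submodule.mem_span_pair.2 ⟨B z w, -B z v, by module⟩
  have h1 := Submodule.finrank_mono hle
  have h2 := Submodule.finrank_add_le_finrank_add_finrank
    (U ⊓ (LinearMap.ker (B v) ⊓ LinearMap.ker (B w))) (Submodule.span F {v, w})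
  have h3 : Module.finrank F (Submodule.span F ({v, w} : Set V)) ≤ 2 := by
    have := finrank_span_finset_le_card (R := F) ({v, w} : Finset V)
    rw [Finset.coe_pair] at this
    exact this.trans Finset.card_le_two
  omega

/-- An isometry respecting three pairwise orthogonal invariant planes is not picky. -/
theorem not_isPicky_of_planes [Finite F] (hB : B.IsAlt) (v w : Fin 3 → V)
    (hp : ∀ i, IsInvariantPlane x (v i) (w i))
    (ho : ∀ i j, i ≠ j → B (v i) (v j) = 0 ∧ B (v i) (w j) = 0 ∧ B (w i) (w j) = 0) :
    ¬ IsPicky x := by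
  intro hx
  choose a c hac using fun i => Submodule.mem_span_pair.1 (hp i).map_left
  choose b d hbd using fun i => Submodule.mem_span_pair.1 (hp i).map_right
  have hvv : ∀ i j, B (v i) (v j) = 0 := fun i j => by
    by_cases hij : i = j
    · rw [hij]; exact hB _
    · exact (ho i j hij).1
  have hww : ∀ i j, B (w i) (w j) = 0 := fun i j => by
    by_cases hij : i = j
    · rw [hij]; exact hB _
    · exact (ho i j hij).2.2
  have hvw : ∀ i j, B (v i) (w j) = if i = j then 1 else 0 := fun i j => by
    split_ifs with hij
    · rw [hij]; exact (hp j).pairing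
    · exact (ho i j hij).2.1
  have hwv : ∀ i j, B (w i) (v j) = if i = j then -1 else 0 := fun i j => by
    rw [← LinearMap.IsAlt.neg hB, hvw]
    split_ifs with h1 h2 h2
    · rfl
    · exact absurd h1.symm h2
    · exact absurd h2.symm h1
    · exact neg_zero
  have hdet : ∀ i, a i * d i - b i * c i = 1 := by
    intro i
    have h := x.2 (v i) (w i)
    rw [(hp i).pairing, ← hac, ← hbd] at h
    simp [hvv, hww, hvw, hwv] at h
    linear_combination h
  let M : Fin 3 → SL(2, F) := fun i =>
    ⟨!![a i, b i; c i, d i], by rw [Matrix.det_fin_two_of]; exact hdet i⟩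
  let ι : (Fin 3 → Fin 2 → F) →ₗ[F] V :=
    ∑ i, (LinearMap.toSpanSingleton F V (v i) ∘ₗ LinearMap.proj (φ := fun _ => F) (0 : Fin 2) ∘ₗ
        LinearMap.proj i +
      LinearMap.toSpanSingleton F V (w i) ∘ₗ LinearMap.proj (φ := fun _ => F) (1 : Fin 2) ∘ₗ
        LinearMap.proj i)
  have hι : ∀ u, ι u = ∑ i, (u i 0 • v i + u i 1 • w i) := fun u => by
    simp [ι]
  refine not_isPicky_diagIsometry M (hx.of_embedding hB threePlanes_isAlt
    threePlanes_nondegenerate ι (fun u z => ?_) fun u => ?_)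
  · rw [hι, hι, threePlanes_apply]
    simp [hvv, hww, hvw, hwv, Fin.sum_univ_three]
    ring
  · rw [hι, hι, map_sum]
    refine Finset.sum_congr rfl fun i _ => ?_
    rw [map_add, map_smul, map_smul, ← hac, ← hbd, diagIsometry_apply]
    simp [M, Matrix.mulVec, dotProduct, Fin.sum_univ_two]
    module

theorem IsNondegInvariant.not_isPicky_of_five_le_finrank [Fintype F] [FiniteDimensional F V]
    (h2 : (2 : F) ≠ 0) (hB : B.IsAlt) {U : Submodule F V} (hU : IsNondegInvariant x U)
    (hY : ∀ u ∈ U, aeval (addInv x) (X ^ Fintype.card F - X : F[X]) u = 0)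
    (hdim : 5 ≤ Module.finrank F U) : ¬ IsPicky x := by
  have hne : ∀ W : Submodule F V, 1 ≤ Module.finrank F W → W ≠ ⊥ := by
    rintro W hW rfl
    simp at hW
  have hsymm : ∀ u v, B u v = 0 → B v u = 0 := fun u v h => by
    rw [← LinearMap.IsAlt.neg hB, h, neg_zero]
  obtain ⟨v₁, hv₁, w₁, hw₁, h₁⟩ := hU.exists_plane h2 hB (hne _ (by omega)) hY
  have hU₁ := hU.inf_plane hB hv₁ hw₁ h₁
  have hd₁ := finrank_le_finrank_inf_plane hB hv₁ hw₁ h₁.pairing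
  obtain ⟨v₂, hv₂, w₂, hw₂, h₂⟩ := hU₁.exists_plane h2 hB (hne _ (by omega)) fun u hu => hY u hu.1
  have hU₂ := hU₁.inf_plane hB hv₂ hw₂ h₂
  have hd₂ := finrank_le_finrank_inf_plane hB hv₂ hw₂ h₂.pairing
  obtain ⟨v₃, hv₃, w₃, hw₃, h₃⟩ :=
    hU₂.exists_plane h2 hB (hne _ (by omega)) fun u hu => hY u hu.1.1
  have e1 : B v₁ v₂ = 0 := hv₂.2.1
  have e2 : B w₁ v₂ = 0 := hv₂.2.2
  have e3 : B v₁ w₂ = 0 := hw₂.2.1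
  have e4 : B w₁ w₂ = 0 := hw₂.2.2
  have e5 : B v₁ v₃ = 0 := hv₃.1.2.1
  have e6 : B w₁ v₃ = 0 := hv₃.1.2.2
  have e7 : B v₁ w₃ = 0 := hw₃.1.2.1
  have e8 : B w₁ w₃ = 0 := hw₃.1.2.2
  have e9 : B v₂ v₃ = 0 := hv₃.2.1
  have e10 : B w₂ v₃ = 0 := hv₃.2.2
  have e11 : B v₂ w₃ = 0 := hw₃.2.1
  have e12 : B w₂ w₃ = 0 := hw₃.2.2
  refine not_isPicky_of_planes hB ![v₁, v₂, v₃] ![w₁, w₂, w₃] (fun i => ?_) (fun i j hij => ?_)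
  · fin_cases i
    exacts [h₁, h₂, h₃]
  · fin_cases i <;> fin_cases j <;>
      first
        | exact absurd rfl hij
        | simp [e1, e3, e4, e5, e7, e8, e9, e11, e12, hsymm _ _ e1, hsymm _ _ e2,
            hsymm _ _ e4, hsymm _ _ e5, hsymm _ _ e6, hsymm _ _ e8, hsymm _ _ e9,
            hsymm _ _ e10, hsymm _ _ e12]

end isometryGroup

end Planes

section ScaledForm

open scoped MatrixGroups

variable {F L : Type*} [Field F] [Field L] [Algebra F L]

/-- The form `μ (u₀ v₁ - u₁ v₀)` on `L²`, viewed as a space over the subfield `F`. -/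
def scaledForm (μ : L →ₗ[F] F) : LinearMap.BilinForm F (Fin 2 → L) :=
  LinearMap.mk₂ F (fun u v => μ (u 0 * v 1 - u 1 * v 0))
    (fun u v w => by rw [← map_add]; congr 1; simp only [Pi.add_apply]; ring)
    (fun c u v => by
      change μ _ = c • μ _
      rw [← map_smul]
      congr 1
      simp only [Pi.smul_apply, smul_mul_assoc, smul_sub])
    (fun u v w => by rw [← map_add]; congr 1; simp only [Pi.add_apply]; ring)
    (fun c u v => by
      change μ _ = c • μ _
      rw [← map_smul]
      congr 1
      simp only [Pi.smul_apply, mul_smul_comm, smul_sub])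

theorem scaledForm_apply (μ : L →ₗ[F] F) (u v : Fin 2 → L) :
    scaledForm μ u v = μ (u 0 * v 1 - u 1 * v 0) := rfl

theorem scaledForm_isAlt (μ : L →ₗ[F] F) : (scaledForm μ).IsAlt := fun u => by
  simp [scaledForm_apply, mul_comm]

theorem scaledForm_nondegenerate {μ : L →ₗ[F] F} {l : L} (hl : μ l ≠ 0) (u : Fin 2 → L)
    (hu : ∀ v, scaledForm μ u v = 0) : u = 0 := by
  funext i
  by_contra hi
  change u i ≠ 0 at hi
  fin_cases i
  · apply hl
    have h := hu ![0, (u 0)⁻¹ * l]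
    simpa [scaledForm_apply, mul_inv_cancel_left₀ (show u 0 ≠ 0 from hi)] using h
  · apply hl
    have h := hu ![(u 1)⁻¹ * l, 0]
    simpa [scaledForm_apply, mul_inv_cancel_left₀ (show u 1 ≠ 0 from hi)] using h

/-- The action of `SL(2, L)` by isometries of the scaled form. -/
def slIsometry (μ : L →ₗ[F] F) : SL(2, L) →* isometryGroup (scaledForm μ) where
  toFun M := isometryGroup.mk ((Matrix.toLin' M.1).restrictScalars F)
    ((Matrix.toLin' (M⁻¹).1).restrictScalars F)
    (fun v => by
      have h : M.1 * (M⁻¹).1 = 1 := congrArg Subtype.val (mul_inv_cancel M)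
      rw [LinearMap.restrictScalars_apply, LinearMap.restrictScalars_apply,
        ← Matrix.toLin'_mul_apply, h, Matrix.toLin'_one, LinearMap.id_apply])
    (fun v => by
      have h : (M⁻¹).1 * M.1 = 1 := congrArg Subtype.val (inv_mul_cancel M)
      rw [LinearMap.restrictScalars_apply, LinearMap.restrictScalars_apply,
        ← Matrix.toLin'_mul_apply, h, Matrix.toLin'_one, LinearMap.id_apply])
    (fun u v => by
      rw [scaledForm_apply, scaledForm_apply]
      congr 1
      have h := M.2
      rw [Matrix.det_fin_two] at h
      simp only [LinearMap.restrictScalars_apply,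
        Matrix.toLin'_apply, Matrix.mulVec, dotProduct, Fin.sum_univ_two]
      linear_combination (u 0 * v 1 - u 1 * v 0) * h)
  map_one' := by
    ext v
    simp [isometryGroup.mk]
  map_mul' a b := by
    ext v
    simp [isometryGroup.mk]

theorem slIsometry_apply (μ : L →ₗ[F] F) (M : SL(2, L)) (u : Fin 2 → L) :
    (slIsometry μ M).1 u = M.1.mulVec u := rfl

theorem slIsometry_injective (μ : L →ₗ[F] F) : Function.Injective (slIsometry μ) := by
  intro M N h
  ext j k
  have h1 := congrArg (fun g => g.1 (Pi.single k 1) j) h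
  simpa [slIsometry_apply] using h1

end ScaledForm

namespace isometryGroup

open Polynomial

variable {F V : Type*} [Field F] [AddCommGroup V] [Module F V] {B : LinearMap.BilinForm F V}
  {x : isometryGroup B}

theorem exists_adjoinRoot_orbit (x : isometryGroup B) {g : F[X]} {w : V}
    (hw : aeval (addInv x) g w = 0) :
    ∃ s : AdjoinRoot g →ₗ[F] V, ∀ p, s (AdjoinRoot.mk g p) = aeval (addInv x) p w := by
  have hwell : ∀ p p', AdjoinRoot.mk g p = AdjoinRoot.mk g p' →
      aeval (addInv x) p w = aeval (addInv x) p' w := by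
    intro p p' h
    obtain ⟨r, hr⟩ := AdjoinRoot.mk_eq_mk.1 h
    rw [← sub_eq_zero, ← LinearMap.sub_apply, ← map_sub, hr, mul_comm, map_mul,
      Module.End.mul_apply, hw, map_zero]
  choose r hr using AdjoinRoot.mk_surjective (g := g)
  refine ⟨{ toFun := fun l => aeval (addInv x) (r l) w, map_add' := ?_, map_smul' := ?_ }, ?_⟩
  · intro l l'
    rw [← LinearMap.add_apply, ← map_add]
    exact hwell _ _ (by rw [map_add, hr, hr, hr])
  · intro c l
    rw [RingHom.id_apply, ← LinearMap.smul_apply, ← map_smul]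
    refine hwell _ _ ?_
    rw [hr, smul_eq_C_mul, map_mul, hr, AdjoinRoot.mk_C, Algebra.smul_def]
    rfl
  · intro p
    exact hwell _ _ (hr _)

theorem aeval_isotropic (h2 : (2 : F) ≠ 0) (hB : B.IsAlt) (x : isometryGroup B) (p p' : F[X])
    (v : V) : B (aeval (addInv x) p v) (aeval (addInv x) p' v) = 0 := by
  have h1 : B (aeval (addInv x) p v) (aeval (addInv x) p' v) =
      B v (aeval (addInv x) (p * p') v) := by
    rw [aeval_adjoint, map_mul, Module.End.mul_apply]
  rw [h1]
  have h3 := aeval_adjoint x (p * p') v v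
  rw [← LinearMap.IsAlt.neg hB] at h3
  have h4 : (2 : F) * B v (aeval (addInv x) (p * p') v) = 0 := by linear_combination -h3
  exact (mul_eq_zero.1 h4).resolve_left h2

theorem apply_sq (x : isometryGroup B) (v : V) :
    x.1 (x.1 v) = addInv x (x.1 v) - v := by
  rw [addInv_apply, inv_apply_self, add_sub_cancel_right]

theorem isPicky_companion (h2 : (2 : F) ≠ 0) (hB : B.IsAlt) (hx : IsPicky x) {g : F[X]}
    [Fact (Irreducible g)] {v : V} (hv : aeval (addInv x) g v = 0) (hvx : B v (x.1 v) ≠ 0) :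
    IsPicky (companionSL (AdjoinRoot.root g)) := by
  obtain ⟨s, hs⟩ := exists_adjoinRoot_orbit x hv
  have hv' : aeval (addInv x) g (x.1 v) = 0 := by rw [← apply_aeval, hv, map_zero]
  obtain ⟨t, ht⟩ := exists_adjoinRoot_orbit x hv'
  have hss : ∀ a b, B (s a) (s b) = 0 := by
    intro a b
    obtain ⟨p, rfl⟩ := AdjoinRoot.mk_surjective a
    obtain ⟨p', rfl⟩ := AdjoinRoot.mk_surjective b
    rw [hs, hs, aeval_isotropic h2 hB]
  have htt : ∀ a b, B (t a) (t b) = 0 := by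
    intro a b
    obtain ⟨p, rfl⟩ := AdjoinRoot.mk_surjective a
    obtain ⟨p', rfl⟩ := AdjoinRoot.mk_surjective b
    rw [ht, ht, aeval_isotropic h2 hB]
  let μ : AdjoinRoot g →ₗ[F] F := (B.flip (x.1 v)) ∘ₗ s
  have hμ : ∀ a, μ a = B (s a) (x.1 v) := fun a => rfl
  have hst : ∀ a b, B (s a) (t b) = μ (a * b) := by
    intro a b
    obtain ⟨p, rfl⟩ := AdjoinRoot.mk_surjective a
    obtain ⟨p', rfl⟩ := AdjoinRoot.mk_surjective b
    rw [hμ, ← map_mul, hs, hs, ht, ← aeval_adjoint, mul_comm, map_mul, Module.End.mul_apply]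
  have hxs : ∀ a, x.1 (s a) = t a := by
    intro a
    obtain ⟨p, rfl⟩ := AdjoinRoot.mk_surjective a
    rw [hs, ht, apply_aeval]
  have hxt : ∀ a, x.1 (t a) = t (AdjoinRoot.root g * a) - s a := by
    intro a
    obtain ⟨p, rfl⟩ := AdjoinRoot.mk_surjective a
    rw [← AdjoinRoot.mk_X, ← map_mul, hs, ht, ht, apply_aeval, apply_sq, map_sub, mul_comm X,
      map_mul, aeval_X, Module.End.mul_apply]
  have hμ1 : μ 1 ≠ 0 := by
    rw [hμ, ← map_one (AdjoinRoot.mk g), hs, map_one]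
    exact hvx
  let ι : (Fin 2 → AdjoinRoot g) →ₗ[F] V :=
    s ∘ₗ LinearMap.proj (φ := fun _ => AdjoinRoot g) (0 : Fin 2) +
      t ∘ₗ LinearMap.proj (φ := fun _ => AdjoinRoot g) (1 : Fin 2)
  have hι : ∀ u, ι u = s (u 0) + t (u 1) := fun u => rfl
  have hfd : Module.Finite F (AdjoinRoot g) :=
    (AdjoinRoot.powerBasis (Fact.out : Irreducible g).ne_zero).finite
  have hy : IsPicky (slIsometry μ (companionSL (AdjoinRoot.root g))) := by
    refine hx.of_embedding hB (scaledForm_isAlt μ) (scaledForm_nondegenerate hμ1) ι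
      (fun u w => ?_) fun u => ?_
    · rw [hι, hι, scaledForm_apply, map_add, map_add, LinearMap.add_apply, LinearMap.add_apply,
        hss, htt, hst, ← LinearMap.IsAlt.neg hB, hst, map_sub, mul_comm (u 1)]
      ring
    · rw [hι, hι, map_add, hxs, hxt, slIsometry_apply]
      simp [companionSL, Matrix.mulVec, dotProduct, Fin.sum_univ_two]
      abel
  obtain ⟨k, hk⟩ := hy.exists_pow_eq_one
  rw [← map_pow, ← map_one (slIsometry μ)] at hk
  refine hy.of_injective _ (slIsometry_injective μ) ⟨k, slIsometry_injective μ hk⟩ fun h => ?_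
  rw [inv_mul_cancel]
  exact Commute.one_left _

theorem irreducible_dvd_of_isPicky [Fintype F] (hodd : Fintype.card F % 2 = 1) (h2 : (2 : F) ≠ 0)
    (hB : B.IsAlt) (hBn : ∀ u, (∀ v, B u v = 0) → u = 0) (hx : IsPicky x) {g h : F[X]}
    (hg : Irreducible g) (hgh : IsCoprime g h) (hz : ∀ u, aeval (addInv x) (g * h) u = 0)
    {u : V} (hu : u ≠ 0) (hgu : aeval (addInv x) g u = 0) :
    g ∣ X ^ Fintype.card F - X ∨ Fintype.card F = 3 ∧ g ∣ X ^ 2 + 1 := by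
  classical
  have hscalar : g ∣ X ^ 2 - 4 → g ∣ X ^ Fintype.card F - X := by
    intro hd
    have hroot : ∀ c : F, (X - C c) ∣ X ^ Fintype.card F - X := fun c => by
      rw [dvd_iff_isRoot]
      simp [IsRoot, FiniteField.pow_card]
    have hfac : (X ^ 2 - 4 : F[X]) = (X - C 2) * (X - C (-2)) := by
      simp only [map_neg, map_ofNat]
      ring
    rw [hfac] at hd
    rcases hg.prime.dvd_or_dvd hd with hd | hd
    · exact hd.trans (hroot _)
    · exact hd.trans (hroot _)
  have hW := (isNondegInvariant_top (x := x) hBn).inf_ker hgh fun u _ => hz u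
  by_cases hex : ∃ v, aeval (addInv x) g v = 0 ∧ B v (x.1 v) ≠ 0
  swap
  · push Not at hex
    left
    apply hscalar
    by_contra hnd
    obtain ⟨a, b, hab⟩ := (hg.coprime_iff_not_dvd.2 hnd)
    have hxu := hW.eq_inv_of_forall hB (fun v hv => hex v hv.2) (u := u) ⟨trivial, hgu⟩
    have h1 : x.1 (x.1 u) = u := by rw [hxu, apply_inv_self]
    have h3 : (x⁻¹).1 ((x⁻¹).1 u) = u := by rw [← hxu, inv_apply_self]
    have h4 : aeval (addInv x) (X ^ 2 - 4 : F[X]) u = 0 := by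
      have : (4 : F[X]) = C 4 := (map_ofNat C 4).symm
      rw [this, map_sub, map_pow, aeval_X, aeval_C, LinearMap.sub_apply, pow_two,
        Module.End.mul_apply, addInv_apply, addInv_apply, map_add, map_add, h1, h3,
        apply_inv_self, inv_apply_self, Module.algebraMap_end_apply]
      module
    apply hu
    have h5 := LinearMap.congr_fun (congrArg (aeval (addInv x)) hab) u
    rw [map_add, map_mul, map_mul, LinearMap.add_apply, Module.End.mul_apply,
      Module.End.mul_apply, hgu, h4, map_zero, map_zero, add_zero, map_one] at h5
    exact h5.symm
  · obtain ⟨v, hv, hvx⟩ := hex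
    have hfact := Fact.mk hg
    have hpick := isPicky_companion h2 hB hx hv hvx
    set ρ := AdjoinRoot.root g with hρdef
    have hdvd : ∀ p : F[X], aeval ρ p = 0 → g ∣ p := fun p hp => by
      rwa [hρdef, AdjoinRoot.aeval_eq, AdjoinRoot.mk_eq_zero] at hp
    by_cases hρ : ρ ^ 2 = 4
    · left
      exact hscalar (hdvd _ (by rw [map_sub, map_pow, aeval_X, hρ, map_ofNat, sub_self]))
    have hfd : Module.Finite F (AdjoinRoot g) := (AdjoinRoot.powerBasis hg.ne_zero).finite
    have hfin : Finite (AdjoinRoot g) := Module.finite_of_finite F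
    have hft : Fintype (AdjoinRoot g) := Fintype.ofFinite _
    have hcard : Fintype.card (AdjoinRoot g) = Fintype.card F ^ g.natDegree := by
      rw [Module.card_eq_pow_finrank (K := F), (AdjoinRoot.powerBasis hg.ne_zero).finrank,
        AdjoinRoot.powerBasis_dim]
    have hoddF : Odd (Fintype.card F) := Nat.odd_iff.2 hodd
    have hF3 : 3 ≤ Fintype.card F := by
      have := Fintype.one_lt_card (α := F)
      omega
    have hm1 : g.natDegree = 1 → g ∣ X ^ Fintype.card F - X := by
      intro hm
      rw [hm, pow_one] at hcard
      apply hdvd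
      rw [map_sub, map_pow, aeval_X, ← hcard, FiniteField.pow_card, sub_self]
    have hm0 : 0 < g.natDegree := hg.natDegree_pos
    rcases card_dvd_of_picky_companion
      (by rw [hcard]; exact Nat.odd_iff.1 hoddF.pow) hρ hpick with ⟨ω, hω, j, hj⟩ | ⟨j, hj⟩
    · by_cases hm : g.natDegree = 1
      · exact Or.inl (hm1 hm)
      rw [hcard] at hj
      obtain ⟨hq, hm⟩ := eq_three_of_pow_sub_one_dvd_two_pow hoddF hF3 (by omega) hj
      rw [hq, hm] at hcard
      have hω0 : ω ≠ 0 := by rintro rfl; simp at hω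
      have h8 : ω ^ 8 = 1 := by
        have := FiniteField.pow_card_sub_one_eq_one ω hω0
        rwa [hcard] at this
      have h3F : (3 : F) = 0 := by
        have := Nat.cast_card_eq_zero F
        rw [hq] at this
        exact_mod_cast this
      have h3 : (3 : AdjoinRoot g) = 0 := by
        rw [← map_ofNat (algebraMap F (AdjoinRoot g)) 3]
        exact (congrArg (algebraMap F (AdjoinRoot g)) h3F).trans (map_zero _)
      have h88 : (ω ^ 4 - 1) * (ω ^ 4 + 1) = 0 := by linear_combination h8
      have hρω : ω * ρ = ω ^ 2 + 1 := by linear_combination -hω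
      rcases mul_eq_zero.1 h88 with h4 | h4
      · left
        apply hdvd
        rw [hq, map_sub, map_pow, aeval_X]
        apply (mul_eq_zero.1 (?_ : ω ^ 3 * (ρ ^ 3 - ρ) = 0)).resolve_left (pow_ne_zero _ hω0)
        have e : ω ^ 3 * (ρ ^ 3 - ρ) = (ω * ρ) ^ 3 - ω ^ 2 * (ω * ρ) := by ring
        rw [e, hρω]
        linear_combination (ω ^ 2 - 1) * h4 + (ω ^ 4 + ω ^ 2) * h3
      · right
        refine ⟨hq, hdvd _ ?_⟩
        rw [map_add, map_pow, aeval_X, map_one]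
        apply (mul_eq_zero.1 (?_ : ω ^ 2 * (ρ ^ 2 + 1) = 0)).resolve_left (pow_ne_zero _ hω0)
        have e : ω ^ 2 * (ρ ^ 2 + 1) = (ω * ρ) ^ 2 + ω ^ 2 := by ring
        rw [e, hρω]
        linear_combination h4 + ω ^ 2 * h3
    · by_cases hm : g.natDegree = 1
      · exact Or.inl (hm1 hm)
      rw [hcard] at hj
      exact (not_pow_add_one_dvd_two_pow hoddF hF3 (by omega) hj).elim

theorem addInv_minpoly_squarefree [FiniteDimensional F V] (h2 : (2 : F) ≠ 0) (hx : IsPicky x) :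
    Squarefree (minpoly F (addInv x)) := by
  obtain ⟨k, hk⟩ := hx.exists_pow_eq_one
  set f : Module.End F V := (x.1 : V →ₗ[F] V)
  have hpow : ∀ (m : ℕ) v, (f ^ m) v = (x ^ m).1 v := by
    intro m
    induction m with
    | zero => intro v; rfl
    | succ m ih => intro v; rw [pow_succ, Module.End.mul_apply, ih, pow_succ]; rfl
  have hsep : (X ^ 2 ^ k - 1 : F[X]).Separable := by
    rw [X_pow_sub_one_separable_iff]
    exact_mod_cast pow_ne_zero k h2
  have hss : f.IsSemisimple := by
    refine Module.End.isSemisimple_of_squarefree_aeval_eq_zero hsep.squarefree ?_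
    ext v
    simp [hpow, hk]
  have hY : addInv x = aeval f (X + X ^ (2 ^ k - 1) : F[X]) := by
    ext v
    have h1 : x⁻¹ = x ^ (2 ^ k - 1) := by
      rw [inv_eq_iff_mul_eq_one, ← pow_succ', Nat.sub_add_cancel Nat.one_le_two_pow, hk]
    rw [map_add, map_pow, aeval_X, LinearMap.add_apply, hpow, ← h1]
    rfl
  rw [hY]
  exact (hss.aeval _).minpoly_squarefree

theorem minpoly_dvd_of_isPicky [Fintype F] [FiniteDimensional F V]
    (hodd : Fintype.card F % 2 = 1) (h2 : (2 : F) ≠ 0)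
    (hB : B.IsAlt) (hBn : ∀ u, (∀ v, B u v = 0) → u = 0) (hx : IsPicky x) {R : F[X]} (hR : R ≠ 0)
    (hR1 : X ^ Fintype.card F - X ∣ R) (hR2 : Fintype.card F = 3 → X ^ 2 + 1 ∣ R) :
    minpoly F (addInv x) ∣ R := by
  classical
  have hsf := addInv_minpoly_squarefree h2 hx
  have hint : IsIntegral F (addInv x) := Algebra.IsIntegral.isIntegral _
  have hm0 := minpoly.ne_zero hint
  rw [UniqueFactorizationMonoid.dvd_iff_normalizedFactors_le_normalizedFactors hm0 hR,
    Multiset.le_iff_subset ((UniqueFactorizationMonoid.squarefree_iff_nodup_normalizedFactors hm0).1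
      hsf)]
  intro g hg
  have hgi := UniqueFactorizationMonoid.irreducible_of_normalized_factor g hg
  have hgn := UniqueFactorizationMonoid.normalize_normalized_factor g hg
  obtain ⟨h, hh⟩ := UniqueFactorizationMonoid.dvd_of_mem_normalizedFactors hg
  have hgR : g ∣ R := by
    have hcop : IsCoprime g h := by
      rw [hgi.coprime_iff_not_dvd]
      rintro ⟨r, hr⟩
      exact hgi.not_isUnit (hsf g ⟨r, by rw [hh, hr]; ring⟩)
    have hh0 : aeval (addInv x) h ≠ 0 := by
      intro h0
      have hd := minpoly.dvd F _ h0
      have : g ∣ h := (Dvd.intro _ hh.symm).trans hd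
      exact (hgi.coprime_iff_not_dvd.1 hcop) this
    obtain ⟨w, hw⟩ : ∃ w, aeval (addInv x) h w ≠ 0 := by
      by_contra! hc
      exact hh0 (LinearMap.ext hc)
    have hz : ∀ u, aeval (addInv x) (g * h) u = 0 := fun u => by
      rw [← hh, minpoly.aeval]; rfl
    rcases irreducible_dvd_of_isPicky hodd h2 hB hBn hx hgi hcop hz hw
      (by rw [← Module.End.mul_apply, ← map_mul, hz]) with h1 | ⟨h1, h3⟩
    · exact h1.trans hR1
    · exact h3.trans (hR2 h1)
  exact (UniqueFactorizationMonoid.mem_normalizedFactors_iff' hR).2 ⟨hgi, hgn, hgR⟩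

end isometryGroup

namespace isometryGroup

open Polynomial

variable {F V : Type*} [Field F] [AddCommGroup V] [Module F V] {B : LinearMap.BilinForm F V}
  {x : isometryGroup B}

/-- In characteristic three, the involution acting as `-1` on the span of `e, e₁, f, f₁` and
trivially on its orthogonal complement. -/
theorem exists_involution (h3 : (3 : F) = 0) (hB : B.IsAlt) {e e₁ f f₁ : V}
    (hef : B e f = 1) (hef₁ : B e f₁ = 0) (he₁f : B e₁ f = 0) (he₁f₁ : B e₁ f₁ = -1)
    (hee : B e e₁ = 0) (hff : B f f₁ = 0)
    (hxe : x.1 e = -e₁ - e) (hxe₁ : x.1 e₁ = e - e₁) (hxf : x.1 f = f - f₁)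
    (hxf₁ : x.1 f₁ = f + f₁) :
    ∃ R : isometryGroup B, R ^ 2 ^ 1 = 1 ∧ Commute R x ∧
      ∀ v, R.1 v = v + (B v f • e - B v f₁ • e₁ - B v e • f + B v e₁ • f₁) := by
  have hsw : ∀ {u v : V} {a : F}, B u v = a → B v u = -a := fun {u v a} h => by
    rw [← LinearMap.IsAlt.neg hB, h]
  have h3v : ∀ v : V, (3 : F) • v = 0 := fun v => by rw [h3, zero_smul]
  let N : V →ₗ[F] V := (B.flip f).smulRight e - (B.flip f₁).smulRight e₁ -
    (B.flip e).smulRight f + (B.flip e₁).smulRight f₁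
  have hN : ∀ v, N v = B v f • e - B v f₁ • e₁ - B v e • f + B v e₁ • f₁ := fun v => rfl
  have hNe : N e = e := by
    simp [hN, hef, hef₁, hee, hB e]
  have hNe₁ : N e₁ = e₁ := by
    simp [hN, he₁f, he₁f₁, hsw hee, hB e₁]
  have hNf : N f = f := by
    simp [hN, hff, hsw hef, hsw he₁f, hB f]
  have hNf₁ : N f₁ = f₁ := by
    simp [hN, hsw hff, hsw hef₁, hsw he₁f₁, hB f₁]
  have hNN : ∀ v, N (N v) = N v := fun v => by
    conv_lhs => rw [hN v]
    rw [map_add, map_sub, map_sub, map_smul, map_smul, map_smul, map_smul, hNe, hNe₁, hNf, hNf₁,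
      hN]
  have hadj : ∀ u v, B (N u) v = B u (N v) := fun u v => by
    rw [hN, hN]
    simp only [map_add, map_sub, map_smul, LinearMap.add_apply, LinearMap.sub_apply,
      LinearMap.smul_apply, smul_eq_mul, ← LinearMap.IsAlt.neg hB v]
    ring
  have hinv : ∀ v, (LinearMap.id + N : V →ₗ[F] V) ((LinearMap.id + N : V →ₗ[F] V) v) = v :=
      fun v => by
    simp only [LinearMap.add_apply, LinearMap.id_apply, map_add, hNN]
    linear_combination (norm := module) h3v (N v)
  have hiso : ∀ u v, B ((LinearMap.id + N : V →ₗ[F] V) u) ((LinearMap.id + N : V →ₗ[F] V) v) =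
      B u v := fun u v => by
    simp only [LinearMap.add_apply, LinearMap.id_apply, map_add, hadj, hNN]
    linear_combination B u (N v) * h3
  refine ⟨isometryGroup.mk _ _ hinv hinv hiso, ?_, ?_, fun v => rfl⟩
  · rw [pow_one, pow_two]
    ext v
    exact hinv v
  · have hxi : ∀ {u v}, x.1 v = u → (x⁻¹).1 u = v := fun {u v} h => by rw [← h, inv_apply_self]
    have ie : (x⁻¹).1 e = e - e₁ := hxi (by
      rw [map_sub, hxe, hxe₁]; linear_combination (norm := module) -h3v e)
    have ie₁ : (x⁻¹).1 e₁ = e + e₁ := hxi (by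
      rw [map_add, hxe, hxe₁]; linear_combination (norm := module) -h3v e₁)
    have jf : (x⁻¹).1 f = -f - f₁ := hxi (by
      rw [map_sub, map_neg, hxf, hxf₁]; linear_combination (norm := module) -h3v f)
    have jf₁ : (x⁻¹).1 f₁ = f - f₁ := hxi (by
      rw [map_sub, hxf, hxf₁]; linear_combination (norm := module) -h3v f₁)
    ext v
    change x.1 v + N (x.1 v) = x.1 (v + N v)
    rw [map_add, hN, hN]
    simp only [apply_left, ie, ie₁, jf, jf₁, map_add, map_sub, map_neg, map_smul, hxe, hxe₁, hxf,
      hxf₁]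
    module

theorem finrank_le_of_pairing [FiniteDimensional F V] (B : LinearMap.BilinForm F V)
    (S T : Submodule F V)
    (h : ∀ u ∈ S, (∀ v ∈ T, B u v = 0) → u = 0) : Module.finrank F S ≤ Module.finrank F T := by
  rw [← Subspace.dual_finrank_eq (V := T)]
  refine LinearMap.finrank_le_finrank_of_injective
    (f := T.dualRestrict ∘ₗ B ∘ₗ S.subtype) ?_
  refine (injective_iff_map_eq_zero _).2 fun u hu => Subtype.ext (h u u.2 fun v hv => ?_)
  exact LinearMap.congr_fun hu ⟨v, hv⟩

theorem IsNondegInvariant.not_isPicky_of_sq_eq_neg_one [Fintype F] [FiniteDimensional F V]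
    (hF : Fintype.card F = 3) (hB : B.IsAlt) {U : Submodule F V} (hU : IsNondegInvariant x U)
    (hY : ∀ u ∈ U, addInv x (addInv x u) = -u) (hdim : 5 ≤ Module.finrank F U) :
    ¬ IsPicky x := by
  rintro ⟨P, hxP, hP⟩
  have h3 : (3 : F) = 0 := by
    have := Nat.cast_card_eq_zero F
    rw [hF] at this
    exact_mod_cast this
  have h2 : (2 : F) = -1 := by linear_combination h3
  have h3v : ∀ v : V, (3 : F) • v = 0 := fun v => by rw [h3, zero_smul]
  let Z : V →ₗ[F] V := (x.1 : V →ₗ[F] V) - ((x⁻¹).1 : V →ₗ[F] V)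
  have hZ : ∀ u, Z u = x.1 u - (x⁻¹).1 u := fun u => rfl
  have hZadj : ∀ u v, B (Z u) v = -B u (Z v) := fun u v => by
    have h := apply_right x u v
    rw [hZ, hZ, map_sub, map_sub, LinearMap.sub_apply, apply_left, h]
    ring
  have hxx : ∀ u ∈ U, x.1 (x.1 u) + (x⁻¹).1 ((x⁻¹).1 u) = (-3 : F) • u := fun u hu => by
    have h := hY u hu
    rw [addInv_apply, addInv_apply, map_add, map_add, apply_inv_self, inv_apply_self] at h
    linear_combination (norm := module) h
  have hZZ : ∀ u ∈ U, Z (Z u) = u := fun u hu => by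
    rw [hZ, hZ, map_sub, map_sub, apply_inv_self, inv_apply_self]
    linear_combination (norm := module) hxx u hu - (2 : F) • h3v u
  have hZY : ∀ u, Z (addInv x u) = addInv x (Z u) := fun u => by
    rw [hZ, hZ, addInv_apply, addInv_apply, map_add, map_add, map_sub, map_sub, apply_inv_self,
      inv_apply_self]
    abel
  have hZU : ∀ u ∈ U, Z u ∈ U := fun u hu => sub_mem (hU.map_mem u hu) (hU.inv_mem u hu)
  let Ep : Submodule F V := U ⊓ LinearMap.ker (Z - LinearMap.id)
  let Em : Submodule F V := U ⊓ LinearMap.ker (Z + LinearMap.id)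
  have hEp : ∀ {u}, u ∈ Ep ↔ u ∈ U ∧ Z u = u := fun {u} => by
    simp [Ep, sub_eq_zero]
  have hEm : ∀ {u}, u ∈ Em ↔ u ∈ U ∧ Z u = -u := fun {u} => by
    simp [Em, add_eq_zero_iff_eq_neg]
  have hdec : ∀ u ∈ U, ∃ v ∈ Ep, ∃ w ∈ Em, u = v + w := fun u hu => by
    refine ⟨-(u + Z u), hEp.2 ⟨neg_mem (add_mem hu (hZU u hu)), ?_⟩,
      -(u - Z u), hEm.2 ⟨neg_mem (sub_mem hu (hZU u hu)), ?_⟩, ?_⟩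
    · rw [map_neg, map_add, hZZ u hu]; abel
    · rw [map_neg, map_sub, hZZ u hu]; abel
    · linear_combination (norm := module) h3v u
  have hself : ∀ {a : F}, a = -a → a = 0 := fun {a} h => by
    linear_combination a * h3 - h
  have hpp : ∀ u ∈ Ep, ∀ v ∈ Ep, B u v = 0 := fun u hu v hv => hself (by
    have h := hZadj u v
    rwa [(hEp.1 hu).2, (hEp.1 hv).2] at h)
  have hmm : ∀ u ∈ Em, ∀ v ∈ Em, B u v = 0 := fun u hu v hv => hself (by
    have h := hZadj u v
    rw [(hEm.1 hu).2, (hEm.1 hv).2] at h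
    simp only [map_neg, LinearMap.neg_apply] at h
    linear_combination -h)
  have hpn : ∀ u ∈ Ep, (∀ v ∈ Em, B u v = 0) → u = 0 := fun u hu h =>
    hU.nondeg u hu.1 fun v hv => by
      obtain ⟨p, hp, m, hm, rfl⟩ := hdec v hv
      rw [map_add, hpp u hu p hp, h m hm, add_zero]
  have hmn : ∀ u ∈ Em, (∀ v ∈ Ep, B u v = 0) → u = 0 := fun u hu h =>
    hU.nondeg u hu.1 fun v hv => by
      obtain ⟨p, hp, m, hm, rfl⟩ := hdec v hv
      rw [map_add, hmm u hu m hm, h p hp, add_zero]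
  have hd1 := finrank_le_of_pairing B Ep Em hpn
  have hd2 := finrank_le_of_pairing B Em Ep hmn
  have hd3 := (Submodule.finrank_mono (show U ≤ Ep ⊔ Em from fun u hu => by
    obtain ⟨p, hp, m, hm, rfl⟩ := hdec u hu
    exact Submodule.add_mem_sup hp hm)).trans (Submodule.finrank_add_le_finrank_add_finrank Ep Em)
  have hYp : ∀ u ∈ Ep, addInv x u ∈ Ep := fun u hu =>
    hEp.2 ⟨hU.addInv_mem hu.1, by rw [hZY, (hEp.1 hu).2]⟩
  have hYm : ∀ u ∈ Em, addInv x u ∈ Em := fun u hu =>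
    hEm.2 ⟨hU.addInv_mem hu.1, by rw [hZY, (hEm.1 hu).2, map_neg]⟩
  have hxp : ∀ u ∈ Ep, x.1 u = -addInv x u - u := fun u hu => by
    have h := (hEp.1 hu).2
    rw [hZ] at h
    rw [addInv_apply]
    linear_combination (norm := module) h3v (x.1 u) - h
  have hxm : ∀ u ∈ Em, x.1 u = u - addInv x u := fun u hu => by
    have h := (hEm.1 hu).2
    rw [hZ] at h
    rw [addInv_apply]
    linear_combination (norm := module) h3v (x.1 u) - h
  have hne : Em ≠ ⊥ := by
    intro h
    rw [h, finrank_bot] at hd1 hd3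
    omega
  obtain ⟨f, hf, hf0⟩ := (Submodule.ne_bot_iff _).1 hne
  obtain ⟨e₀, he₀, hef₀⟩ : ∃ e ∈ Ep, B e f ≠ 0 := by
    by_contra! h
    exact hf0 (hmn f hf fun v hv => by rw [← LinearMap.IsAlt.neg hB, h v hv, neg_zero])
  set a := B e₀ f with ha
  set b := B (addInv x e₀) f with hb
  have hab : a ^ 2 + b ^ 2 ≠ 0 := by
    have hpow : ∀ c : F, c ^ 3 = c := fun c => by
      have := FiniteField.pow_card c
      rwa [hF] at this
    have ha2 : a ^ 2 = 1 := by
      apply mul_left_cancel₀ hef₀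
      linear_combination hpow a
    intro h
    by_cases hb0 : b = 0
    · rw [ha2, hb0] at h
      simp at h
    · have hb2 : b ^ 2 = 1 := by
        apply mul_left_cancel₀ hb0
        linear_combination hpow b
      rw [ha2, hb2] at h
      exact one_ne_zero (α := F) (by linear_combination h3 - h)
  obtain ⟨e, he, hef, hYef⟩ : ∃ e ∈ Ep, B e f = 1 ∧ B (addInv x e) f = 0 := by
    refine ⟨(a ^ 2 + b ^ 2)⁻¹ • (a • e₀ + b • addInv x e₀), Ep.smul_mem _
      (add_mem (Ep.smul_mem _ he₀) (Ep.smul_mem _ (hYp _ he₀))), ?_, ?_⟩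
    · simp only [map_smul, map_add, LinearMap.add_apply, LinearMap.smul_apply, smul_eq_mul,
        ← ha, ← hb]
      rw [← inv_mul_cancel₀ hab]
      ring
    · simp only [map_smul, map_add, LinearMap.add_apply, LinearMap.smul_apply, smul_eq_mul,
        hY e₀ he₀.1, map_neg, LinearMap.neg_apply, ← ha, ← hb]
      ring
  obtain ⟨d, hd, hd0, hdf, hYdf⟩ : ∃ d ∈ Ep, d ≠ 0 ∧ B d f = 0 ∧ B (addInv x d) f = 0 := by
    let φ : Ep →ₗ[F] F × F :=
      ((B.flip f) ∘ₗ Ep.subtype).prod ((B.flip f) ∘ₗ addInv x ∘ₗ Ep.subtype)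
    have hφ : LinearMap.ker φ ≠ ⊥ := LinearMap.ker_ne_bot_of_finrank_lt (by
      rw [Module.finrank_prod, Module.finrank_self]
      omega)
    obtain ⟨d, hd, hd0⟩ := (Submodule.ne_bot_iff _).1 hφ
    have h := LinearMap.mem_ker.1 hd
    exact ⟨d, d.2, fun h0 => hd0 (Subtype.ext h0), congrArg Prod.fst h, congrArg Prod.snd h⟩
  have hinvol : ∀ e ∈ Ep, B e f = 1 → B (addInv x e) f = 0 →
      ∃ R ∈ P, ∀ v, R.1 v = v + (B v f • e - B v (addInv x f) • addInv x e - B v e • f +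
        B v (addInv x e) • addInv x f) := by
    intro e he hef hYef
    obtain ⟨R, hR2, hRx, hR⟩ := exists_involution (x := x) h3 hB hef
      (by rw [← addInv_adjoint, hYef]) hYef
      (by rw [← addInv_adjoint, hY e he.1, map_neg, LinearMap.neg_apply, hef])
      (hpp _ he _ (hYp _ he)) (hmm _ hf _ (hYm _ hf)) (hxp e he)
      (by rw [hxp _ (hYp e he), hY e he.1, neg_neg]) (hxm f hf)
      (by rw [hxm _ (hYm f hf), hY f hf.1, sub_neg_eq_add, add_comm])
    exact ⟨R, mem_of_commute hP hxP hR2 hRx, hR⟩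
  obtain ⟨R, hRP, hR⟩ := hinvol e he hef hYef
  obtain ⟨S, hSP, hS⟩ := hinvol (e + d) (add_mem he hd)
    (by rw [map_add, LinearMap.add_apply, hef, hdf, add_zero])
    (by rw [map_add, map_add, LinearMap.add_apply, hYef, hYdf, add_zero])
  have hef₁ : B e (addInv x f) = 0 := by rw [← addInv_adjoint, hYef]
  have hdf₁ : B d (addInv x f) = 0 := by rw [← addInv_adjoint, hYdf]
  have hRe : R.1 e = -e := by
    rw [hR, hef, hef₁, hB e, hpp _ he _ (hYp _ he)]
    linear_combination (norm := module) h3v e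
  have hRd : R.1 d = d := by
    rw [hR, hdf, hdf₁, hpp _ hd _ he, hpp _ hd _ (hYp _ he)]
    module
  have hed := add_mem he hd
  have hSe : S.1 e = -e + d := by
    rw [hS, hef, hef₁, hpp _ he _ hed, hpp _ he _ (hYp _ hed)]
    linear_combination (norm := module) h3v e
  have hSd : S.1 d = d := by
    rw [hS, hdf, hdf₁, hpp _ hd _ hed, hpp _ hd _ (hYp _ hed)]
    module
  obtain ⟨k, hk⟩ := exists_pow_eq_one_of_mem_sylow (mul_mem hSP hRP)
  have hpow : ∀ m : ℕ, ((S * R) ^ m).1 e = e - (m : F) • d := by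
    intro m
    induction m with
    | zero => simp
    | succ m ih =>
      rw [pow_succ', mul_apply, ih, mul_apply, map_sub, map_sub, map_smul, map_smul, hRe, hRd,
        map_neg, hSe, hSd]
      push_cast
      module
  have h := hpow (2 ^ k)
  rw [hk] at h
  have h' : ((2 ^ k : ℕ) : F) • d = 0 := sub_eq_self.1 h.symm
  refine hd0 ((smul_eq_zero.1 h').resolve_left ?_)
  push_cast
  rw [h2]
  exact pow_ne_zero _ (neg_ne_zero.2 one_ne_zero)

theorem not_isPicky_of_finrank [Fintype F] [FiniteDimensional F V]
    (hodd : Odd (Fintype.card F)) (hB : B.IsAlt) (hBn : ∀ u, (∀ v, B u v = 0) → u = 0)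
    (hdim : 12 ≤ Module.finrank F V) : ¬ IsPicky x := by
  intro hx
  have hodd' : Fintype.card F % 2 = 1 := Nat.odd_iff.1 hodd
  have h2 : (2 : F) ≠ 0 := fun h => by
    have h1 := Nat.cast_card_eq_zero F
    obtain ⟨k, hk⟩ := hodd
    rw [hk] at h1
    push_cast at h1
    rw [h, zero_mul, zero_add] at h1
    exact one_ne_zero h1
  have htop := isNondegInvariant_top (x := x) hBn
  have hX0 : (X ^ Fintype.card F - X : F[X]) ≠ 0 :=
    FiniteField.X_pow_card_sub_X_ne_zero F Fintype.one_lt_card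
  by_cases hF : Fintype.card F = 3
  swap
  · have hd := minpoly_dvd_of_isPicky hodd' h2 hB hBn hx hX0 dvd_rfl fun h => absurd h hF
    have hz := (minpoly.dvd_iff).1 hd
    refine htop.not_isPicky_of_five_le_finrank h2 hB (fun u _ => ?_)
      (by rw [finrank_top]; omega) hx
    rw [hz]
    rfl
  · have hX1 : (X ^ 2 + 1 : F[X]) ≠ 0 := by
      have : (X ^ 2 + 1 : F[X]).Monic := by monicity!
      exact this.ne_zero
    have hd := minpoly_dvd_of_isPicky hodd' h2 hB hBn hx (mul_ne_zero hX0 hX1)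
      (dvd_mul_right _ _) fun _ => dvd_mul_left _ _
    have hz := (minpoly.dvd_iff).1 hd
    have h3 : (3 : F[X]) = 0 := by
      have := Nat.cast_card_eq_zero F
      rw [hF] at this
      rw [← map_ofNat C 3]
      exact (congrArg C (show (3 : F) = 0 by exact_mod_cast this)).trans (map_zero C)
    have hcop : IsCoprime (X ^ Fintype.card F - X : F[X]) (X ^ 2 + 1) := by
      refine ⟨-X, 1 + X ^ 2, ?_⟩
      rw [hF]
      linear_combination X ^ 2 * h3
    have hV1 := htop.inf_ker hcop fun u _ => by rw [hz]; rfl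
    have hV2 := htop.inf_ker hcop.symm fun u _ => by rw [mul_comm, hz]; rfl
    rw [top_inf_eq] at hV1 hV2
    by_cases h5 : 5 ≤ Module.finrank F
        ↥(LinearMap.ker (aeval (addInv x) (X ^ Fintype.card F - X : F[X])))
    · exact hV1.not_isPicky_of_five_le_finrank h2 hB (fun u hu => hu) h5 hx
    refine hV2.not_isPicky_of_sq_eq_neg_one hF hB (fun u hu => ?_) ?_ hx
    · have h := LinearMap.mem_ker.1 hu
      rw [map_add, map_pow, aeval_X, map_one, pow_two] at h
      exact eq_neg_of_add_eq_zero_left h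
    · have h := Polynomial.sup_ker_aeval_eq_ker_aeval_mul_of_coprime (addInv x) hcop
      rw [hz, LinearMap.ker_zero] at h
      have h1 := Submodule.finrank_add_le_finrank_add_finrank
        (LinearMap.ker (aeval (addInv x) (X ^ Fintype.card F - X : F[X])))
        (LinearMap.ker (aeval (addInv x) (X ^ 2 + 1 : F[X])))
      rw [h, finrank_top] at h1
      omega

end isometryGroup

/-- `Sp_{2n}(𝔽_q)` for `q` odd and `n ≥ 6` has no picky `2`-element: no element of
`2`-power order lies in a unique Sylow `2`-subgroup. -/
theorem no_picky_two_element_Sp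
    (q : ℕ) (hq : IsPrimePow q) (hodd : Odd q) (n : ℕ) (hn : 6 ≤ n)
    (F : Type*) [Field F] [Fintype F] [DecidableEq F] (hF : Fintype.card F = q)
    (x : Matrix.symplecticGroup (Fin n) F) (hx : ∃ k : ℕ, orderOf x = 2 ^ k) :
    ¬ ∃! P : Sylow 2 (Matrix.symplecticGroup (Fin n) F), x ∈ P := by
  subst hF
  intro hpick
  have hpick : IsPicky x := hpick
  obtain ⟨y, rfl⟩ := toSymplecticGroup_bijective.2 x
  obtain ⟨k, hk⟩ := hpick.exists_pow_eq_one
  refine isometryGroup.not_isPicky_of_finrank (x := y) hodd stdForm_isAlt stdForm_nondegenerate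
    ?_ (hpick.of_injective (toSymplecticGroup n F) toSymplecticGroup_bijective.1 ⟨k, ?_⟩ ?_)
  · rw [Module.finrank_fintype_fun_eq_card, Fintype.card_sum, Fintype.card_fin]
    omega
  · exact toSymplecticGroup_bijective.1 (by rw [map_pow, hk, map_one])
  · intro h
    rw [inv_mul_cancel]
    exact Commute.one_left _
end
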